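/- Let C be an absolutely irreducible plane algebraic curve of degree d in P^2 over F_q, where q is a prime power, with simple tangency, and let e ∈ ℕ. Then for every k ∈ {0,…,de} the limit p_k(C,e) of the probabilities that a random plane curve of degree e over F_{q^N} meets C in exactly k points exists and equals Σ_{s=k}^{de} ((−1)^{k+s}/s!)·binom(s,k). -/

import Mathlib

set_option linter.unusedSectionVars false
section Frozen
open MvPolynomial Filter


namespace IncidenceProb

variable {K : Type} [Field K] {ι κ : Type} [Fintype ι] [Fintype κ]

/-- The common zero set in `K^ι` of a family of polynomials. -/
def zeroLocus (S : Set (MvPolynomial ι K)) : Set (ι → K) :=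
  {x | ∀ p ∈ S, eval x p = 0}

/-- The ideal of all polynomials vanishing on a subset of `K^ι`. -/
def vanishingIdeal (V : Set (ι → K)) : Ideal (MvPolynomial ι K) where
  carrier := {p | ∀ x ∈ V, eval x p = 0}
  add_mem' := by
    intro a b ha hb x hx
    simp only [Set.mem_setOf_eq] at ha hb ⊢
    simp [map_add, ha x hx, hb x hx]
  zero_mem' := by intro x hx; simp
  smul_mem' := by
    intro c p hp x hx
    simp only [Set.mem_setOf_eq] at hp ⊢
    simp [smul_eq_mul, hp x hx]

lemma mem_vanishingIdeal {V : Set (ι → K)} {p : MvPolynomial ι K} :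
    p ∈ vanishingIdeal V ↔ ∀ x ∈ V, eval x p = 0 := Iff.rfl

/-- A subset of `K^ι` is an (affine) algebraic set if it is the zero locus of a
family of polynomials. -/
def IsAlgebraicSet (V : Set (ι → K)) : Prop :=
  ∃ S : Set (MvPolynomial ι K), V = zeroLocus S

/-- The coordinate ring of a subset of affine space. -/
abbrev coordRing (V : Set (ι → K)) : Type :=
  MvPolynomial ι K ⧸ vanishingIdeal V

/-- The Zariski topology on affine space `K^ι`: the open sets are generated by the
complements of hypersurfaces. -/
def zariskiTopology (K ι : Type) [Field K] : TopologicalSpace (ι → K) :=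
  TopologicalSpace.generateFrom
    {U | ∃ p : MvPolynomial ι K, U = {x | eval x p ≠ 0}}

/-- Irreducibility of a subset of affine space with respect to the Zariski topology. -/
def IsIrreducibleSet (V : Set (ι → K)) : Prop :=
  letI := zariskiTopology K ι
  IsIrreducible V

/-- The irreducible components of a subset of affine space: the maximal irreducible
subsets (with respect to the Zariski topology). -/
def irreducibleComponentsOf (V : Set (ι → K)) : Set (Set (ι → K)) :=
  letI := zariskiTopology K ι
  {Z | Maximal (fun T => T ⊆ V ∧ IsIrreducible T) Z}

end IncidenceProb

namespace IncidenceProb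

/-- The projective plane over `K`. -/
abbrev P2 (K : Type) [Field K] : Type := Projectivization K (Fin 3 → K)

variable {K : Type} [Field K]

/-- A point of the projective plane lies on the curve cut out by the homogeneous
polynomial `Q`. -/
def OnCurve (Q : MvPolynomial (Fin 3) K) (x : P2 K) : Prop :=
  MvPolynomial.eval x.rep Q = 0

/-- Incidence between a point `L` of the dual projective plane (i.e. a line) and a
point `x` of the projective plane. -/
def Incid (L x : P2 K) : Prop :=
  ∑ i, L.rep i * x.rep i = 0

/-- The probability that a random line of `ℙ²(K)` meets the plane curve `{Q = 0}` in
exactly `k` points: the number of such lines divided by `q² + q + 1`, the total number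
of lines of `ℙ²(K)` (where `q = |K|`). -/
noncomputable def probLine (K : Type) [Field K] [Fintype K]
    (Q : MvPolynomial (Fin 3) K) (k : ℕ) : ℝ :=
  (Nat.card {L : P2 K // Nat.card {x : P2 K // OnCurve Q x ∧ Incid L x} = k} : ℝ) /
    ((Fintype.card K : ℝ) ^ 2 + (Fintype.card K : ℝ) + 1)

/-- Simple tangency for the plane curve of degree `d` cut out by `Q` (to be applied over
an algebraically closed field): there is a line meeting the curve in exactly `d - 1`
points, all of them smooth points of the curve, which is transversal at all of them
except exactly one, where it is tangent.  (At a smooth point, the line `a` is tangent to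
the curve exactly when the gradient of `Q` there is proportional to `a`; the tangency
point then has intersection multiplicity `2`, since the total intersection multiplicity
is `d`.) -/
def SimpleTangencyPlane (d : ℕ) (Q : MvPolynomial (Fin 3) K) : Prop :=
  ∃ a : Fin 3 → K, a ≠ 0 ∧
    Nat.card {x : P2 K // OnCurve Q x ∧ (∑ i, a i * x.rep i = 0)} = d - 1 ∧
    (∀ x : P2 K, OnCurve Q x → (∑ i, a i * x.rep i = 0) →
      (fun r => MvPolynomial.eval x.rep (MvPolynomial.pderiv r Q)) ≠ 0) ∧
    ∃ x₀ : P2 K, (OnCurve Q x₀ ∧ (∑ i, a i * x₀.rep i = 0)) ∧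
      (∃ c : K, (fun r => MvPolynomial.eval x₀.rep (MvPolynomial.pderiv r Q)) = c • a) ∧
      ∀ x : P2 K, OnCurve Q x → (∑ i, a i * x.rep i = 0) →
        (∃ c : K, (fun r => MvPolynomial.eval x.rep (MvPolynomial.pderiv r Q)) = c • a) →
        x = x₀

end IncidenceProb

namespace IncidenceProb

/-- The probability that a random plane curve of degree `e` over `K` (i.e. a nonzero
homogeneous polynomial of degree `e` up to scalars) meets the plane curve `{Q = 0}` in
exactly `k` points, the denominator being the number of plane curves of degree `e`
over `K`. -/
noncomputable def probCurve (K : Type) [Field K] [Fintype K]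
    (Q : MvPolynomial (Fin 3) K) (e k : ℕ) : ℝ :=
  (Nat.card {E : Projectivization K (MvPolynomial.homogeneousSubmodule (Fin 3) K e) //
      Nat.card {x : P2 K //
        MvPolynomial.eval x.rep Q = 0 ∧ MvPolynomial.eval x.rep (E.rep : MvPolynomial (Fin 3) K) = 0} = k} : ℝ) /
    (Nat.card (Projectivization K (MvPolynomial.homogeneousSubmodule (Fin 3) K e)) : ℝ)
end IncidenceProb
end Frozen

section Mine
local notation "mRH" => Polynomial.mapRingHom
local notation "eRH" => Polynomial.evalRingHom
local notation "mev" => MvPolynomial.eval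
local notation "mmap" => MvPolynomial.map
local notation "aM" => algebraMap
open Finset (univ mem_univ sum_congr mem_filter card_univ mul_prod_erase prod_eq_zero mul_sum mem_erase prod_ne_zero_iff range prod_eq_zero_iff sum_eq_single card_filter sum_const ne_of_mem_erase sum_add_distrib card_le_card mem_map sum_eq_zero sum_mul sum_comm card_filter_le prod_mul_distrib finsuppAntidiag le_sup sum_sub_distrib prod_congr Icc mem_range card_filter_add_card_filter_not card_union_le prod_const card_map)
open Function (Injective)
open Fintype (card card_fin card_perm linearCombination_apply sum_equiv card_fun linearCombination card_subtype card_coe)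
open Equiv (Perm mulLeft subtypeEquiv)
open AdjoinRoot (mk mk_surjective mk_eq_zero lift_of lift_mk)
open Polynomial (map_map isUnit_C induction_on' map_id trdeg_of_isDomain ringHom_ext')
open MvPolynomial (pderiv mem_homogeneousSubmodule rename homogeneousSubmodule eval_eq' isHomogeneous_C_mul_X pderiv_mul pderiv_X isHomogeneous_one)
open Nat (card_eq_fintype_card cast_pow cast_mul cast_nonneg card_congr one_lt_pow card_le_card_of_injective cast_le le_mul_of_pos_left lt_succ_of_le factorial_ne_zero card_eq_of_bijective)
open Pi (single single_apply single_eq_same single_eq_of_ne)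
open Subtype (val val_injective)
open IsFractionRing (injective)
open RingHom (comp_apply map_det mapMatrix_apply)
open IsAlgClosed (splits lift)
open Matrix (cons_val mulVec mul_nonsing_inv nonsing_inv_mul mulVec_mulVec one_mulVec)
open Multiset (mem_toFinset toFinset_card_le)
open Algebra (smul_def)
open AlgHom (toLinearMap_apply)
open Module (IsTorsionFree)
open Projectivization (exists_smul_eq_mk_rep mk_eq_mk_iff')


namespace IncidenceProb

section Step
open Polynomial

variable {k : Type} [Field k]

def wt (w m : ℕ) : Submodule k k[X][X] where
  carrier := {G | ∀ j a, m < a + w * j → (G.coeff j).coeff a = 0}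
  add_mem' := by
    intro a b ha hb j i h
    simp [ha j i h, hb j i h]
  zero_mem' := by intro j i h; simp
  smul_mem' := by
    intro c x hx j i h
    simp [hx j i h]

lemma wt_mul {w m m' : ℕ} {F G : k[X][X]} (hF : F ∈ wt w m) (hG : G ∈ wt w m') :
    F * G ∈ wt w (m + m') := by
  intro j a h
  rw [coeff_mul, finsetSum_coeff]
  refine sum_eq_zero fun x hx => ?_
  rw [coeff_mul]
  refine sum_eq_zero fun y hy => ?_
  rw [Finset.HasAntidiagonal.mem_antidiagonal] at hx hy
  by_cases h1 : m < y.1 + w * x.1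
  · rw [hF _ _ h1, zero_mul]
  · rw [hG x.2 y.2 (by rw [← hx, ← hy, mul_add] at h; omega), mul_zero]

lemma wt_pow {w m : ℕ} {F : k[X][X]} (hF : F ∈ wt w m) (n : ℕ) : F ^ n ∈ wt w (n * m) := by
  induction n with
  | zero =>
    intro j a h
    rw [pow_zero, coeff_one]
    split_ifs with hj
    · subst hj; rw [coeff_one, if_neg]; omega
    · simp
  | succ n ih => rw [pow_succ, add_mul, one_mul]; exact wt_mul ih hF

lemma wt_mono {w m m' : ℕ} (h : m ≤ m') : (wt w m : Submodule k k[X][X]) ≤ wt w m' :=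
  fun _ hF j a h' => hF j a (by omega)

lemma wt_of_le {w m D E : ℕ} {G : k[X][X]} (h1 : G.natDegree ≤ E)
    (h2 : ∀ j, (G.coeff j).natDegree ≤ D) (hm : D + w * E ≤ m) : G ∈ wt w m := by
  intro j a h
  by_cases hj : j ≤ E
  · apply coeff_eq_zero_of_natDegree_lt
    have := Nat.mul_le_mul_left w hj
    have := h2 j; omega
  · rw [coeff_eq_zero_of_natDegree_lt (p := G) (by omega)]; simp

lemma exists_wt (w : ℕ) (G : k[X][X]) : ∃ m, G ∈ wt w m :=
  ⟨_, wt_of_le le_rfl (fun j => by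
    by_cases h : j ∈ G.support
    · exact le_sup (f := fun j => (G.coeff j).natDegree) h
    · simp [notMem_support_iff.1 h]) le_rfl⟩

variable {R : k[X][X]} {r w : ℕ}

lemma wt_red (hR : R.Monic) (hr : R.natDegree = r) (hw : ∀ j, (R.coeff j).natDegree ≤ w)
    {m : ℕ} (n : ℕ) : ∀ G : k[X][X], G.natDegree < n → G ∈ wt w m →
    ∃ G' ∈ wt w m, G'.degree < R.degree ∧ mk R G' = mk R G := by
  induction n with
  | zero => intro G h; omega
  | succ n ih =>
    intro G hn hG
    by_cases hd : G.degree < R.degree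
    · exact ⟨G, hG, hd, rfl⟩
    have hd' : R.degree ≤ G.degree := not_lt.1 hd
    have hR0 : R ≠ 0 := hR.ne_zero
    have hG0 : G ≠ 0 := by
      rintro rfl; rw [degree_zero, le_bot_iff, degree_eq_bot] at hd'; exact hR0 hd'
    have hrn : r ≤ G.natDegree := hr ▸ natDegree_le_natDegree hd'
    have hlt := div_wf_lemma ⟨hd', hG0⟩ hR
    set S := C G.leadingCoeff * X ^ (G.natDegree - R.natDegree) with hS
    have hRw : R ∈ wt w (w * r) := by
      intro j a h
      rcases lt_trichotomy j r with h1 | h1 | h1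
      · apply coeff_eq_zero_of_natDegree_lt
        have := hw j
        obtain ⟨c, rfl⟩ := Nat.exists_eq_add_of_lt h1
        nlinarith
      · subst h1; rw [← hr, hR.coeff_natDegree, coeff_one, if_neg]; omega
      · rw [coeff_eq_zero_of_natDegree_lt (p := R) (by omega)]; simp
    have hm : w * r ≤ m := by
      by_contra hcon
      apply hG0
      rw [← leadingCoeff_eq_zero]
      ext a
      rw [leadingCoeff, hG _ _ ?_, coeff_zero]
      have := Nat.mul_le_mul_left w hrn
      omega
    have hSw : S ∈ wt w (m - w * r) := by
      intro j a h
      rw [hS, coeff_C_mul_X_pow]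
      split_ifs with hj
      · apply hG
        have : w * j + w * r = w * G.natDegree := by rw [← mul_add, hj, hr]; congr 1; omega
        omega
      · simp
    have hG2 : G - R * S ∈ wt w m := by
      refine Submodule.sub_mem _ hG ?_
      have := wt_mul hRw hSw
      rwa [Nat.add_sub_cancel' hm] at this
    by_cases h0 : (G - R * S) = 0
    · refine ⟨0, Submodule.zero_mem _, ?_, ?_⟩
      · rw [degree_zero]; exact bot_lt_iff_ne_bot.2 (by simpa using hR0)
      · rw [sub_eq_zero] at h0; rw [h0]; simp
    obtain ⟨G', h1, h2, h3⟩ := ih (G - R * S) (by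
      have := natDegree_lt_natDegree h0 hlt
      omega) hG2
    exact ⟨G', h1, h2, by rw [h3]; simp⟩

noncomputable def boxP (k : Type) [Field k] (r m : ℕ) : (Fin r × Fin (m+1) → k) →ₗ[k] k[X][X] :=
  linearCombination k (fun x : Fin r × Fin (m+1) => (C (X ^ (x.2:ℕ)) * X ^ (x.1:ℕ) : k[X][X]))

noncomputable def mkL (R : k[X][X]) : k[X][X] →ₗ[k] AdjoinRoot R where
  toFun := mk R
  map_add' := by simp
  map_smul' := by
    intro c x
    rw [RingHom.id_apply, smul_def, smul_def, map_mul]; rfl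

lemma boxP_coeff (m : ℕ) (c : Fin r × Fin (m+1) → k) (j a : ℕ) :
    ((boxP k r m c).coeff j).coeff a =
      if h : j < r ∧ a < m + 1 then c (⟨j, h.1⟩, ⟨a, h.2⟩) else 0 := by
  rw [boxP, linearCombination_apply, finsetSum_coeff, finsetSum_coeff]
  have : ∀ x : Fin r × Fin (m+1), (((c x • (C (X ^ (x.2:ℕ)) * X ^ (x.1:ℕ) : k[X][X])).coeff j).coeff a)
      = if (j = x.1 ∧ a = x.2) then c x else 0 := by
    intro x
    rw [coeff_smul, coeff_C_mul_X_pow, coeff_smul]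
    by_cases h1 : j = x.1
    · rw [if_pos h1, coeff_X_pow]; simp [h1]
    · simp [h1]
  rw [sum_congr rfl fun x _ => this x]
  split_ifs with h
  · rw [sum_eq_single (⟨j, h.1⟩, ⟨a, h.2⟩)]
    · simp
    · rintro ⟨x1, x2⟩ _ hx
      rw [if_neg]; rintro ⟨h1, h2⟩; apply hx; ext <;> simp [h1, h2]
    · simp
  · refine sum_eq_zero fun x _ => ?_
    rw [if_neg]; rintro ⟨h1, h2⟩; apply h
    exact ⟨h1 ▸ x.1.2, h2 ▸ x.2.2⟩

lemma boxP_wt (w m : ℕ) (c : Fin r × Fin (m+1) → k) : boxP k r m c ∈ wt w (m + w * r) := by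
  intro j a h
  rw [boxP_coeff, dif_neg]
  rintro ⟨h1, h2⟩
  have := Nat.mul_le_mul_left w h1.le
  omega

noncomputable def box (R : k[X][X]) (r m : ℕ) : (Fin r × Fin (m+1) → k) →ₗ[k] AdjoinRoot R :=
  mkL R ∘ₗ boxP k r m

lemma box_inj (hR : R.Monic) (hr : R.natDegree = r) (m : ℕ) : Injective (box R r m) := by
  rw [injective_iff_map_eq_zero]
  intro c hc
  have hc' : R ∣ boxP k r m c := mk_eq_zero.1 hc
  have h0 : boxP k r m c = 0 := by
    by_contra h0
    refine hR.not_dvd_of_degree_lt h0 ?_ hc'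
    rw [degree_eq_natDegree hR.ne_zero, degree_lt_iff_coeff_zero]
    intro j hj
    ext a
    rw [boxP_coeff, dif_neg (by omega), coeff_zero]
  ext ⟨j, a⟩
  have := boxP_coeff (r := r) m c j a
  rw [h0] at this
  rw [dif_pos ⟨j.2, a.2⟩] at this
  simpa using this.symm

lemma mem_box (hR : R.Monic) (hr : R.natDegree = r) (hw : ∀ j, (R.coeff j).natDegree ≤ w)
    {m : ℕ} {G : k[X][X]} (hG : G ∈ wt w m) : mk R G ∈ LinearMap.range (box R r m) := by
  obtain ⟨G', h1, h2, h3⟩ := wt_red hR hr hw _ G (Nat.lt_succ_self _) hG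
  refine ⟨fun x => (G'.coeff x.1).coeff x.2, ?_⟩
  rw [← h3]
  change mk R (boxP k r m _) = _
  congr 1
  ext j a
  rw [boxP_coeff]
  split_ifs with h
  · rfl
  · by_cases hj : j < r
    · exact (h1 j a (by omega)).symm
    · rw [degree_eq_natDegree hR.ne_zero, degree_lt_iff_coeff_zero] at h2
      rw [h2 j (by omega), coeff_zero]

lemma dim_bound (hR : R.Monic) (hr : R.natDegree = r) (hw : ∀ j, (R.coeff j).natDegree ≤ w)
    [IsDomain (AdjoinRoot R)] {l : ℕ} {S : k[X][X]} (hS : S ∈ wt w l)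
    (hS0 : mk R S ≠ 0) {V : Type} [AddCommGroup V] [Module k V] [FiniteDimensional k V]
    (φ : AdjoinRoot R →ₗ[k] V) (hφ : Function.Surjective φ)
    (hφS : ∀ a, φ (mk R S * a) = 0) : Module.finrank k V ≤ r * (l + w * r) := by
  classical
  let b := Module.finBasis k V
  choose v hv using fun i => hφ (b i)
  choose G hG using fun i => mk_surjective (g := R) (v i)
  choose mm hmm using fun i => exists_wt w (G i)
  set M := univ.sup mm with hM
  have hsub : ∀ i, v i ∈ LinearMap.range (box R r (M + l + w * r)) := by
    intro i
    rw [← hG i]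
    refine mem_box hR hr hw (wt_mono ?_ (hmm i))
    have := le_sup (f := mm) (mem_univ i)
    omega
  let U := LinearMap.range (box R r (M + l + w * r))
  let ψ : U →ₗ[k] V := φ.domRestrict U
  have hψ : LinearMap.range ψ = ⊤ := by
    rw [eq_top_iff, ← b.span_eq, Submodule.span_le]
    rintro _ ⟨i, rfl⟩
    exact ⟨⟨v i, hsub i⟩, hv i⟩
  have h1 := LinearMap.finrank_range_add_finrank_ker ψ
  rw [hψ, finrank_top] at h1
  have hU : Module.finrank k U = r * (M + l + w * r + 1) := by
    rw [LinearMap.finrank_range_of_inj (box_inj hR hr _)]; simp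
  have hk : ∀ c, box R r M c * mk R S ∈ U := by
    intro c
    change mk R (boxP k r M c) * _ ∈ _
    rw [← map_mul]
    refine mem_box hR hr hw (wt_mono ?_ (wt_mul (boxP_wt w M c) hS))
    omega
  let κ : (Fin r × Fin (M+1) → k) →ₗ[k] LinearMap.ker ψ :=
    LinearMap.codRestrict _ (LinearMap.codRestrict U
      (LinearMap.mulRight k (mk R S) ∘ₗ box R r M) hk) (by
        intro c
        rw [LinearMap.mem_ker]
        change φ (box R r M c * mk R S) = 0
        rw [mul_comm, hφS])
  have hκ : Injective κ := by
    rw [injective_iff_map_eq_zero]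
    intro c hc
    have : box R r M c * mk R S = 0 := congrArg (fun x : LinearMap.ker ψ => ((x : U) : AdjoinRoot R)) hc
    rcases mul_eq_zero.1 this with h | h
    · exact (injective_iff_map_eq_zero _).1 (box_inj hR hr M) c h
    · exact absurd h hS0
  have h2 := LinearMap.finrank_le_finrank_of_injective hκ
  simp only [Module.finrank_fintype_fun_eq_card, Fintype.card_prod, card_fin] at h2
  rw [hU] at h1
  nlinarith

end Step

section Step2
open Polynomial

variable {k : Type} [Field k] {R : k[X][X]} {r w : ℕ}

noncomputable def ptHom {B : Type} [CommRing B] [Algebra k B] (R : k[X][X]) (α β : B)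
    (h : eval₂ (aeval α : k[X] →ₐ[k] B).toRingHom β R = 0) : AdjoinRoot R →ₐ[k] B :=
  { AdjoinRoot.lift (aeval α : k[X] →ₐ[k] B).toRingHom β h with
    commutes' := fun c => by
      have : aM k (AdjoinRoot R) c = AdjoinRoot.of R (C c) := rfl
      simp [this] }

lemma ptHom_mk {B : Type} [CommRing B] [Algebra k B] (R : k[X][X]) (α β : B)
    (h : eval₂ (aeval α : k[X] →ₐ[k] B).toRingHom β R = 0) (G : k[X][X]) :
    ptHom R α β h (mk R G) = eval₂ (aeval α : k[X] →ₐ[k] B).toRingHom β G :=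
  lift_mk h G

lemma aev (α β : k) (G : k[X][X]) :
    eval₂ (aeval α : k[X] →ₐ[k] k).toRingHom β G = G.evalEval α β := by
  have : (aeval α : k[X] →ₐ[k] k).toRingHom = eRH α := by
    ext <;> simp
  rw [this, eval₂_evalRingHom]

lemma exists_series (hR : R.Monic) (α β : k) (h : R.evalEval α β = 0)
    (h' : (derivative R).evalEval α β ≠ 0) :
    ∃ χ : AdjoinRoot R →ₐ[k] PowerSeries k, χ (mk R (C X)) =
      aM k _ α + PowerSeries.X := by
  set τ : PowerSeries k := aM k _ α + PowerSeries.X with hτ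
  set φ := (aeval τ : k[X] →ₐ[k] PowerSeries k).toRingHom with hφ
  have hc : ∀ G : k[X][X], PowerSeries.constantCoeff (eval (aM k _ β) (G.map φ)) =
      G.evalEval α β := by
    intro G
    rw [← aev, eval_map, hom_eval₂]
    congr 1
    ext <;> simp [hφ, hτ]
  obtain ⟨b, hb, -⟩ := HenselianRing.is_henselian (I := Ideal.span {(PowerSeries.X : PowerSeries k)})
    (R.map φ) (hR.map φ) (aM k _ β) (by
      rw [Ideal.mem_span_singleton, PowerSeries.X_dvd_iff, hc, h]) (by
      apply IsUnit.map
      rw [PowerSeries.isUnit_iff_constantCoeff, derivative_map, hc]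
      exact isUnit_iff_ne_zero.2 h')
  refine ⟨ptHom R τ b (by rw [← hφ, ← eval_map]; exact hb), ?_⟩
  rw [ptHom_mk]; simp

lemma series_ord (hR : R.Monic) (hr : R.natDegree = r) (hw : ∀ j, (R.coeff j).natDegree ≤ w)
    [IsDomain (AdjoinRoot R)] {α : k} (χ : AdjoinRoot R →ₐ[k] PowerSeries k)
    (hχ : χ (mk R (C X)) = aM k _ α + PowerSeries.X)
    {l : ℕ} {S : k[X][X]} (hS : S ∈ wt w l) (hS0 : mk R S ≠ 0) {n : ℕ}
    (hn : PowerSeries.X ^ n ∣ χ (mk R S)) : n ≤ r * (l + w * r) := by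
  let φ : AdjoinRoot R →ₗ[k] (Fin n → k) :=
    LinearMap.pi fun i => (PowerSeries.coeff (R := k) (i : ℕ)) ∘ₗ χ.toLinearMap
  have := dim_bound hR hr hw hS hS0 φ ?_ ?_
  · simpa using this
  · intro v
    refine ⟨∑ i : Fin n, v i • (mk R (C X) - aM k _ α) ^ (i:ℕ), ?_⟩
    ext i
    simp only [φ, LinearMap.pi_apply, LinearMap.comp_apply, toLinearMap_apply, map_sum,
      map_smul, map_pow, map_sub, hχ, AlgHom.commutes, add_sub_cancel_left]
    rw [sum_eq_single i]
    · simp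
    · intro j _ hj
      rw [PowerSeries.coeff_X_pow, if_neg, smul_zero]
      intro h; exact hj (Fin.ext h.symm)
    · simp
  · intro a
    ext i
    simp only [φ, LinearMap.pi_apply, LinearMap.comp_apply, toLinearMap_apply, map_mul]
    exact PowerSeries.X_pow_dvd_iff.1 (hn.mul_right _) i i.2

noncomputable def bm (k : Type) [Field k] (r m : ℕ) (x : Fin r × Fin (m+1)) : k[X][X] :=
  C (X ^ (x.2:ℕ)) * X ^ (x.1:ℕ)

lemma boxP_eq (m : ℕ) (c : Fin r × Fin (m+1) → k) : boxP k r m c = ∑ x, c x • bm k r m x := by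
  rw [boxP, linearCombination_apply]; rfl

lemma mk_smul' (c : k) (G : k[X][X]) : mk R (c • G) = c • mk R G :=
  (mkL R).map_smul c G

lemma box_eq (m : ℕ) (c : Fin r × Fin (m+1) → k) :
    box R r m c = ∑ x, c x • mk R (bm k r m x) := by
  change mk R (boxP k r m c) = _
  rw [boxP_eq, map_sum]; exact sum_congr rfl fun x _ => mk_smul' _ _

lemma nonvanish (hR : R.Monic) (hr : R.natDegree = r) (hw : ∀ j, (R.coeff j).natDegree ≤ w)
    [IsDomain (AdjoinRoot R)] {α : k} (χ : AdjoinRoot R →ₐ[k] PowerSeries k)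
    (hχ : χ (mk R (C X)) = aM k _ α + PowerSeries.X)
    {p : ℕ} [Fact p.Prime] [CharP k p] {ν l : ℕ} (hl : r * (l + 2 * (w * r)) < p ^ ν)
    (z : Fin r × Fin (l+1) → AdjoinRoot R) (hz : ∃ x, z x ≠ 0) :
    ∑ x, mk R (bm k r l x) * z x ^ (p ^ ν) ≠ 0 := by
  classical
  have : CharP (PowerSeries k) p := charP_of_injective_algebraMap (aM k _).injective p
  intro h0
  have hinj : ∀ x, z x ≠ 0 → χ (z x) ≠ 0 := by
    intro x hx h
    obtain ⟨G, hG⟩ := mk_surjective (g := R) (z x)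
    obtain ⟨m, hm⟩ := exists_wt w G
    have := series_ord hR hr hw χ hχ hm (by rwa [hG]) (n := r * (m + w * r) + 1)
      (by rw [hG, h]; exact dvd_zero _)
    omega
  obtain ⟨x0, hx0⟩ := hz
  obtain ⟨y, hy, hmin⟩ := Finset.exists_min_image (univ.filter fun x => z x ≠ 0)
    (fun x => (χ (z x)).order.toNat) ⟨x0, by simpa using hx0⟩
  simp only [mem_filter, mem_univ, true_and] at hy hmin
  set v := (χ (z y)).order.toNat
  have hdiv : ∀ x, ∃ ζ, χ (z x) = PowerSeries.X ^ v * ζ := by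
    intro x
    by_cases hx : z x = 0
    · exact ⟨0, by rw [hx]; simp⟩
    · exact (pow_dvd_pow _ (hmin x hx)).trans PowerSeries.X_pow_order_dvd
  choose ζ hζ using hdiv
  have hζy : PowerSeries.constantCoeff (ζ y) ≠ 0 := by
    intro h
    have h1 : PowerSeries.X ^ (v + 1) ∣ χ (z y) := by
      rw [hζ y, pow_succ]; exact mul_dvd_mul_left _ (PowerSeries.X_dvd_iff.2 h)
    have h2 := PowerSeries.X_pow_dvd_iff.1 h1 v (by omega)
    exact PowerSeries.coeff_order (hinj y hy) h2
  have h1 : ∑ x, χ (mk R (bm k r l x)) * ζ x ^ (p ^ ν) = 0 := by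
    have h2 : (PowerSeries.X ^ v) ^ (p ^ ν) * ∑ x, χ (mk R (bm k r l x)) * ζ x ^ (p ^ ν) = 0 := by
      rw [← map_zero χ, ← h0, map_sum, mul_sum]
      refine sum_congr rfl fun x _ => ?_
      rw [map_mul, map_pow, hζ x, mul_pow]; ring
    exact (mul_eq_zero.1 h2).resolve_left (pow_ne_zero _ (pow_ne_zero _ PowerSeries.X_ne_zero))
  set a : Fin r × Fin (l+1) → k := fun x => PowerSeries.constantCoeff (ζ x) ^ (p ^ ν) with ha
  have h2 : ∀ x, PowerSeries.X ^ (p ^ ν) ∣ ζ x ^ (p ^ ν) - aM k _ (a x) := by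
    intro x
    rw [ha, map_pow, ← sub_pow_char_pow]
    refine pow_dvd_pow_of_dvd (PowerSeries.X_dvd_iff.2 ?_) _
    simp
  have h3 : PowerSeries.X ^ (p ^ ν) ∣ χ (mk R (boxP k r l a)) := by
    have h4 : χ (mk R (boxP k r l a)) =
        - ∑ x, χ (mk R (bm k r l x)) * (ζ x ^ (p ^ ν) - aM k _ (a x)) := by
      change χ (box R r l a) = _
      simp only [mul_sub, sum_sub_distrib, h1, zero_sub, neg_neg, box_eq, map_sum, map_smul]
      exact sum_congr rfl fun x _ => by rw [smul_def, mul_comm]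
    rw [h4, dvd_neg]
    exact Finset.dvd_sum fun x _ => (h2 x).mul_left _
  have h5 := series_ord hR hr hw χ hχ (boxP_wt w l a) (by
    intro h
    have := congrFun ((injective_iff_map_eq_zero _).1 (box_inj hR hr l) a h) y
    exact hζy (pow_eq_zero_iff (pow_ne_zero _ (Fact.out : p.Prime).ne_zero) |>.1 this)) h3
  have : l + w * r + w * r = l + 2 * (w * r) := by ring
  rw [this] at h5
  omega

lemma zeros_bound (hR : R.Monic) (hr : R.natDegree = r) (hw : ∀ j, (R.coeff j).natDegree ≤ w)
    [IsDomain (AdjoinRoot R)] {l : ℕ} {G : k[X][X]} (hG : G ∈ wt w l)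
    (hG0 : mk R G ≠ 0) (S : Finset (k × k)) (hS : ∀ x ∈ S, R.evalEval x.1 x.2 = 0)
    (hSG : ∀ x ∈ S, G.evalEval x.1 x.2 = 0) : S.card ≤ r * (l + w * r) := by
  classical
  have hS' : ∀ x : S, eval₂ (aeval x.1.1 : k[X] →ₐ[k] k).toRingHom x.1.2 R = 0 := fun x => by
    rw [aev]; exact hS x.1 x.2
  let φ : AdjoinRoot R →ₗ[k] (S → k) :=
    LinearMap.pi fun x => (ptHom R x.1.1 x.1.2 (hS' x)).toLinearMap
  have hφ : ∀ G x, φ (mk R G) x = G.evalEval x.1.1 x.1.2 := by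
    intro G x
    simp only [φ, LinearMap.pi_apply, toLinearMap_apply, ptHom_mk, aev]
  have := dim_bound hR hr hw hG hG0 φ ?_ ?_
  · simpa using this
  · have hex : ∀ x : S, ∃ f : AdjoinRoot R, φ f = single x 1 := by
      intro x
      have h2 : ∀ y : S, ∃ f : k[X][X], y ≠ x → f.evalEval x.1.1 x.1.2 ≠ 0 ∧ f.evalEval y.1.1 y.1.2 = 0 := by
        intro y
        by_cases h1 : x.1.1 = y.1.1
        · refine ⟨X - C (C y.1.2), fun h => ?_⟩
          have h2 : x.1.2 ≠ y.1.2 := fun h2 => h (Subtype.ext (Prod.ext h1.symm h2.symm))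
          simp [evalEval, sub_eq_zero, h2]
        · exact ⟨C (X - C y.1.1), fun h => by simp [evalEval, sub_eq_zero, h1]⟩
      choose f hf using h2
      set F := ∏ y ∈ univ.erase x, f y with hF
      have hFx : F.evalEval x.1.1 x.1.2 ≠ 0 := by
        rw [← coe_evalEvalRingHom, hF, map_prod, prod_ne_zero_iff]
        intro y hy; exact (hf y (ne_of_mem_erase hy)).1
      refine ⟨(F.evalEval x.1.1 x.1.2)⁻¹ • mk R F, ?_⟩
      ext y
      rw [map_smul, Pi.smul_apply, hφ, smul_eq_mul]
      by_cases hy : y = x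
      · subst hy; rw [single_eq_same, inv_mul_cancel₀ hFx]
      · rw [single_eq_of_ne hy]
        have : F.evalEval y.1.1 y.1.2 = 0 := by
          rw [← coe_evalEvalRingHom, hF, map_prod]
          exact prod_eq_zero (mem_erase.2 ⟨hy, mem_univ _⟩) (hf y hy).2
        rw [this, mul_zero]
    choose f hf using hex
    intro v
    refine ⟨∑ x, v x • f x, ?_⟩
    rw [map_sum]
    ext y
    simp [hf, Finset.sum_apply, single_apply]
  · intro a
    obtain ⟨A, rfl⟩ := mk_surjective (g := R) a
    ext x
    rw [← map_mul, hφ, evalEval_mul, hSG x.1 x.2, zero_mul]; rfl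

end Step2

section Step3
open Polynomial

variable {k : Type} [Field k] {R : k[X][X]} {r w : ℕ}

lemma step_aux [IsAlgClosed k] {p : ℕ} [Fact p.Prime] [CharP k p] (hR : R.Monic)
    (hr : R.natDegree = r) (hw : ∀ j, (R.coeff j).natDegree ≤ w) [IsDomain (AdjoinRoot R)]
    {H : k[X][X]} {D l m μ ν : ℕ} (hD : derivative R ∈ wt w D) (hH : H ∈ wt w D)
    (hl : r * (l + 2 * (w * r)) < p ^ ν)
    (hm : p ^ μ * (l + w * r) + m + r * D + 1 < r * (l + 1) * (m + 1))
    (S : Finset (k × k)) (hS : ∀ x ∈ S, R.evalEval x.1 x.2 = 0 ∧ (derivative R).evalEval x.1 x.2 ≠ 0 ∧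
      x.1 ^ (p ^ (μ + ν)) = x.1 ∧
      x.2 ^ (p ^ (μ + ν)) * (derivative R).evalEval x.1 x.2 = H.evalEval x.1 x.2) :
    S.card ≤ r * (l + 2 * (w * r)) + p ^ ν * (r * m + r * (w * r)) := by
  classical
  rcases S.eq_empty_or_nonempty with rfl | ⟨x0, hx0⟩
  · simp
  obtain ⟨χ, hχ⟩ := exists_series hR x0.1 x0.2 (hS x0 hx0).1 (hS x0 hx0).2.1
  have hp : p.Prime := Fact.out
  have hr0 : 0 < r := by
    rcases Nat.eq_zero_or_pos r with h | h
    · subst h; simp at hm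
    · exact h
  let δ := derivative R
  let τ : Fin r × Fin (m+1) → k[X][X] := fun i => C (X ^ (i.2:ℕ)) * δ ^ (r - 1 - i.1) * H ^ (i.1:ℕ)
  have hbmw : ∀ (m : ℕ) x, bm k r m x ∈ wt w (m + w * r) := by
    intro m x
    have := boxP_wt (r := r) w m (single x (1:k))
    rwa [boxP_eq, sum_eq_single x (by intro y _ hy; simp [single_eq_of_ne hy])
      (by simp), single_eq_same, one_smul] at this
  let N := p ^ μ * (l + w * r) + m + r * D
  have hτw : ∀ i j, bm k r l j ^ (p ^ μ) * τ i ∈ wt w N := by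
    intro i j
    have h1 := wt_pow (hbmw l j) (p ^ μ)
    have h2 : (C (X ^ (i.2:ℕ)) : k[X][X]) ∈ wt w m := by
      refine wt_of_le (E := 0) (D := m) (by simp) (fun j => ?_) (by simp)
      rw [coeff_C]; split_ifs
      · simpa using Nat.le_of_lt_succ i.2.2
      · simp
    have h3 := wt_mul h1 (wt_mul (wt_mul h2 (wt_pow hD (r - 1 - i.1))) (wt_pow hH (i.1 : ℕ)))
    refine wt_mono ?_ h3
    have : (r - 1 - i.1) * D + i.1 * D ≤ r * D := by
      rw [← add_mul]; exact Nat.mul_le_mul_right _ (by have := i.1.2; omega)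
    simp only [N]; omega
  let Φ : ((Fin r × Fin (m+1)) × (Fin r × Fin (l+1)) → k) →ₗ[k] AdjoinRoot R :=
    linearCombination k (fun x => mk R (bm k r l x.2 ^ (p ^ μ) * τ x.1))
  have hΦ : ∀ c, Φ c ∈ LinearMap.range (box R r N) := by
    intro c
    simp only [Φ, linearCombination_apply]
    exact Submodule.sum_mem _ fun x _ => Submodule.smul_mem _ _ (mem_box hR hr hw (hτw _ _))
  obtain ⟨c, hc, hc0⟩ : ∃ c, Φ c = 0 ∧ c ≠ 0 := by
    have := LinearMap.ker_ne_bot_of_finrank_lt (f := Φ.codRestrict _ hΦ) (by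
      rw [LinearMap.finrank_range_of_inj (box_inj hR hr _)]
      simp only [Module.finrank_fintype_fun_eq_card, Fintype.card_prod, card_fin]
      have h1 := Nat.mul_lt_mul_of_pos_left hm hr0
      simp only [N]
      calc _ < _ := h1
        _ = _ := by ring)
    obtain ⟨c, hc, hc0⟩ := (Submodule.ne_bot_iff _).1 this
    exact ⟨c, congrArg val (LinearMap.mem_ker.1 hc), hc0⟩
  have hQ : 0 < p ^ (μ + ν) := pow_pos hp.pos _
  choose γ hγ using fun x => IsAlgClosed.exists_pow_nat_eq (c x) hQ
  let Z : Fin r × Fin (l+1) → k[X][X] := fun j => boxP k r m (fun i => γ (i, j))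
  let G : k[X][X] := ∑ j, bm k r l j * Z j ^ (p ^ ν)
  have hG0 : mk R G ≠ 0 := by
    have := nonvanish hR hr hw χ hχ hl (fun j => mk R (Z j)) ?_
    · simpa [G, map_sum, map_mul, map_pow] using this
    · obtain ⟨⟨i, j⟩, hx⟩ := Function.ne_iff.1 hc0
      refine ⟨j, fun h => hx ?_⟩
      have := congrFun ((injective_iff_map_eq_zero _).1 (box_inj hR hr m) _ h) i
      rw [← hγ]
      simp only [Pi.zero_apply] at this
      rw [this, zero_pow hQ.ne']; rfl
  have hGw : G ∈ wt w (l + w * r + p ^ ν * (m + w * r)) :=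
    Submodule.sum_mem _ fun j _ => wt_mul (hbmw l j) (wt_pow (boxP_wt w m _) _)
  have hSG : ∀ x ∈ S, G.evalEval x.1 x.2 = 0 := by
    intro x hx
    obtain ⟨h1, h2, h3, h4⟩ := hS x hx
    set ev := evalEvalRingHom x.1 x.2 with hev
    have hev' : ∀ F : k[X][X], F.evalEval x.1 x.2 = ev F := fun F => rfl
    rw [hev'] at h1 h2 h4 ⊢
    rw [hev' H] at h4
    have hbm : ∀ (m : ℕ) i, ev (bm k r m i) = x.1 ^ (i.2:ℕ) * x.2 ^ (i.1:ℕ) := by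
      intro m i; simp [hev, bm]
    have hsm : ∀ (c : k) (F : k[X][X]), ev (c • F) = c * ev F := by
      intro c F; simp [hev]
    have key : ev δ ^ (r - 1) * ev G ^ (p ^ μ) = 0 := by
      have hrel : ∑ y, c y * ev (bm k r l y.2 ^ (p ^ μ) * τ y.1) = 0 := by
        have : R ∣ ∑ y, c y • (bm k r l y.2 ^ (p ^ μ) * τ y.1) := by
          rw [← mk_eq_zero, map_sum, ← hc]
          simp only [Φ, linearCombination_apply]
          exact sum_congr rfl fun y _ => mk_smul' _ _
        obtain ⟨F, hF⟩ := this
        have h := congrArg ev hF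
        rw [map_mul, h1, zero_mul, map_sum] at h
        rw [← h]
        exact sum_congr rfl fun y _ => (hsm _ _).symm
      rw [← hrel, Fintype.sum_prod_type_right]
      simp only [G, map_sum, map_mul, map_pow]
      rw [sum_pow_char_pow, mul_sum]
      refine sum_congr rfl fun j _ => ?_
      have hZ : ev (Z j) ^ (p ^ (μ + ν)) = ∑ i, c (i, j) * (x.1 ^ (i.2:ℕ) * (x.2 ^ (p ^ (μ+ν))) ^ (i.1:ℕ)) := by
        simp only [Z, boxP_eq, map_sum, hsm, hbm]
        rw [sum_pow_char_pow]
        refine sum_congr rfl fun i _ => ?_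
        rw [mul_pow, hγ, mul_pow, ← pow_mul, mul_comm (i.2:ℕ), pow_mul, h3, ← pow_mul, ← pow_mul,
          mul_comm (i.1:ℕ)]
      rw [mul_pow, ← pow_mul (ev (Z j)), ← pow_add, add_comm ν μ, hZ, mul_sum, mul_sum]
      refine sum_congr rfl fun i _ => ?_
      have hi : r - 1 = (r - 1 - i.1) + i.1 := by have := i.1.2; omega
      have hτe : ev (τ i) = x.1 ^ (i.2:ℕ) * (x.2 ^ (p ^ (μ+ν))) ^ (i.1:ℕ) * ev δ ^ (r - 1) := by
        have : ev (C (X ^ (i.2:ℕ))) = x.1 ^ (i.2:ℕ) := by simp [hev]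
        simp only [τ, map_mul, map_pow, ← h4]
        rw [← map_pow, ← map_pow, this, hi, pow_add, mul_pow, Nat.add_sub_cancel]; ring
      rw [hτe]; ring
    exact (pow_eq_zero_iff (pow_pos hp.pos _).ne').1 ((mul_eq_zero.1 key).resolve_left (pow_ne_zero _ h2))
  have := zeros_bound hR hr hw hGw hG0 S (fun x hx => (hS x hx).1) hSG
  calc _ ≤ _ := this
    _ = _ := by ring

theorem step (k : Type) [Field k] [IsAlgClosed k] (p : ℕ) [Fact p.Prime] [CharP k p] (r w h : ℕ) :
    ∃ C a₀ : ℕ, ∀ a, a₀ ≤ a → ∀ R H : k[X][X], R.Monic → Irreducible R → R.natDegree = r →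
      (∀ j, (R.coeff j).natDegree ≤ w) → H.natDegree ≤ h → (∀ j, (H.coeff j).natDegree ≤ h) →
      ∀ S : Finset (k × k), (∀ x ∈ S, R.evalEval x.1 x.2 = 0 ∧ (derivative R).evalEval x.1 x.2 ≠ 0 ∧
        x.1 ^ (p ^ a) = x.1 ∧ x.2 ^ (p ^ a) * (derivative R).evalEval x.1 x.2 = H.evalEval x.1 x.2) →
      S.card ≤ p ^ a + C * p ^ (a - a / 2) := by
  rcases Nat.eq_zero_or_pos r with hr0 | hr0
  · refine ⟨0, 0, fun a _ R H hR hirr hr => ?_⟩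
    rw [hr0] at hr
    rw [hR.natDegree_eq_zero.1 hr] at hirr
    exact absurd isUnit_one hirr.not_isUnit
  set u := w * r with hu
  set D := w + w * r + h + w * h with hD
  set B := 2 * r * (u + 1) with hB
  set K := 2 * r * (2 * u + 1) + r * D + 1 with hK
  refine ⟨1 + B + r * u, 2 * K, fun a ha R H hR hirr hr hw hH hH' S hS => ?_⟩
  set μ := a / 2 with hμ
  set ν := a - a / 2 with hν
  have hμν : μ + ν = a := by omega
  have hp : 2 ≤ p := (Fact.out : p.Prime).two_le
  set q := p ^ ν with hq
  set P := p ^ μ with hP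
  have hPq : P ≤ q := Nat.pow_le_pow_right (by omega) (by omega)
  have hqK : K ≤ q := by
    calc K ≤ ν := by omega
      _ ≤ 2 ^ ν := Nat.lt_two_pow_self.le
      _ ≤ q := Nat.pow_le_pow_left hp _
  have hdom : IsDomain (AdjoinRoot R) := AdjoinRoot.isDomain_of_prime hirr.prime
  have hq1 : 1 ≤ q := by omega
  obtain ⟨l', hl'⟩ : ∃ l', l' = (q - 1) / r := ⟨_, rfl⟩
  have hl1 : r * l' ≤ q - 1 := hl' ▸ Nat.mul_div_le _ _
  have hl2 : q ≤ r * (l' + 1) := by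
    have := Nat.lt_mul_div_succ (q - 1) hr0
    rw [← hl'] at this; omega
  have hl3 : 2 * u ≤ l' := by
    by_contra hcon
    have : r * (l' + 1) ≤ r * (2 * u) := Nat.mul_le_mul_left _ (by omega)
    have : r * (2 * u) ≤ 2 * r * (2 * u + 1) := by nlinarith
    omega
  obtain ⟨l, rfl⟩ := Nat.exists_eq_add_of_le hl3
  obtain ⟨m, hm⟩ : ∃ m, m = (P + B) / r := ⟨_, rfl⟩
  have hm1 : r * m ≤ P + B := hm ▸ Nat.mul_div_le _ _
  have hm2 : P + B + 1 ≤ r * (m + 1) := by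
    have := Nat.lt_mul_div_succ (P + B) hr0
    rw [← hm] at this; omega
  have hB2 : q * (u + 1) ≤ l * B := by
    have h1 : q ≤ 2 * r * l := by
      have h1 : r * (2 * u + l + 1) = r * (2 * u + 1) + r * l := by ring
      have h2 : 2 * r * (2 * u + 1) = 2 * (r * (2 * u + 1)) := by ring
      have h3 : 2 * r * l = 2 * (r * l) := by ring
      omega
    calc q * (u + 1) ≤ 2 * r * l * (u + 1) := Nat.mul_le_mul_right _ h1
      _ = l * B := by rw [hB]; ring
  have hlt : r * (l + 2 * (w * r)) < q := by
    rw [← hu, add_comm l]; omega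
  have := step_aux hR hr hw (H := H) (D := D) (l := l) (m := m) (μ := μ) (ν := ν)
    (wt_of_le (D := w) (E := r) ((natDegree_derivative_le R).trans (by omega)) (fun j => by
      rw [coeff_derivative]
      have : ((j : k[X]) + 1) = C ((j : k) + 1) := by simp
      rw [this]
      exact (natDegree_mul_C_le _ _).trans (hw _)) (by omega))
    (wt_of_le hH hH' (by omega)) hlt (by
      have h1 : (l + 1) * (P + B + 1) ≤ (l + 1) * (r * (m + 1)) := Nat.mul_le_mul_left _ hm2
      have h2 : m ≤ P + B := le_trans (le_mul_of_pos_left _ hr0) hm1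
      have h3 : P * u ≤ q * u := Nat.mul_le_mul_right _ hPq
      rw [← hP, ← hu]
      have e1 : (l + 1) * (P + B + 1) = P * l + l * B + l + P + B + 1 := by ring
      have e2 : (l + 1) * (r * (m + 1)) = r * (l + 1) * (m + 1) := by ring
      have e3 : P * (l + u) = P * l + P * u := by ring
      have e4 : q * (u + 1) = q * u + q := by ring
      rw [e3, ← e2]
      clear_value u D B K q P
      omega) S (by rw [hμν]; exact hS)
  have hQ : q * P = p ^ a := by rw [hq, hP, ← pow_add]; congr 1; omega
  rw [← hQ]
  rw [← hu, ← hq] at this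
  rw [← hu] at hlt
  have h4 : q * (r * m) ≤ q * (P + B) := Nat.mul_le_mul_left _ hm1
  have e1 : q * (r * m + r * u) = q * (r * m) + q * (r * u) := by ring
  have e2 : q * P + (1 + B + r * u) * q = q * (P + B) + q + q * (r * u) := by ring
  clear_value u D B K q P
  omega

end Step3

section OpenIrr
open Polynomial

lemma exists_ext {W S k : Type} [CommRing W] [CommRing S] [Algebra W S] [Algebra.IsIntegral W S]
    [Field k] [IsAlgClosed k] (φ : W →+* k)
    (h : ∀ x, aM W S x = 0 → φ x = 0) : ∃ ψ : S →+* k, ψ.comp (aM W S) = φ := by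
  have hp : (RingHom.ker φ).IsPrime := RingHom.ker_isPrime φ
  obtain ⟨Q, -, hQ, hQ'⟩ := Ideal.exists_ideal_over_prime_of_isIntegral (S := S) (RingHom.ker φ) ⊥
    (fun x hx => h x (by simpa using hx))
  let φ' : W ⧸ Q.comap (aM W S) →+* k := Ideal.Quotient.lift _ φ (fun a ha => by
    rw [hQ'] at ha; exact ha)
  have hφ' : Injective φ' := by
    rw [injective_iff_map_eq_zero]
    intro a ha
    obtain ⟨a, rfl⟩ := Ideal.Quotient.mk_surjective a
    rw [Ideal.Quotient.eq_zero_iff_mem, hQ']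
    exact ha
  let _ := φ'.toAlgebra
  have : IsDomain (W ⧸ Q.comap (aM W S)) := Ideal.Quotient.isDomain _
  have : IsTorsionFree (W ⧸ Q.comap (aM W S)) k := by
    have : FaithfulSMul (W ⧸ Q.comap (aM W S)) k :=
      (faithfulSMul_iff_algebraMap_injective _ _).2 hφ'
    infer_instance
  have : IsDomain (S ⧸ Q) := Ideal.Quotient.isDomain _
  have : IsTorsionFree (W ⧸ Q.comap (aM W S)) (S ⧸ Q) := by
    have h1 : FaithfulSMul (W ⧸ Q.comap (aM W S)) (S ⧸ Q) :=
      (faithfulSMul_iff_algebraMap_injective _ _).2 Ideal.algebraMap_quotient_injective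
    exact (Module.isTorsionFree_iff_faithfulSMul).2 h1
  have : Algebra.IsIntegral (W ⧸ Q.comap (aM W S)) (S ⧸ Q) := inferInstance
  let L : S ⧸ Q →ₐ[W ⧸ Q.comap (aM W S)] k := lift
  refine ⟨L.toRingHom.comp (Ideal.Quotient.mk Q), ?_⟩
  ext w
  have := L.commutes (Ideal.Quotient.mk _ w)
  exact this

lemma coeff_swap {k : Type} [CommRing k] (F : k[X][X]) (a j : ℕ) :
    ((Bivariate.swap F).coeff a).coeff j = (F.coeff j).coeff a := by
  induction F using induction_on' with
  | add p q hp hq => simp [hp, hq]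
  | monomial n f =>
    induction f using induction_on' with
    | add p q hp hq => simp [map_add, hp, hq]
    | monomial m c =>
      rw [Bivariate.swap_monomial_monomial]
      simp only [coeff_monomial]
      split_ifs <;> simp [coeff_monomial, *]

lemma natDegree_swap_le {k : Type} [CommRing k] (F : k[X][X]) (D : ℕ) :
    (Bivariate.swap F).natDegree ≤ D ↔ ∀ j, (F.coeff j).natDegree ≤ D := by
  simp only [natDegree_le_iff_coeff_eq_zero]
  constructor
  · intro h j N hN; rw [← coeff_swap, h N hN, coeff_zero]
  · intro h N hN; ext j; rw [coeff_swap, h j N hN, coeff_zero]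

lemma factor_bound {k : Type} [CommRing k] [IsDomain k] {F G : k[X][X]} (h0 : F * G ≠ 0) {D : ℕ}
    (h : ∀ j, ((F * G).coeff j).natDegree ≤ D) (j : ℕ) : (F.coeff j).natDegree ≤ D := by
  refine (natDegree_swap_le F D).1 (le_trans ?_ ((natDegree_swap_le _ _).2 h)) j
  have hF : Bivariate.swap F ≠ 0 := by
    rw [Ne, EmbeddingLike.map_eq_zero_iff]; rintro rfl; simp at h0
  have hG : Bivariate.swap G ≠ 0 := by
    rw [Ne, EmbeddingLike.map_eq_zero_iff]; rintro rfl; simp at h0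
  rw [map_mul, natDegree_mul hF hG]
  exact Nat.le_add_right _ _

lemma exists_pi_poly {J : Type} {κ : J → Type} [∀ i, Field (κ i)] (n D : ℕ)
    (S : ∀ i, (κ i)[X][X]) (hn : ∀ i, (S i).natDegree ≤ n) (hD : ∀ i j, ((S i).coeff j).natDegree ≤ D) :
    ∃ T : (∀ i, κ i)[X][X], ∀ i, T.map (mRH (Pi.evalRingHom κ i)) = S i := by
  refine ⟨∑ j ∈ range (n+1), monomial j (∑ a ∈ range (D+1),
    monomial a (fun i => ((S i).coeff j).coeff a)), fun i => ?_⟩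
  simp only [Polynomial.map_sum, map_monomial, coe_mapRingHom, Pi.evalRingHom_apply]
  conv_rhs => rw [(S i).as_sum_range' (n+1) (lt_succ_of_le (hn i))]
  refine sum_congr rfl fun j _ => ?_
  congr 1
  exact (((S i).coeff j).as_sum_range' (D+1) (lt_succ_of_le (hD i j))).symm

lemma pi_poly_ext {J : Type} {κ : J → Type} [∀ i, Field (κ i)] {S T : (∀ i, κ i)[X][X]}
    (h : ∀ i, S.map (mRH (Pi.evalRingHom κ i)) = T.map (mRH (Pi.evalRingHom κ i))) :
    S = T := by
  ext j a i
  have := congrArg (fun P => (P.coeff j).coeff a) (h i)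
  simpa using this

attribute [local instance] Polynomial.algebra in
lemma int_coeff {W B : Type} [CommRing W] [CommRing B] [Algebra W B] {R : W[X][X]} {S T : B[X][X]}
    (hR : R.Monic) (hS : S.Monic) (h : S * T = R.map (mRH (aM W B))) (j a : ℕ) :
    IsIntegral W ((S.coeff j).coeff a) :=
  isIntegral_iff_isIntegral_coeff.1 (isIntegral_coeff_of_dvd R S hR hS ⟨T, h.symm⟩ j) a

lemma open_factor {W k₁ : Type} [CommRing W] [Field k₁] [IsAlgClosed k₁] {R : W[X][X]}
    (hR : R.Monic) (φ : W →+* k₁) {J : Type} {κ : J → Type} [∀ i, Field (κ i)]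
    (ψ : ∀ i, W →+* κ i) (hker : ∀ x, (∀ i, ψ i x = 0) → φ x = 0) (n : ℕ)
    (S T : ∀ i, (κ i)[X][X]) (hS : ∀ i, (S i).Monic) (hSn : ∀ i, (S i).natDegree = n)
    (hST : ∀ i, S i * T i = R.map (mRH (ψ i))) :
    ∃ S' : k₁[X][X], S'.Monic ∧ S'.natDegree = n ∧ S' ∣ R.map (mRH φ) := by
  obtain ⟨D, hD⟩ : ∃ D, ∀ j, (R.coeff j).natDegree ≤ D := ⟨_, (natDegree_swap_le R _).1 le_rfl⟩
  have hT : ∀ i, (T i).Monic := fun i => (hS i).of_mul_monic_left ((hST i) ▸ hR.map _)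
  have hD' : ∀ i j, ((S i * T i).coeff j).natDegree ≤ D := by
    intro i j
    rw [hST, coeff_map]; exact (natDegree_map_le).trans (hD j)
  have hne : ∀ i, S i * T i ≠ 0 := fun i => ((hS i).mul (hT i)).ne_zero
  obtain ⟨S1, hS1⟩ := exists_pi_poly n D S (fun i => (hSn i).le)
    (fun i => factor_bound (hne i) (hD' i))
  obtain ⟨T1, hT1⟩ := exists_pi_poly R.natDegree D T (fun i => by
      have := (hS i).natDegree_mul (hT i)
      have h2 : (R.map (mRH (ψ i))).natDegree ≤ R.natDegree := natDegree_map_le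
      rw [← hST] at h2; omega)
    (fun i => factor_bound (F := T i) (G := S i) (by rw [mul_comm]; exact hne i)
      (by rw [mul_comm]; exact hD' i))
  let _ : Algebra W (∀ i, κ i) := (RingHom.pi ψ).toAlgebra
  have halg : aM W (∀ i, κ i) = RingHom.pi ψ := rfl
  have hS1m : S1.Monic := by
    have hdeg : S1.natDegree ≤ n := by
      rw [natDegree_le_iff_coeff_eq_zero]
      intro N hN
      ext a i
      have := congrArg (fun P => (P.coeff N).coeff a) (hS1 i)
      rw [coeff_eq_zero_of_natDegree_lt (p := S i) (by rw [hSn]; exact hN)] at this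
      simpa using this
    refine monic_of_natDegree_le_of_coeff_eq_one n hdeg ?_
    ext a i
    have := congrArg (fun P => (P.coeff n).coeff a) (hS1 i)
    rw [← hSn i, (hS i).coeff_natDegree, hSn i] at this
    simp only [coeff_map, coe_mapRingHom, Pi.evalRingHom_apply] at this
    rw [this, coeff_one, coeff_one]; split_ifs <;> rfl
  have hprod : S1 * T1 = R.map (mRH (aM W (∀ i, κ i))) := by
    refine pi_poly_ext fun i => ?_
    rw [Polynomial.map_mul, hS1, hT1, hST, map_map]
    congr 1
    ext <;> simp [halg]
  have hint : ∀ j a, IsIntegral W ((S1.coeff j).coeff a) := int_coeff hR hS1m hprod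
  have hint' : ∀ j a, IsIntegral W ((T1.coeff j).coeff a) :=
    int_coeff hR (hS1m.of_mul_monic_left (hprod ▸ hR.map _)) ((mul_comm _ _).trans hprod)
  let O := integralClosure W (∀ i, κ i)
  let ι : O →+* (∀ i, κ i) := (aM O _)
  have hι : Injective ι := val_injective
  have hι2 : Injective (mRH (mRH ι)) :=
    map_injective _ (map_injective _ hι)
  have hl : ∀ P : (∀ i, κ i)[X][X], (∀ j a, IsIntegral W ((P.coeff j).coeff a)) →
      P ∈ lifts (mRH ι) := by
    intro P hP
    rw [lifts_iff_coeff_lifts]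
    intro j
    obtain ⟨q, hq⟩ : P.coeff j ∈ lifts ι := by
      rw [lifts_iff_coeff_lifts]
      intro a
      exact ⟨⟨_, hP j a⟩, rfl⟩
    exact ⟨q, hq⟩
  obtain ⟨S2, hS2, hS2d, hS2m⟩ := lifts_and_natDegree_eq_and_monic (hl S1 hint) hS1m
  obtain ⟨T2, hT2⟩ := hl T1 hint'
  have hprod2 : S2 * T2 = R.map (mRH (aM W O)) := by
    apply hι2
    rw [map_mul]
    change S2.map _ * _ = _
    rw [hS2, hT2, hprod]
    change _ = (R.map _).map _
    rw [map_map, mapRingHom_comp]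
    rfl
  obtain ⟨Ψ, hΨ⟩ := exists_ext (S := O) φ (fun x hx => hker x (fun i => by
    have : aM W (∀ i, κ i) x = 0 := congrArg val hx
    rw [halg] at this
    exact congrFun this i))
  rcases isEmpty_or_nonempty J with hJ | ⟨⟨i0⟩⟩
  · exact absurd (hker 1 (fun i => (hJ.false i).elim)) (by simp)
  refine ⟨S2.map (mRH Ψ), hS2m.map _, ?_, ⟨T2.map (mRH Ψ), ?_⟩⟩
  · have : Nontrivial O := Ψ.domain_nontrivial
    rw [hS2m.natDegree_map, hS2d, ← hSn i0, ← hS1 i0, hS1m.natDegree_map]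
  · rw [← Polynomial.map_mul, hprod2, map_map, ← hΨ, ← mapRingHom_comp]

theorem open_irr {W k₁ : Type} [CommRing W] [Field k₁] [IsAlgClosed k₁] {R : W[X][X]}
    (hR : R.Monic) (φ : W →+* k₁) (hirr : Irreducible (R.map (mRH φ))) :
    ∃ g : W, φ g ≠ 0 ∧ ∀ (k₀ : Type) [Field k₀] (ψ : W →+* k₀), ψ g ≠ 0 →
      Irreducible (R.map (mRH ψ)) := by
  classical
  have hW : Nontrivial W := φ.domain_nontrivial
  have key : ∀ n ∈ Finset.Ioc 0 (R.natDegree / 2), ∃ g : W, φ g ≠ 0 ∧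
      ∀ (k₀ : Type) [Field k₀] (ψ : W →+* k₀), ψ g ≠ 0 → ∀ S T : k₀[X][X], S.Monic → S.natDegree = n →
        S * T ≠ (R.map (mRH ψ)) := by
    intro n hn
    by_contra hcon
    push Not at hcon
    choose κ hκ ψ hψ S T hS hSn hST using fun g : {g : W // φ g ≠ 0} => hcon g.1 g.2
    obtain ⟨S', h1, h2, h3⟩ := open_factor hR φ ψ (fun x hx => by
      by_contra h
      exact hψ ⟨x, h⟩ (hx ⟨x, h⟩)) n S T hS hSn hST
    have h4 := (Monic.irreducible_iff_lt_natDegree_lt (hR.map (mRH φ))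
      (fun h => hirr.not_isUnit (h ▸ isUnit_one))).1 hirr
    refine h4 S' h1 ?_ h3
    rwa [h2, hR.natDegree_map]
  choose! g hg hg' using key
  refine ⟨∏ n ∈ Finset.Ioc 0 (R.natDegree / 2), g n, ?_, fun k₀ _ ψ hψ => ?_⟩
  · rw [map_prod]; exact prod_ne_zero_iff.2 hg
  · rw [map_prod, prod_ne_zero_iff] at hψ
    have hd : R.natDegree ≠ 0 := by
      intro h
      rw [hR.natDegree_eq_zero.1 h, Polynomial.map_one] at hirr
      exact hirr.not_isUnit isUnit_one
    refine (Monic.irreducible_iff_lt_natDegree_lt (hR.map (mRH ψ)) ?_).2 ?_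
    · intro h
      rw [← (hR.map _).natDegree_eq_zero, hR.natDegree_map] at h
      exact hd h
    · rintro S hS hSd ⟨T, hT⟩
      rw [hR.natDegree_map] at hSd
      exact hg' _ hSd k₀ ψ (hψ _ hSd) S T hS rfl hT.symm

end OpenIrr

section Resolvent
open Polynomial

noncomputable def esm (n : ℕ) (k : Type) [Field k] : MvPolynomial (Fin n) k →ₐ[k] MvPolynomial (Fin n) k :=
  MvPolynomial.aeval (fun i => MvPolynomial.esymm (Fin n) k (i + 1))

noncomputable def evE (n : ℕ) {k A : Type} [Field k] [CommRing A] [Algebra k A] (f : A[X]) :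
    MvPolynomial (Fin n) k →ₐ[k] A :=
  MvPolynomial.aeval (fun i => (-1) ^ ((i : ℕ) + 1) * f.coeff (n - (i + 1)))

lemma evE_map {n : ℕ} {k A B : Type} [Field k] [CommRing A] [Algebra k A] [CommRing B] [Algebra k B]
    (f : A[X]) (g : A →ₐ[k] B) :
    (evE n (f.map (g : A →+* B)) : MvPolynomial (Fin n) k →ₐ[k] B) = g.comp (evE n f) := by
  ext i
  simp [evE]

lemma evE_esm {n : ℕ} {k A : Type} [Field k] [CommRing A] [Algebra k A] (η : Fin n → A) :
    (MvPolynomial.aeval η).comp (esm n k) = evE n (∏ i, (X - C (η i))) := by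
  ext i
  simp only [esm, evE, AlgHom.comp_apply, MvPolynomial.aeval_X,
    MvPolynomial.aeval_esymm_eq_multiset_esymm]
  have h := Multiset.prod_X_sub_C_coeff (univ.val.map η) (k := n - (i + 1)) (by simp)
  rw [Multiset.map_map] at h
  change _ = (-1) ^ ((i : ℕ) + 1) * ((univ.val.map ((fun t => X - C t) ∘ η)).prod).coeff _
  rw [h]
  have h2 : n - (n - ((i : ℕ) + 1)) = i + 1 := by have := i.2; omega
  simp only [Multiset.card_map, Finset.card_val, card_univ, card_fin, h2]
  rw [← mul_assoc, ← mul_pow]; simp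

lemma symm_lift {n : ℕ} {k : Type} [Field k] (PP : (MvPolynomial (Fin n) k)[X])
    (h : ∀ τ : Perm (Fin n), PP.map (rename τ : MvPolynomial (Fin n) k →ₐ[k] MvPolynomial (Fin n) k).toRingHom = PP) :
    PP ∈ lifts (esm n k).toRingHom := by
  rw [lifts_iff_coeff_lifts]
  intro j
  have hs : PP.coeff j ∈ MvPolynomial.symmetricSubalgebra (Fin n) k := by
    rw [MvPolynomial.mem_symmetricSubalgebra]
    intro τ
    conv_rhs => rw [← h τ]
    rw [coeff_map]; rfl
  obtain ⟨q, hq⟩ := MvPolynomial.esymmAlgHom_surjective (σ := Fin n) k (n := n) (by simp) ⟨_, hs⟩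
  refine ⟨q, ?_⟩
  have := congrArg val hq
  rw [MvPolynomial.esymmAlgHom_apply] at this
  exact this

variable {n : ℕ} {k : Type} [Field k] (c : Fin n → k)

def thet {A : Type} [CommRing A] [Algebra k A] (η : Fin n → A) (π : Perm (Fin n)) : A :=
  ∑ i, c i • η (π i)

lemma map_thet {A B : Type} [CommRing A] [Algebra k A] [CommRing B] [Algebra k B] (g : A →ₐ[k] B)
    (η : Fin n → A) (π : Perm (Fin n)) : g (thet c η π) = thet c (fun i => g (η i)) π := by
  simp [thet]

lemma thet_perm {A : Type} [CommRing A] [Algebra k A] (η : Fin n → A) (τ π : Perm (Fin n)) :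
    thet c (fun i => η (τ i)) π = thet c η (τ * π) := rfl

noncomputable def resP {A : Type} [CommRing A] [Algebra k A] (η : Fin n → A) : A[X] :=
  ∏ π : Perm (Fin n), (X - C (thet c η π))

noncomputable def resH {A : Type} [CommRing A] [Algebra k A] (η : Fin n → A) (j : Fin n) : A[X] :=
  ∑ π : Perm (Fin n), C (η (π j)) * ∏ π' ∈ univ.erase π, (X - C (thet c η π'))

lemma map_resP {A B : Type} [CommRing A] [Algebra k A] [CommRing B] [Algebra k B] (g : A →ₐ[k] B)
    (η : Fin n → A) : (resP c η).map g.toRingHom = resP c (fun i => g (η i)) := by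
  simp only [resP, Polynomial.map_prod, Polynomial.map_sub, map_X, map_C]
  refine prod_congr rfl fun π _ => ?_
  rw [← map_thet]; rfl

lemma map_resH {A B : Type} [CommRing A] [Algebra k A] [CommRing B] [Algebra k B] (g : A →ₐ[k] B)
    (η : Fin n → A) (j : Fin n) : (resH c η j).map g.toRingHom = resH c (fun i => g (η i)) j := by
  simp only [resH, Polynomial.map_sum, Polynomial.map_mul, Polynomial.map_prod, Polynomial.map_sub, map_X, map_C]
  refine sum_congr rfl fun π _ => ?_
  congr 1
  refine prod_congr rfl fun π _ => ?_
  rw [← map_thet]; rfl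

lemma resP_perm {A : Type} [CommRing A] [Algebra k A] (η : Fin n → A) (τ : Perm (Fin n)) :
    resP c (fun i => η (τ i)) = resP c η := by
  simp only [resP, thet_perm]
  exact Fintype.prod_equiv (mulLeft τ) _ _ (fun _ => rfl)

lemma resH_perm {A : Type} [CommRing A] [Algebra k A] (η : Fin n → A) (τ : Perm (Fin n)) (j : Fin n) :
    resH c (fun i => η (τ i)) j = resH c η j := by
  simp only [resH, thet_perm]
  refine sum_equiv (mulLeft τ) _ _ (fun π => ?_)
  congr 1
  refine Finset.prod_equiv (mulLeft τ) (fun π' => ?_) (fun _ _ => rfl)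
  simp

lemma monic_resP {A : Type} [CommRing A] [Algebra k A] (η : Fin n → A) : (resP c η).Monic :=
  monic_prod_of_monic _ _ (fun _ _ => monic_X_sub_C _)

lemma natDegree_resP {A : Type} [CommRing A] [Algebra k A] [Nontrivial A] (η : Fin n → A) :
    (resP c η).natDegree = n.factorial := by
  rw [resP, natDegree_prod_of_monic _ _ (fun _ _ => monic_X_sub_C _)]
  simp [card_perm]

lemma exists_resU : ∃ Q : (MvPolynomial (Fin n) k)[X], Q.map (esm n k).toRingHom = resP c MvPolynomial.X
    ∧ Q.natDegree = (resP c (MvPolynomial.X : Fin n → MvPolynomial (Fin n) k)).natDegree ∧ Q.Monic :=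
  lifts_and_natDegree_eq_and_monic (symm_lift _ (fun τ => by
    rw [map_resP]
    simp only [MvPolynomial.rename_X]
    exact resP_perm c _ τ)) (monic_resP c _)

lemma exists_resHU (j : Fin n) : ∃ Q : (MvPolynomial (Fin n) k)[X],
    Q.map (esm n k).toRingHom = resH c MvPolynomial.X j :=
  (symm_lift _ (fun τ => by
    rw [map_resH]
    simp only [MvPolynomial.rename_X]
    exact resH_perm c _ τ j))

noncomputable def resol {A : Type} [CommRing A] [Algebra k A] (f : A[X]) : A[X] :=
  (exists_resU c).choose.map (evE n f).toRingHom

noncomputable def resolH {A : Type} [CommRing A] [Algebra k A] (f : A[X]) (j : Fin n) : A[X] :=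
  (exists_resHU c j).choose.map (evE n f).toRingHom

lemma monic_resol {A : Type} [CommRing A] [Algebra k A] (f : A[X]) : (resol c f).Monic :=
  (exists_resU c).choose_spec.2.2.map _

lemma natDegree_resol {A : Type} [CommRing A] [Nontrivial A] [Algebra k A] (f : A[X]) :
    (resol c f).natDegree = n.factorial := by
  rw [resol, (exists_resU c).choose_spec.2.2.natDegree_map, (exists_resU c).choose_spec.2.1,
    natDegree_resP]

lemma resol_map {A B : Type} [CommRing A] [Algebra k A] [CommRing B] [Algebra k B] (g : A →ₐ[k] B)
    (f : A[X]) : resol c (f.map (g : A →+* B)) = (resol c f).map (g : A →+* B) := by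
  rw [resol, resol, evE_map, map_map]; rfl

lemma resolH_map {A B : Type} [CommRing A] [Algebra k A] [CommRing B] [Algebra k B] (g : A →ₐ[k] B)
    (f : A[X]) (j : Fin n) : resolH c (f.map (g : A →+* B)) j = (resolH c f j).map (g : A →+* B) := by
  rw [resolH, resolH, evE_map, map_map]; rfl

lemma resol_prod {A : Type} [CommRing A] [Algebra k A] (η : Fin n → A) :
    resol c (∏ i, (X - C (η i))) = resP c η := by
  rw [resol, ← evE_esm]
  have := (exists_resU c).choose_spec.1
  have h2 := congrArg (Polynomial.map (MvPolynomial.aeval (R := k) η).toRingHom) this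
  rw [map_resP, map_map] at h2
  simp only [MvPolynomial.aeval_X] at h2
  exact h2

lemma resolH_prod {A : Type} [CommRing A] [Algebra k A] (η : Fin n → A) (j : Fin n) :
    resolH c (∏ i, (X - C (η i))) j = resH c η j := by
  rw [resolH, ← evE_esm]
  have := (exists_resHU c j).choose_spec
  have h2 := congrArg (Polynomial.map (MvPolynomial.aeval (R := k) η).toRingHom) this
  rw [map_resH, map_map] at h2
  simp only [MvPolynomial.aeval_X] at h2
  exact h2

end Resolvent

section Comb

lemma card_fix_eq (n : ℕ) (S : Finset (Fin n)) :
    Nat.card {σ : Perm (Fin n) // ∀ i, σ i = i ↔ i ∈ S} = numDerangements (n - S.card) := by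
  classical
  have e : {σ : Perm (Fin n) // ∀ i, σ i = i ↔ i ∈ S} ≃ derangements {i : Fin n // i ∉ S} := by
    refine Equiv.symm ?_
    refine (subtypeEquiv (Perm.subtypeEquivSubtypePerm (fun i => i ∉ S))
      (q := fun σ => ∀ i, i ∉ S → σ.1 i ≠ i) ?_).trans ?_
    · intro a
      simp only [derangements, Set.mem_setOf_eq, Perm.subtypeEquivSubtypePerm_apply_coe]
      constructor
      · intro h i hi
        rw [Perm.ofSubtype_apply_of_mem (p := fun i => i ∉ S) a hi]
        intro h'
        exact h ⟨i, hi⟩ (Subtype.ext h')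
      · intro h x hx
        refine h x.1 x.2 ?_
        rw [Perm.ofSubtype_apply_of_mem (p := fun i => i ∉ S) a x.2]
        exact congrArg val hx
    · refine (Equiv.subtypeSubtypeEquivSubtypeInter _ (fun σ : Perm (Fin n) => ∀ i, i ∉ S → σ i ≠ i)).trans (Equiv.subtypeEquivRight ?_)
      intro σ
      constructor
      · rintro ⟨h1, h2⟩ i
        constructor
        · intro h; by_contra h'; exact h2 i h' h
        · intro h; exact h1 i (by simpa using h)
      · intro h
        refine ⟨fun a ha => (h a).2 (by simpa using ha), fun i hi h' => hi ((h i).1 h')⟩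
  rw [card_congr e, card_eq_fintype_card, card_derangements_eq_numDerangements]
  congr 1
  rw [Fintype.card_subtype_compl]; simp

lemma card_fix (n k : ℕ) :
    (univ.filter (fun σ : Perm (Fin n) => (univ.filter (fun i => σ i = i)).card = k)).card
      = n.choose k * numDerangements (n - k) := by
  classical
  have h1 : (univ.filter (fun σ : Perm (Fin n) => (univ.filter (fun i => σ i = i)).card = k))
     = (Finset.powersetCard k univ).biUnion (fun S => univ.filter (fun σ : Perm (Fin n) => ∀ i, σ i = i ↔ i ∈ S)) := by
    ext σ
    simp only [mem_filter, mem_univ, true_and, Finset.mem_biUnion, Finset.mem_powersetCard,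
      Finset.subset_univ]
    constructor
    · intro h; exact ⟨_, h, by simp⟩
    · rintro ⟨S, hS, h⟩
      rw [← hS]; congr 1; ext i; simp [h]
  rw [h1, Finset.card_biUnion]
  · rw [sum_congr rfl (g := fun _ => numDerangements (n - k))]
    · simp
    · intro S hS
      rw [Finset.mem_powersetCard] at hS
      rw [← hS.2, ← card_fix_eq, card_eq_fintype_card, card_subtype]
  · intro S _ T _ hST
    rw [Function.onFun, Finset.disjoint_left]
    intro σ h1 h2
    apply hST
    simp only [mem_filter, mem_univ, true_and] at h1 h2
    ext i; rw [← h1, h2]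

lemma fix_formula (n k : ℕ) (hk : k ≤ n) :
    ((univ.filter (fun σ : Perm (Fin n) => (univ.filter (fun i => σ i = i)).card = k)).card : ℝ)
      / n.factorial = ∑ s ∈ Icc k n, (-1 : ℝ) ^ (k + s) / (Nat.factorial s) * (Nat.choose s k) := by
  rw [card_fix]
  have h0 : (numDerangements (n - k) : ℝ) = ∑ j ∈ range (n - k + 1), (-1 : ℝ)^j * ((n-k).factorial / j.factorial) := by
    have := numDerangements_sum (n - k)
    have h2 : ((numDerangements (n - k) : ℤ) : ℝ) = _ := congrArg (Int.cast) this
    rw [Int.cast_natCast] at h2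
    rw [h2]; push_cast
    refine sum_congr rfl fun j hj => ?_
    congr 1
    have hj' : j ≤ n - k := by simpa [Nat.lt_succ_iff] using hj
    rw [eq_div_iff (by positivity), mul_comm]
    have := Nat.factorial_mul_ascFactorial j (n - k - j)
    rw [Nat.add_sub_cancel' hj'] at this
    exact_mod_cast this
  have h1 : Icc k n = (range (n - k + 1)).image (fun j => k + j) := by
    ext s; simp only [Finset.mem_Icc, Finset.mem_image, mem_range]
    constructor
    · intro h; exact ⟨s - k, by omega, by omega⟩
    · rintro ⟨j, hj, rfl⟩; omega
  rw [h1, Finset.sum_image (by intro a _ b _ h; simpa using h), cast_mul, h0, Nat.cast_choose ℝ hk,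
    mul_sum, Finset.sum_div]
  refine sum_congr rfl fun j hj => ?_
  rw [Nat.cast_choose ℝ (Nat.le_add_right k j), Nat.add_sub_cancel_left]
  have : (-1 : ℝ)^(k + (k + j)) = (-1)^j := by rw [← add_assoc, pow_add, ← two_mul, pow_mul]; simp
  rw [this]
  have := factorial_ne_zero n
  have := factorial_ne_zero (n-k)
  have := factorial_ne_zero (k+j)
  field_simp

end Comb

section TwoTrans
open Polynomial

noncomputable def bev {k Ω : Type} [CommRing k] [CommRing Ω] (i : k →+* Ω) (y x : Ω) : k[X][X] →+* Ω :=
  eval₂RingHom (eval₂RingHom i y) x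

lemma bev_map {k k' Ω : Type} [CommRing k] [CommRing k'] [CommRing Ω] (j : k →+* k') (i : k' →+* Ω) (y x : Ω)
    (P : k[X][X]) : bev i y x (P.map (mRH j)) = bev (i.comp j) y x P := by
  have : (bev i y x).comp (mRH (mRH j)) = bev (i.comp j) y x := by
    ext <;> simp [bev]
  exact congrArg (fun g => g P) this

lemma comp_bev {k Ω Ω' : Type} [CommRing k] [CommRing Ω'] [CommRing Ω] (i : k →+* Ω) (y x : Ω) (g : Ω →+* Ω')
    (P : k[X][X]) : g (bev i y x P) = bev (g.comp i) (g y) (g x) P := by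
  have : g.comp (bev i y x) = bev (g.comp i) (g y) (g x) := by
    ext <;> simp [bev]
  exact congrArg (fun g => g P) this

lemma irr_ext {k k' : Type} [Field k] [IsAlgClosed k] [Field k'] (j : k →+* k') {P : k[X][X]}
    (hP : P.Monic) (hirr : Irreducible P) : Irreducible (P.map (mRH j)) := by
  obtain ⟨g, hg, h⟩ := open_irr hP (RingHom.id k) (by
    rw [mapRingHom_id, map_id]; exact hirr)
  refine h k' j ?_
  simpa using hg

lemma alg_mem {k Ω : Type} [Field k] [IsAlgClosed k] [Field Ω] [Algebra k Ω] {x : Ω}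
    (h : IsAlgebraic k x) : ∃ a, aM k Ω a = x := by
  have h1 : x ∈ algebraicClosure k Ω := mem_algebraicClosure_iff.2 h
  rw [IntermediateField.eq_bot_of_isAlgClosed_of_isAlgebraic (algebraicClosure k Ω)] at h1
  exact IntermediateField.mem_bot.1 h1

lemma y_mem {k Ω : Type} [Field k] [IsAlgClosed k] [Field Ω] (i : k →+* Ω) {P : k[X][X]}
    (hP : P.Monic) {x : Ω} {b : k} (h0 : bev i (i b) x P = 0) : ∃ a, i a = x := by
  let _ := i.toAlgebra
  have h1 : aeval x (P.map (eRH b)) = 0 := by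
    have : (aeval x : k[X] →ₐ[k] Ω).toRingHom.comp (mRH (eRH b)) = bev i (i b) x := by
      ext <;> simp [bev, RingHom.algebraMap_toAlgebra]
    rw [← this] at h0
    exact h0
  exact alg_mem (k := k) ⟨_, (hP.map _).ne_zero, h1⟩

lemma gen_point {k Ω : Type} [Field k] [IsAlgClosed k] [Field Ω] (i : k →+* Ω) {P : k[X][X]}
    (hP : P.Monic) (hirr : Irreducible P) {y x : Ω} (h0 : bev i y x P = 0) (hy : ∀ b, i b ≠ y)
    {H : k[X][X]} (hH : bev i y x H = 0) : P ∣ H := by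
  let _ := i.toAlgebra
  have htr : Transcendental k y := by
    intro h
    obtain ⟨b, hb⟩ := alg_mem h
    exact hy b hb
  let _ : Algebra k[X] Ω := (aeval y : k[X] →ₐ[k] Ω).toRingHom.toAlgebra
  have hinj : Injective (aM k[X] Ω) := transcendental_iff_injective.1 htr
  have : IsTorsionFree k[X] Ω :=
    Module.isTorsionFree_iff_faithfulSMul.2 ((faithfulSMul_iff_algebraMap_injective _ _).2 hinj)
  have hev : ∀ H : k[X][X], aeval x H = bev i y x H := by
    intro H
    have : (aeval x : k[X][X] →ₐ[k[X]] Ω).toRingHom = bev i y x := by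
      ext <;> simp [bev, RingHom.algebraMap_toAlgebra]
    exact congrArg (fun g => g H) this
  have hint : IsIntegral k[X] x := ⟨P, hP, by rw [← aeval_def, hev]; exact h0⟩
  have h1 := minpoly.isIntegrallyClosed_dvd hint (p := P) (by rw [hev]; exact h0)
  have h2 := minpoly.isIntegrallyClosed_dvd hint (p := H) (by rw [hev]; exact hH)
  have h3 : Associated (minpoly k[X] x) P := by
    refine ((minpoly.prime_of_isIntegrallyClosed hint).irreducible).associated_of_dvd hirr h1
  exact h3.symm.dvd.trans h2

lemma lift_field {F S Ω : Type} [Field F] [Field S] [Field Ω] [Algebra F S] [Algebra.IsAlgebraic F S]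
    [IsAlgClosed Ω] (β : F →+* Ω) : ∃ γ : S →+* Ω, γ.comp (aM F S) = β := by
  let _ := β.toAlgebra
  exact ⟨(lift : S →ₐ[F] Ω).toRingHom, by ext x; exact (lift : S →ₐ[F] Ω).commutes x⟩

lemma no_indep {k D S : Type} [Field k] [CommRing D] [IsDomain D] [Field S] [Algebra k[X] D] [Algebra.IsIntegral k[X] D]
    [Algebra D S] (h1 : Injective (aM k[X] D)) (h2 : Injective (aM D S))
    [Algebra.IsAlgebraic D S] [Algebra k S]
    (hk : aM k S = (aM D S).comp ((aM k[X] D).comp C)) (σ τ : S) :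
    ¬ Injective (bev (aM k S) σ τ) := by
  intro hv
  let _ : Algebra k[X] S := ((aM D S).comp (aM k[X] D)).toAlgebra
  have : IsScalarTower k[X] D S := IsScalarTower.of_algebraMap_eq (fun _ => rfl)
  have : IsScalarTower k k[X] S := IsScalarTower.of_algebraMap_eq (fun x => by rw [hk]; rfl)
  have f1 : FaithfulSMul k[X] D := (faithfulSMul_iff_algebraMap_injective _ _).2 h1
  have f2 : FaithfulSMul D S := (faithfulSMul_iff_algebraMap_injective _ _).2 h2
  have f3 : FaithfulSMul k[X] S := (faithfulSMul_iff_algebraMap_injective _ _).2 (h2.comp h1)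
  have : Algebra.IsAlgebraic k[X] D := Algebra.IsIntegral.isAlgebraic
  have : Algebra.IsAlgebraic k[X] S := Algebra.IsAlgebraic.trans k[X] D S
  have e1 := _root_.trdeg_add_eq k k[X] (A := S)
  rw [trdeg_of_isDomain, _root_.trdeg_eq_zero, add_zero] at e1
  have e3 := _root_.trdeg_add_eq k k[X] (A := k[X][X])
  rw [trdeg_of_isDomain, trdeg_of_isDomain] at e3
  let φ : k[X][X] →ₐ[k] S := { bev (aM k S) σ τ with
    commutes' := fun r => by
      change bev (aM k S) σ τ (C (C r)) = _
      simp [bev] }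
  have e2 := trdeg_le_of_injective φ hv
  rw [← e1, ← e3] at e2
  norm_num at e2

lemma ext_step {k Ω : Type} [Field k] [IsAlgClosed k] [Field Ω] [IsAlgClosed Ω] (i j : k →+* Ω) {P : k[X][X]}
    (hP : P.Monic) (hirr : Irreducible P) {y x y' x' : Ω} (h0 : bev i y x P = 0) (hy : ∀ b, i b ≠ y)
    (h0' : bev j y' x' P = 0) (hy' : ∀ b, j b ≠ y') :
    ∃ (k₁ : Type) (_ : Field k₁) (_ : IsAlgClosed k₁) (_ : Algebra k k₁) (i' j' : k₁ →+* Ω),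
      i'.comp (aM k k₁) = i ∧ j'.comp (aM k k₁) = j ∧
      (∃ a b, i' a = x ∧ i' b = y ∧ j' a = x' ∧ j' b = y') ∧
      ∀ σ τ : k₁, ¬ Injective (bev (aM k k₁) σ τ) := by
  have hpr : Prime P := hirr.prime
  let D := AdjoinRoot P
  have hD : IsDomain D := AdjoinRoot.isDomain_of_prime hpr
  let α : D →+* Ω := AdjoinRoot.lift (eval₂RingHom i y) x h0
  let β : D →+* Ω := AdjoinRoot.lift (eval₂RingHom j y') x' h0'
  have hα : Injective α := by
    rw [injective_iff_map_eq_zero]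
    intro a ha
    obtain ⟨H, rfl⟩ := mk_surjective a
    replace ha := (lift_mk h0 H).symm.trans ha
    exact mk_eq_zero.2 (gen_point i hP hirr h0 hy ha)
  have hβ : Injective β := by
    rw [injective_iff_map_eq_zero]
    intro a ha
    obtain ⟨H, rfl⟩ := mk_surjective a
    replace ha := (lift_mk h0' H).symm.trans ha
    exact mk_eq_zero.2 (gen_point j hP hirr h0' hy' ha)
  let F := FractionRing D
  let α1 : F →+* Ω := IsFractionRing.lift hα
  let β1 : F →+* Ω := IsFractionRing.lift hβ
  let _ : Algebra F Ω := α1.toAlgebra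
  let S := algebraicClosure F Ω
  obtain ⟨γ, hγ⟩ := lift_field (S := S) β1
  let κ : k →+* S := (aM F S).comp ((aM D F).comp ((AdjoinRoot.of P).comp C))
  have hα1 : ∀ z : D, aM S Ω (aM F S (aM D F z)) = α z := fun z =>
    IsFractionRing.lift_algebraMap hα z
  have hβ1 : ∀ z : D, γ (aM F S (aM D F z)) = β z := fun z => by
    have : γ (aM F S (aM D F z)) = β1 (aM D F z) := by rw [← hγ]; rfl
    rw [this]; exact IsFractionRing.lift_algebraMap hβ z
  have hS : IsAlgClosed S := IsAlgClosure.isAlgClosed F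
  refine ⟨S, inferInstance, hS, κ.toAlgebra, aM S Ω, γ, ?_, ?_,
    ⟨aM F S (aM D F (AdjoinRoot.root P)), aM F S (aM D F (AdjoinRoot.of P X)), ?_⟩, ?_⟩
  · ext a
    change aM S Ω (aM F S (aM D F _)) = _
    rw [hα1]; exact (lift_of h0).trans (by simp)
  · ext a
    change γ (aM F S (aM D F _)) = _
    rw [hβ1]; exact (lift_of h0').trans (by simp)
  · rw [hα1, hα1, hβ1, hβ1]
    exact ⟨AdjoinRoot.lift_root h0, (lift_of h0).trans (by simp),
      AdjoinRoot.lift_root h0', (lift_of h0').trans (by simp)⟩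
  · let _ := κ.toAlgebra
    let _ : Algebra D S := ((aM F S).comp (aM D F)).toAlgebra
    have : IsScalarTower D F S := IsScalarTower.of_algebraMap_eq (fun _ => rfl)
    have hDS : Injective (aM D S) :=
      (aM F S).injective.comp (injective D F)
    have : Algebra.IsAlgebraic D F := IsLocalization.isAlgebraic (R := D) F (nonZeroDivisors D)
    have : Algebra.IsAlgebraic D S := Algebra.IsAlgebraic.trans D F S
    have : Algebra.IsIntegral k[X] D := by
      have := hP.free_adjoinRoot
      have := hP.finite_adjoinRoot
      infer_instance
    refine no_indep (D := D) ?_ hDS rfl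
    exact AdjoinRoot.of.injective_of_degree_ne_zero (by
      intro h
      have h1 := hP.natDegree_eq_zero.1 (natDegree_eq_zero_iff_degree_le_zero.2 h.le)
      exact hirr.not_isUnit (h1 ▸ isUnit_one))

def OnPt {k Ω : Type} [CommRing k] [CommRing Ω] (i : k →+* Ω) (P E : k[X][X]) (s t : Ω) (y x : Ω) : Prop :=
  bev i y x P = 0 ∧ bev i y x E + s * y + t = 0

lemma st_mem {k Ω : Type} [Field k] [Field Ω] (i : k →+* Ω) {P E : k[X][X]} {s t : Ω} {a b a' b' : k}
    (h : OnPt i P E s t (i b) (i a)) (h' : OnPt i P E s t (i b') (i a')) (hne : b ≠ b') :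
    s = i ((bev (RingHom.id k) b' a' E - bev (RingHom.id k) b a E) / (b - b')) ∧
    t = i (- bev (RingHom.id k) b a E - ((bev (RingHom.id k) b' a' E - bev (RingHom.id k) b a E) / (b - b')) * b) := by
  have e : ∀ b a, i (bev (RingHom.id k) b a E) = bev i (i b) (i a) E := by
    intro b a; rw [comp_bev]; rfl
  have hne' : i b - i b' ≠ 0 := sub_ne_zero.2 (fun h => hne (i.injective h))
  have h1 := h.2
  have h2 := h'.2
  have hs : s = (bev i (i b') (i a') E - bev i (i b) (i a) E) / (i b - i b') := by
    rw [eq_div_iff hne']; linear_combination h1 - h2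
  refine ⟨?_, ?_⟩
  · rw [map_div₀, map_sub, map_sub, e, e, hs]
  · rw [map_sub, map_neg, map_mul, map_div₀, map_sub, map_sub, e, e, ← hs]
    linear_combination h1

lemma pt_notmem {k Ω : Type} [Field k] [IsAlgClosed k] [Field Ω] [Algebra k Ω] {P E : k[X][X]} {s t y x : Ω}
    (hinj : Injective (bev (aM k Ω) s t))
    (hP : P.Monic) (h : OnPt (aM k Ω) P E s t y x) (b : k) : aM k Ω b ≠ y := by
  rintro rfl
  obtain ⟨a, rfl⟩ := y_mem _ hP h.1
  have h2 := h.2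
  have e : aM k Ω (bev (RingHom.id k) b a E) = bev (aM k Ω) (aM k Ω b) (aM k Ω a) E := by
    rw [comp_bev]; rfl
  rw [← e] at h2
  have h3 : bev (aM k Ω) s t (C (C (bev (RingHom.id k) b a E) + X * C b) + X) = 0 := by
    simp only [bev, coe_eval₂RingHom, eval₂_add, eval₂_C, eval₂_X, eval₂_mul]
    exact h2
  have h4 := (injective_iff_map_eq_zero _).1 hinj _ h3
  have h5 := congrArg (fun p => p.coeff 1) h4
  simp at h5

lemma pt_notmem2 {k k₁ Ω : Type} [Field k] [Field k₁] [IsAlgClosed k₁] [Field Ω] [Algebra k Ω] [Algebra k k₁]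
    {P E : k[X][X]} {s t y x y' x' : Ω}
    (hinj : Injective (bev (aM k Ω) s t)) (hP : P.Monic) (i : k₁ →+* Ω)
    (hi : i.comp (aM k k₁) = aM k Ω)
    (hno : ∀ σ τ : k₁, ¬ Injective (bev (aM k k₁) σ τ))
    (h : OnPt (aM k Ω) P E s t y x) (h' : OnPt (aM k Ω) P E s t y' x') (hne : y ≠ y')
    (hy : ∃ b, i b = y) (b : k₁) : i b ≠ y' := by
  rintro rfl
  obtain ⟨b0, rfl⟩ := hy
  have tr : ∀ {y x}, OnPt (aM k Ω) P E s t y x →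
      OnPt i (P.map (mRH (aM k k₁))) (E.map (mRH (aM k k₁))) s t y x := by
    intro y x h
    unfold OnPt
    rw [bev_map, bev_map, hi]; exact h
  have h1 := tr h
  have h2 := tr h'
  obtain ⟨a0, rfl⟩ := y_mem i (hP.map _) h1.1
  obtain ⟨a1, rfl⟩ := y_mem i (hP.map _) h2.1
  obtain ⟨hs, ht⟩ := st_mem i h1 h2 (fun h => hne (h ▸ rfl))
  generalize (bev (RingHom.id k₁) b a1 (E.map (mRH (aM k k₁))) -
    bev (RingHom.id k₁) b0 a0 (E.map (mRH (aM k k₁)))) / (b0 - b) = σ at hs ht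
  generalize -bev (RingHom.id k₁) b0 a0 (E.map (mRH (aM k k₁))) - σ * b0 = τ at ht
  rw [hs, ht] at hinj
  refine hno σ τ (Injective.of_comp (f := i) ?_)
  convert hinj using 1
  ext p
  rw [Function.comp, comp_bev, hi]

lemma surj_of {k k₁ Ω : Type} [Field k] [Field k₁] [IsAlgClosed k₁] [Field Ω] [Algebra k Ω] [Algebra k k₁]
    {s t : Ω} (hinj : Injective (bev (aM k Ω) s t)) (i : k₁ →+* Ω)
    (hi : i.comp (aM k k₁) = aM k Ω)
    (hal : ∀ x : Ω, ∃ p : k[X][X][X], p ≠ 0 ∧ eval₂ (bev (aM k Ω) s t) x p = 0)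
    (σ τ : k₁) (hs : i σ = s) (ht : i τ = t) : Function.Bijective i := by
  refine ⟨i.injective, fun x => ?_⟩
  obtain ⟨p, hp, hx⟩ := hal x
  let _ := i.toAlgebra
  have hb : i.comp (bev (aM k k₁) σ τ) = bev (aM k Ω) s t := by
    refine RingHom.ext fun q => ?_
    rw [comp_apply, comp_bev, hi, hs, ht]
  refine alg_mem (k := k₁) (x := x) ⟨p.map (bev (aM k k₁) σ τ), ?_, ?_⟩
  · rw [Polynomial.map_ne_zero_iff]
    · exact hp
    · rw [← hb] at hinj
      exact Injective.of_comp (f := i) hinj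
  · rw [aeval_def, eval₂_map]
    change eval₂ (i.comp _) x p = 0
    rw [hb, hx]

theorem two_trans {k Ω : Type} [Field k] [IsAlgClosed k] [Field Ω] [IsAlgClosed Ω] [Algebra k Ω]
    {P E : k[X][X]} (hP : P.Monic) (hirr : Irreducible P) {s t : Ω}
    (hinj : Injective (bev (aM k Ω) s t))
    (hal : ∀ x : Ω, ∃ p : k[X][X][X], p ≠ 0 ∧ eval₂ (bev (aM k Ω) s t) x p = 0)
    {y x y' x' z w z' w' : Ω}
    (h1 : OnPt (aM k Ω) P E s t y x) (h2 : OnPt (aM k Ω) P E s t y' x')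
    (h3 : OnPt (aM k Ω) P E s t z w) (h4 : OnPt (aM k Ω) P E s t z' w')
    (hy : y ≠ y') (hz : z ≠ z') :
    ∃ g : Ω ≃+* Ω, (∀ a, g (aM k Ω a) = aM k Ω a) ∧ g s = s ∧ g t = t ∧ g y = z ∧ g y' = z' := by
  obtain ⟨k₁, _, _, _, i, j, hi, hj, ⟨a, b, hia, hib, hja, hjb⟩, hno⟩ := ext_step _ _ hP hirr h1.1
    (pt_notmem hinj hP h1) h3.1 (pt_notmem hinj hP h3)
  have ny := pt_notmem2 hinj hP i hi hno h1 h2 hy ⟨b, hib⟩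
  have nz := pt_notmem2 hinj hP j hj hno h3 h4 hz ⟨b, hjb⟩
  have h2' := h2.1
  have h4' := h4.1
  rw [← hi, ← bev_map] at h2'
  rw [← hj, ← bev_map] at h4'
  obtain ⟨k₂, _, _, _, i', j', hi', hj', ⟨a', b', hia', hib', hja', hjb'⟩, -⟩ := ext_step _ _ (hP.map _)
    (irr_ext _ hP hirr) h2' ny h4' nz
  let _ : Algebra k k₂ := ((aM k₁ k₂).comp (aM k k₁)).toAlgebra
  have hI : i'.comp (aM k k₂) = aM k Ω := by
    rw [← hi, ← hi']; rfl
  have hJ : j'.comp (aM k k₂) = aM k Ω := by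
    rw [← hj, ← hj']; rfl
  have tr : ∀ (i' : k₂ →+* Ω), i'.comp (aM k k₂) = aM k Ω → ∀ {y x}, OnPt (aM k Ω) P E s t y x →
      OnPt i' (P.map (mRH (aM k k₂))) (E.map (mRH (aM k k₂))) s t y x := by
    intro i' hi y x h
    unfold OnPt
    rw [bev_map, bev_map, hi]; exact h
  have e1 : ∀ u, i' (aM k₁ k₂ u) = i u := fun u => by rw [← hi']; rfl
  have e2 : ∀ u, j' (aM k₁ k₂ u) = j u := fun u => by rw [← hj']; rfl
  rw [← e1] at hia hib
  rw [← e2] at hja hjb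
  subst hia hib hja hjb hia' hib' hja' hjb'
  have hne : aM k₁ k₂ b ≠ b' := fun h => hy (h ▸ rfl)
  obtain ⟨hs, ht⟩ := st_mem i' (tr i' hI h1) (tr i' hI h2) hne
  obtain ⟨hs', ht'⟩ := st_mem j' (tr j' hJ h3) (tr j' hJ h4) hne
  have bi := surj_of hinj i' hI hal _ _ hs.symm ht.symm
  have bj := surj_of hinj j' hJ hal _ _ hs'.symm ht'.symm
  let g := (RingEquiv.ofBijective i' bi).symm.trans (RingEquiv.ofBijective j' bj)
  have hg : ∀ u, g (i' u) = j' u := by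
    intro u
    have : (RingEquiv.ofBijective i' bi).symm (i' u) = u := (RingEquiv.ofBijective i' bi).symm_apply_apply u
    change j' ((RingEquiv.ofBijective i' bi).symm (i' u)) = _
    rw [this]
  refine ⟨g, fun a => ?_, ?_, ?_, hg _, hg _⟩
  · have u1 := congrArg (fun f => f a) hI
    have u2 := congrArg (fun f => f a) hJ
    simp only [comp_apply] at u1 u2
    rw [← u1, hg, u2, u1]
  · conv_lhs => rw [hs]
    rw [hg]; exact hs'.symm
  · conv_lhs => rw [ht]
    rw [hg]; exact ht'.symm

end TwoTrans

section Inertia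
open Polynomial

lemma inertia {G B D k : Type} [Group G] [Finite G] [CommRing B] [CommRing D] [IsDomain D] [Field k]
    (act : G → B →+* B) (hmul : ∀ σ τ b, act (σ * τ) b = act σ (act τ b)) (h1 : ∀ b, act 1 b = b)
    (φ : B →+* D) (ψ : D →+* k) (ι : k → B) (hι : ∀ σ a, act σ (ι a) = ι a)
    (hχ : ∀ a, ψ (φ (ι a)) = a) (τ : D) (hτ : τ ≠ 0) (hψτ : ψ τ = 0)
    (hinv : ∀ x : B, (∀ σ, act σ x = x) → ψ (φ x) = 0 → ∃ b : D, φ x = τ * b)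
    (z : B) (h A : D) (hz : ψ (φ z) = 0) (heq : (φ z) ^ 2 * h + τ * A = 0) (hA : ψ A ≠ 0) :
    ∃ σ, σ ≠ 1 ∧ ∀ b, ψ (φ (act σ b)) = ψ (φ b) := by
  classical
  by_contra! hcon
  have := Fintype.ofFinite G
  have hc : ∀ σ : G, ∃ c : B, σ ≠ 1 → ψ (φ (act σ c)) = 0 ∧ ψ (φ c) ≠ 0 := by
    intro σ
    by_cases hσ : σ = 1
    · exact ⟨0, fun h => absurd hσ h⟩
    obtain ⟨b, hb⟩ := hcon σ hσ
    refine ⟨b - ι (ψ (φ (act σ b))), fun _ => ⟨?_, ?_⟩⟩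
    · rw [map_sub, map_sub, map_sub, hι, hχ, sub_self]
    · rw [map_sub, map_sub, hχ]; exact sub_ne_zero.2 hb.symm
  choose cc hcc using hc
  let c := ∏ σ ∈ univ.erase (1 : G), cc σ
  have hc1 : ψ (φ c) ≠ 0 := by
    simp only [c, map_prod]
    exact prod_ne_zero_iff.2 fun σ hσ => (hcc σ (ne_of_mem_erase hσ)).2
  have hc2 : ∀ σ, σ ≠ 1 → ψ (φ (act σ c)) = 0 := by
    intro σ hσ
    simp only [c, map_prod]
    exact prod_eq_zero (mem_erase.2 ⟨hσ, mem_univ _⟩) (hcc σ hσ).1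
  let H : B[X] := ∑ σ : G, C (act σ (c * z)) * ∏ π ∈ univ.erase σ, (X - C (act π c))
  have hH : ∀ ρ : G, H.map (act ρ) = H := by
    intro ρ
    simp only [H, Polynomial.map_sum, Polynomial.map_mul, Polynomial.map_prod, Polynomial.map_sub, map_X, map_C, ← hmul]
    refine sum_equiv (mulLeft ρ) _ _ (fun σ => ?_)
    simp only [Equiv.coe_mulLeft]
    congr 1
    refine Finset.prod_bij (fun π _ => ρ * π) ?_ ?_ ?_ ?_
    · intro π hπ; simpa using hπ
    · intro a _ b _ hab; simpa using hab
    · intro b hb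
      refine ⟨ρ⁻¹ * b, ?_, by simp⟩
      simp only [mem_erase, mem_univ, and_true] at hb ⊢
      intro h; apply hb; rw [← h]; simp
    · intro a _; rfl
  have hco : ∀ n, ∃ b : D, φ (H.coeff n) = τ * b := by
    intro n
    refine hinv _ (fun σ => ?_) ?_
    · conv_rhs => rw [← hH σ]
      rw [coeff_map]
    · have : H.map (ψ.comp φ) = 0 := by
        simp only [H, Polynomial.map_sum, Polynomial.map_mul, map_C]
        refine sum_eq_zero fun σ _ => ?_
        have : ψ.comp φ (act σ (c * z)) = 0 := by
          by_cases hσ : σ = 1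
          · rw [hσ, h1]; simp [hz]
          · simp [hc2 σ hσ]
        rw [this]; simp
      have := congrArg (fun p => p.coeff n) this
      simpa using this
  choose bb hbb using hco
  let m := c * ∏ π ∈ univ.erase (1 : G), (c - act π c)
  have hev : H.eval c = z * m := by
    simp only [H, eval_finsetSum, eval_mul, eval_prod, eval_sub, eval_X, eval_C]
    rw [sum_eq_single 1]
    · rw [h1]; simp only [m]; ring
    · intro σ _ hσ
      rw [prod_eq_zero (i := 1)]
      · simp
      · simpa using hσ.symm
      · rw [h1, sub_self]
    · simp
  have hm : ψ (φ m) ≠ 0 := by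
    simp only [m, map_mul, map_prod, map_sub]
    refine mul_ne_zero hc1 (prod_ne_zero_iff.2 fun σ hσ => ?_)
    rw [hc2 σ (ne_of_mem_erase hσ), sub_zero]; exact hc1
  have hzm : ∃ b, φ z * φ m = τ * b := by
    rw [← map_mul, ← hev, eval_eq_sum_range, map_sum]
    refine ⟨∑ i ∈ range (H.natDegree + 1), bb i * φ c ^ i, ?_⟩
    rw [mul_sum]
    refine sum_congr rfl fun i _ => ?_
    rw [map_mul, map_pow, hbb]; ring
  obtain ⟨b, hb⟩ := hzm
  have e1 : τ * (τ * b ^ 2 * h + A * φ m ^ 2) = 0 := by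
    have : (φ z * φ m) ^ 2 * h + τ * A * φ m ^ 2 = 0 := by linear_combination (φ m) ^ 2 * heq
    rw [hb] at this
    linear_combination this
  have e2 := (mul_eq_zero.1 e1).resolve_left hτ
  have e3 := congrArg ψ e2
  simp only [map_add, map_mul, map_pow, hψτ, map_zero, zero_mul, zero_add] at e3
  exact (mul_ne_zero hA (pow_ne_zero 2 hm)) e3

lemma inv_form {A k1 : Type} [CommRing A] [Field k1] (j : A →+* k1) (u : FractionRing k1[X])
    (hu : ((aM k1[X] (FractionRing k1[X])).comp (mRH j)).IsIntegralElem u) :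
    ∃ (w0 : k1) (w1 : k1[X]), u = aM k1[X] (FractionRing k1[X]) (C w0 + X * w1) ∧
      j.IsIntegralElem w0 ∧ (mRH j).IsIntegralElem w1 := by
  obtain ⟨p, hp, hpu⟩ := hu
  have h1 : IsIntegral k1[X] u := ⟨p.map (mRH j), hp.map _, by rw [eval₂_map]; exact hpu⟩
  obtain ⟨w, rfl⟩ := IsIntegrallyClosed.isIntegral_iff.1 h1
  have h2 : (mRH j).IsIntegralElem w := by
    refine ⟨p, hp, injective k1[X] (FractionRing k1[X]) ?_⟩
    rw [hom_eval₂, hpu, map_zero]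
  let _ := j.toAlgebra
  let _ : Algebra A[X] k1[X] := Polynomial.algebra A k1
  have h3 : ∀ n, j.IsIntegralElem (w.coeff n) := fun n =>
    isIntegral_iff_isIntegral_coeff.1 (show IsIntegral A[X] w from h2) n
  refine ⟨w.coeff 0, w.divX, ?_, h3 0, ?_⟩
  · rw [add_comm, X_mul_divX_add]
  · exact (isIntegral_iff_isIntegral_coeff (R := A) (f := w.divX)).2 (fun n => by rw [coeff_divX]; exact h3 _)

lemma root_const {k D : Type} [Field k] [IsAlgClosed k] [CommRing D] [IsDomain D] (γ : k →+* D) {q : k[X]}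
    (hq : q.Monic) {x : D} (hx : eval₂ γ x q = 0) : ∃ a, x = γ a := by
  have h := (splits q).eq_prod_roots_of_monic hq
  rw [h, eval₂_multiset_prod, Multiset.prod_eq_zero_iff] at hx
  simp only [Multiset.map_map, Multiset.mem_map, Function.comp, eval₂_sub, eval₂_X, eval₂_C] at hx
  obtain ⟨a, -, ha⟩ := hx
  exact ⟨a, sub_eq_zero.1 ha⟩

theorem inertia_gal {k k1 L : Type} [Field k] [IsAlgClosed k] [Field k1] (j : k[X] →+* k1)
    (hj : Injective j) [Field L] [Algebra (FractionRing k1[X]) L] [FiniteDimensional (FractionRing k1[X]) L]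
    [IsGalois (FractionRing k1[X]) L] (a0 : k[X][X] →+* L)
    (ha0 : a0 = (aM (FractionRing k1[X]) L).comp
      ((aM k1[X] (FractionRing k1[X])).comp (mRH j)))
    (f : k[X][X][X]) {n : ℕ} (η : Fin n → L) (hη : f.map a0 = ∏ i, (X - C (η i)))
    (y0 : k) (g : k[X]) (A : k[X][X])
    (hf : f.map (mRH (eRH 0)) = (X - C (C y0)) ^ 2 * g.map C + C X * A)
    (hA : A.evalEval 0 y0 ≠ 0) :
    ∃ (σ : L ≃ₐ[FractionRing k1[X]] L) (μ : Fin n → k), σ ≠ 1 ∧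
      (f.map (mRH (eRH 0))).map (eRH 0) = ∏ i, (X - C (μ i)) ∧
      ∀ i i', σ (η i) = η i' → μ i = μ i' := by
  have hinj : Injective a0 := by
    rw [ha0]
    exact (aM (FractionRing k1[X]) L).injective.comp ((injective _ _).comp (map_injective _ hj))
  have hfm : f.Monic := by
    have h1 : (f.map a0).Monic := by rw [hη]; exact monic_prod_of_monic _ _ fun i _ => monic_X_sub_C _
    exact (hinj.monic_map_iff).2 h1
  have hcomm : ∀ (σ : L ≃ₐ[FractionRing k1[X]] L) (x : k[X][X]), σ (a0 x) = a0 x := by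
    intro σ x
    rw [ha0]; exact σ.commutes _
  obtain ⟨B, _, v, b0, act, hv, hvb, hmem, hact⟩ : ∃ (B : Type) (_ : CommRing B) (v : B →+* L) (b0 : k[X][X] →+* B)
      (act : (L ≃ₐ[FractionRing k1[X]] L) → B →+* B),
      Injective v ∧ v.comp b0 = a0 ∧ (∀ x, a0.IsIntegralElem x ↔ ∃ b, v b = x) ∧
      ∀ σ x, v (act σ x) = σ (v x) := by
    let _ := a0.toAlgebra
    exact ⟨integralClosure k[X][X] L, inferInstance, (integralClosure k[X][X] L).val.toRingHom, aM _ _,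
      fun σ => (AlgHom.mapIntegralClosure ({ (σ : L →+* L) with commutes' := hcomm σ } : L →ₐ[k[X][X]] L)).toRingHom,
      val_injective, rfl, fun x => ⟨fun h => ⟨⟨x, h⟩, rfl⟩, by rintro ⟨b, rfl⟩; exact b.2⟩, fun σ x => rfl⟩
  have hb0 : ∀ x, v (b0 x) = a0 x := fun x => congrArg (fun g => g x) hvb
  have hBint : b0.IsIntegral := by
    intro b
    obtain ⟨p, hp, hpb⟩ := (hmem (v b)).2 ⟨b, rfl⟩
    refine ⟨p, hp, hv ?_⟩
    rw [hom_eval₂, hvb, hpb, map_zero]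
  let _ : Algebra k[X][X] B := b0.toAlgebra
  have : Algebra.IsIntegral k[X][X] B := ⟨hBint⟩
  let Ω' := AlgebraicClosure (FractionRing k[X])
  let φ0 : k[X][X] →+* Ω' := (aM k[X] Ω').comp (mRH (eRH 0))
  obtain ⟨φ1, hφ1⟩ := exists_ext (S := B) φ0 (fun x hx => by
    have : a0 x = 0 := by rw [← hb0]; exact (congrArg v hx).trans (map_zero v)
    rw [(injective_iff_map_eq_zero _).1 hinj x this, map_zero])
  have hφ1' : ∀ x, φ1 (b0 x) = aM k[X] Ω' (x.map (eRH 0)) := fun x =>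
    congrArg (fun g => g x) hφ1
  let D : Subring Ω' := RingHom.range (R := B) (S := Ω') φ1
  let φ : B →+* D := RingHom.rangeRestrict (R := B) (S := Ω') φ1
  let β : k[X] →+* D := φ.comp (b0.comp (mRH C))
  have hβ0 : ∀ q, (β q : Ω') = aM k[X] Ω' q := by
    intro q
    change φ1 (b0 (q.map C)) = _
    rw [hφ1', map_map]
    congr 1
    have : (eRH (0 : k)).comp C = RingHom.id k := by ext; simp
    rw [this, map_id]
  have hφβ : ∀ x, φ (b0 x) = β (x.map (eRH 0)) := by
    intro x
    apply Subtype.ext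
    rw [hβ0]; exact hφ1' x
  have hβinj : Injective β := by
    intro a b hab
    have h := congrArg val hab
    rw [hβ0, hβ0] at h
    have h2 : Injective (aM k[X] Ω') := by
      rw [IsScalarTower.algebraMap_eq k[X] (FractionRing k[X]) Ω']
      exact (aM (FractionRing k[X]) Ω').injective.comp (injective _ _)
    exact h2 h
  have hφβ' : φ.comp b0 = β.comp (mRH (eRH 0)) := RingHom.ext hφβ
  let _ : Algebra k[X] D := β.toAlgebra
  have hint : Algebra.IsIntegral k[X] D := by
    refine ⟨fun x => ?_⟩
    obtain ⟨b, rfl⟩ := RingHom.rangeRestrict_surjective (R := B) (S := Ω') φ1 x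
    obtain ⟨p, hp, hpb⟩ := hBint b
    refine ⟨p.map (mRH (eRH 0)), hp.map _, ?_⟩
    rw [eval₂_map]
    change eval₂ (β.comp (mRH (eRH 0))) (φ b) p = 0
    rw [← hφβ', ← hom_eval₂]
    rw [hpb, map_zero]
  obtain ⟨ψ, hψ⟩ := exists_ext (S := D) (eRH (0 : k)) (fun x hx => by
    rw [(injective_iff_map_eq_zero _).1 hβinj x hx, map_zero])
  have hψ' : ∀ q, ψ (β q) = q.eval 0 := fun q => congrArg (fun g => g q) hψ
  have hηint : ∀ i, a0.IsIntegralElem (η i) := by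
    intro i
    refine ⟨f, hfm, ?_⟩
    rw [← eval_map, hη, eval_prod]
    exact prod_eq_zero (mem_univ i) (by simp)
  choose ηB hηBv using fun i => (hmem (η i)).1 (hηint i)
  have hηB : f.map b0 = ∏ i, ((X : Polynomial B) - C (ηB i)) := by
    apply map_injective v hv
    rw [map_map, Polynomial.map_prod, hvb]
    simp only [Polynomial.map_sub, map_X, map_C, hηBv]
    exact hη
  have hηD : (f.map (mRH (eRH 0))).map β = ∏ i, ((X : Polynomial D) - C (φ (ηB i))) := by
    rw [map_map, ← hφβ', ← map_map, hηB, Polynomial.map_prod]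
    simp only [Polynomial.map_sub, map_X, map_C]
  let μ : Fin n → k := fun i => ψ (φ (ηB i))
  have hμ : (f.map (mRH (eRH 0))).map (eRH 0) = ∏ i, (X - C (μ i)) := by
    have : eRH (0 : k) = ψ.comp β := RingHom.ext fun q => (hψ' q).symm
    conv_lhs => arg 1; rw [this]
    rw [← map_map, hηD, Polynomial.map_prod]
    simp only [Polynomial.map_sub, map_X, map_C, μ]
  obtain ⟨i0, hi0⟩ : ∃ i, μ i = y0 := by
    have h := congrArg (fun p => eval y0 (p.map (eRH (0 : k)))) hf
    simp only [hμ] at h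
    simp [eval_prod, prod_eq_zero_iff, map_map] at h
    obtain ⟨i, hi⟩ := h
    exact ⟨i, (sub_eq_zero.1 hi).symm⟩
  have hinv : ∀ x : B, (∀ σ, act σ x = x) → ψ (φ x) = 0 → ∃ b : D, φ x = β X * b := by
    intro x hx hx0
    obtain ⟨u, hu⟩ := (IsGalois.mem_range_algebraMap_iff_fixed (F := FractionRing k1[X]) (v x)).2
      (fun σ => by rw [← hact, hx])
    have hui : ((aM k1[X] (FractionRing k1[X])).comp (mRH j)).IsIntegralElem u := by
      obtain ⟨p, hp, hpx⟩ := (hmem (v x)).2 ⟨x, rfl⟩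
      refine ⟨p, hp, (aM (FractionRing k1[X]) L).injective ?_⟩
      rw [hom_eval₂, ← ha0, map_zero, hu]
      exact hpx
    obtain ⟨w0, w1, rfl, ⟨p, hp, hpw⟩, ⟨p1, hp1, hpw1⟩⟩ := inv_form j u hui
    let l : k1[X] →+* L := (aM (FractionRing k1[X]) L).comp (aM k1[X] (FractionRing k1[X]))
    have hl : a0 = l.comp (mRH j) := ha0
    have hlC : a0.comp C = (l.comp C).comp j := by
      rw [hl]; ext <;> simp
    have hW0 : eval₂ (a0.comp C) (l (C w0)) p = 0 := by
      rw [hlC, show l (C w0) = (l.comp C) w0 from rfl, ← hom_eval₂, hpw, map_zero]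
    obtain ⟨W0, hW0v⟩ := (hmem (l (C w0))).1 ⟨p.map C, hp.map _, by rw [eval₂_map]; exact hW0⟩
    obtain ⟨W1, hW1v⟩ := (hmem (l w1)).1 ⟨p1, hp1, by rw [hl, ← hom_eval₂, hpw1, map_zero]⟩
    have hxW : x = W0 + b0 X * W1 := by
      apply hv
      rw [map_add, map_mul, hb0, hW0v, hW1v, ← hu, hl]
      change l (C w0 + X * w1) = _
      simp
    have hW0' : eval₂ (b0.comp C) W0 p = 0 := by
      apply hv
      rw [hom_eval₂, ← RingHom.comp_assoc, hvb, hW0v, hW0, map_zero]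
    have hev : eval₂ (β.comp C) (φ W0) (p.map (eRH 0)) = 0 := by
      have : (β.comp C).comp (eRH (0 : k)) = φ.comp (b0.comp C) := by
        rw [← RingHom.comp_assoc, hφβ']
        refine RingHom.ext fun q => ?_
        simp
      rw [eval₂_map, this, ← hom_eval₂, hW0', map_zero]
    obtain ⟨a, ha⟩ := root_const (β.comp C) (hp.map _) hev
    have hXX : φ (b0 X) = β X := by rw [hφβ, map_X]
    refine ⟨φ W1, ?_⟩
    rw [hxW, map_add, map_mul, hXX, ha] at hx0 ⊢
    rw [map_add, map_mul, comp_apply, hψ', hψ', eval_C, eval_X, zero_mul, add_zero] at hx0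
    rw [hx0]; simp
  have hβy : φ (b0 (C (C y0))) = β (C y0) := by rw [hφβ]; simp
  obtain ⟨σ, hσ, hσ'⟩ := inertia act (fun σ τ b => hv (by simp [hact])) (fun b => hv (by simp [hact])) φ ψ (fun a => b0 (C (C a)))
    (fun σ a => hv (by rw [hact, hb0, hcomm])) (fun a => by rw [hφβ, hψ']; simp) (β X)
    (fun h => X_ne_zero ((injective_iff_map_eq_zero _).1 hβinj _ h)) (by rw [hψ', eval_X]) hinv
    (ηB i0 - b0 (C (C y0))) (eval₂ (β.comp C) (φ (ηB i0)) g) (eval₂ β (φ (ηB i0)) A)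
    (by rw [map_sub, map_sub, hφβ, hψ']; simpa [sub_eq_zero] using hi0)
    (by
      have h := congrArg (fun p => eval₂ β (φ (ηB i0)) p) hf
      simp only [← eval_map, hηD, eval_prod] at h
      rw [prod_eq_zero (mem_univ i0) (by simp)] at h
      rw [map_sub, hβy]
      rw [h]
      simp [map_map, eval_map])
    (by
      rw [hom_eval₂]
      have : eRH (0 : k) = ψ.comp β := RingHom.ext fun q => (hψ' q).symm
      rw [← this]
      change eval₂ _ (μ i0) A ≠ 0
      rw [hi0]
      convert hA using 1
      rw [← eval_map, map_evalRingHom_eval])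
  refine ⟨σ, μ, hσ, hμ, fun i i' hii => ?_⟩
  have := hσ' (ηB i)
  rw [show act σ (ηB i) = ηB i' from hv (by rw [hact, hηBv, hηBv, hii])] at this
  exact this.symm

end Inertia

section GalA
open Polynomial

lemma spec_lift {D k Ω : Type} [CommRing D] [Field k] [IsAlgClosed k] [Field Ω] (a : D →+* Ω)
    (ha : Injective a) (φ : D →+* k) {f : D[X]} (hf : f.Monic) {n : ℕ} {η : Fin n → Ω}
    (hη : f.map a = ∏ i, (X - C (η i))) :
    ∃ (B : Type) (_ : CommRing B) (v : B →+* Ω) (b0 : D →+* B) (ψ : B →+* k) (β : Fin n → B),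
      Injective v ∧ v.comp b0 = a ∧ ψ.comp b0 = φ ∧ (∀ i, v (β i) = η i) ∧
      f.map b0 = ∏ i, (X - C (β i)) := by
  let _ : Algebra D Ω := a.toAlgebra
  obtain ⟨ψ, hψ⟩ := exists_ext (W := D) (S := integralClosure D Ω) φ (by
    intro x hx
    have : a x = 0 := congrArg (aM (integralClosure D Ω) Ω) hx
    rw [(map_eq_zero_iff a ha).1 this, map_zero])
  have hint : ∀ i, IsIntegral D (η i) := fun i => by
    refine ⟨f, hf, ?_⟩
    change eval₂ a (η i) f = 0
    rw [← eval_map, hη, eval_prod]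
    exact prod_eq_zero (mem_univ i) (by simp)
  refine ⟨integralClosure D Ω, inferInstance, aM (integralClosure D Ω) Ω,
    aM D (integralClosure D Ω), ψ, fun i => ⟨η i, hint i⟩, val_injective, rfl, hψ, fun i => rfl, ?_⟩
  apply map_injective (aM (integralClosure D Ω) Ω) val_injective
  rw [map_map, Polynomial.map_prod]
  refine Eq.trans hη (prod_congr rfl fun i _ => ?_)
  rw [Polynomial.map_sub, map_X, map_C]; rfl

lemma full_perm {Ω : Type} [Field Ω] (Γ : Subgroup (Ω ≃+* Ω)) {n : ℕ} {η : Fin n → Ω}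
    (h2 : ∀ a b c d, a ≠ b → c ≠ d → ∃ g : Ω ≃+* Ω, g (η a) = η c ∧ g (η b) = η d ∧
      (∀ i, ∃ j, g (η i) = η j) ∧ ∀ γ ∈ Γ, g * γ * g⁻¹ ∈ Γ)
    (hη : Injective η)
    {γ₀ : Ω ≃+* Ω} (hγ₀ : γ₀ ∈ Γ) {a b : Fin n} (hab : a ≠ b) (ha : γ₀ (η a) = η b) (hb : γ₀ (η b) = η a)
    (ho : ∀ i, i ≠ a → i ≠ b → γ₀ (η i) = η i) (σ : Perm (Fin n)) :
    ∃ γ ∈ Γ, ∀ i, γ (η i) = η (σ i) := by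
  let T : Subgroup (Perm (Fin n)) :=
    { carrier := {σ | ∃ γ ∈ Γ, ∀ i, γ (η i) = η (σ i)}
      mul_mem' := by
        rintro σ τ ⟨γ, hγ, h⟩ ⟨δ, hδ, h'⟩
        exact ⟨γ * δ, Γ.mul_mem hγ hδ, fun i => by rw [RingAut.mul_apply, h', h]; rfl⟩
      one_mem' := ⟨1, Γ.one_mem, fun i => rfl⟩
      inv_mem' := by
        rintro σ ⟨γ, hγ, h⟩
        refine ⟨γ⁻¹, Γ.inv_mem hγ, fun i => ?_⟩
        apply γ.injective
        rw [h]
        change (γ * γ⁻¹) (η i) = _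
        rw [mul_inv_cancel]; simp }
  suffices hT : T = ⊤ by
    have : σ ∈ T := hT ▸ Subgroup.mem_top σ
    exact this
  rw [eq_top_iff, ← Perm.closure_isSwap, Subgroup.closure_le]
  rintro τ ⟨c, d, hcd, rfl⟩
  obtain ⟨g, hga, hgb, hg, hgΓ⟩ := h2 a b c d hab hcd
  choose m hm using hg
  have hmi : Injective m := fun i j h => hη (g.injective (by rw [hm, hm, h]))
  have hms : Function.Surjective m := Finite.injective_iff_surjective.1 hmi
  have hma : m a = c := hη (by rw [← hm, hga])
  have hmb : m b = d := hη (by rw [← hm, hgb])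
  refine ⟨_, hgΓ γ₀ hγ₀, fun i => ?_⟩
  obtain ⟨i, rfl⟩ := hms i
  have : g⁻¹ (η (m i)) = η i := by
    apply g.injective
    change (g * g⁻¹) _ = _
    rw [mul_inv_cancel, hm]; rfl
  rw [RingAut.mul_apply, this, RingAut.mul_apply]
  by_cases hia : i = a
  · subst hia; rw [ha, hgb, hma, Equiv.swap_apply_left]
  by_cases hib : i = b
  · subst hib; rw [hb, hga, hmb, Equiv.swap_apply_right]
  rw [ho i hia hib, hm, Equiv.swap_apply_of_ne_of_ne]
  · rw [← hma]; exact hmi.ne hia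
  · rw [← hmb]; exact hmi.ne hib

lemma exists_thet {k Ω : Type} [Field k] [Infinite k] [Field Ω] [Algebra k Ω] {n : ℕ} {η : Fin n → Ω}
    (hη : Injective η) : ∃ c : Fin n → k, Injective (thet c η) := by
  by_contra! hcon
  let l : Perm (Fin n) → (Fin n → k) →ₗ[k] Ω := fun π =>
    { toFun := fun c => thet c η π
      map_add' := fun c c' => by simp [thet, add_smul, sum_add_distrib]
      map_smul' := fun r c => by simp [thet, mul_smul, Finset.smul_sum] }
  obtain ⟨⟨⟨π, π'⟩, hne⟩, h⟩ := Subspace.exists_eq_top_of_iUnion_eq_univ (k := k) (E := Fin n → k)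
    (ι := {q : Perm (Fin n) × Perm (Fin n) // q.1 ≠ q.2})
    (p := fun q => LinearMap.ker (l q.1.1 - l q.1.2)) (by
      rw [Set.eq_univ_iff_forall]
      intro c
      have := hcon c
      rw [Injective] at this
      push Not at this
      obtain ⟨π, π', h, hne⟩ := this
      refine Set.mem_iUnion.2 ⟨⟨(π, π'), hne⟩, ?_⟩
      change (l π - l π') c = 0
      exact sub_eq_zero.2 h)
  apply hne
  refine Equiv.ext fun i => hη ?_
  have : (single i 1 : Fin n → k) ∈ LinearMap.ker (l π - l π') := by rw [h]; trivial
  have h3 : l π (single i 1) = l π' (single i 1) := sub_eq_zero.1 this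
  simpa [l, thet, single_apply] using h3

lemma res_prod {A ι : Type} [CommRing A] [Nontrivial A] [Fintype ι] (θ : ι → A) (g : A[X]) (m : ℕ) (hg : g.natDegree ≤ m) :
    resultant (∏ i, (X - C (θ i))) g (card ι) m = ∏ i, g.eval (θ i) := by
  classical
  have key : ∀ s : Finset ι, resultant (∏ i ∈ s, (X - C (θ i))) g s.card m = ∏ i ∈ s, g.eval (θ i) := by
    intro s
    induction s using Finset.induction_on with
    | empty => simp
    | insert a s ha ih =>
      have h1 : (X - C (θ a)).natDegree = 1 := natDegree_X_sub_C _
      have h2 : (∏ i ∈ s, (X - C (θ i))).natDegree = s.card := by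
        simp [natDegree_prod_of_monic, monic_X_sub_C]
      have := resultant_mul_left (X - C (θ a)) (∏ i ∈ s, (X - C (θ i))) g m hg
      rw [h1, h2] at this
      rw [Finset.prod_insert ha, Finset.prod_insert ha, Finset.card_insert_of_notMem ha, add_comm,
        this, ih, resultant_X_sub_C_left _ _ _ hg]
  exact key univ

lemma res_der_ne {A ι : Type} [Field A] [Fintype ι] (θ : ι → A) (hθ : Injective θ) (N : ℕ)
    {p : A[X]} (hp : p = ∏ i, (X - C (θ i))) (hN : N = card ι) : resultant p (derivative p) N N ≠ 0 := by
  subst hp hN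
  have hd : (∏ i, (X - C (θ i))).natDegree = card ι := by simp [natDegree_prod_of_monic, monic_X_sub_C]
  rw [res_prod]
  · rw [prod_ne_zero_iff]
    intro i _
    have hs : (∏ i, (X - C (θ i))).Separable := separable_prod_X_sub_C_iff.2 hθ
    have h0 : eval (θ i) (∏ i, (X - C (θ i))) = 0 := by
      rw [eval_prod]; exact prod_eq_zero (mem_univ i) (by simp)
    have := hs.eval₂_derivative_ne_zero (RingHom.id A) (by rw [eval₂_id, h0])
    rwa [eval₂_id] at this
  · exact (natDegree_derivative_le _).trans (by omega)

lemma irr_of_trans {k1 Ω ι : Type} [Field k1] [Field Ω] [Algebra (FractionRing k1[X]) Ω] [Fintype ι] [Nonempty ι]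
    (θ : ι → Ω) (hθ : Injective θ) {p : k1[X][X]} (hp : p.Monic)
    (hpr : p.map ((aM (FractionRing k1[X]) Ω).comp (aM k1[X] (FractionRing k1[X]))) = ∏ i, (X - C (θ i)))
    (htr : ∀ i i', ∃ γ : Ω ≃+* Ω, (∀ a, γ (aM (FractionRing k1[X]) Ω a) = aM (FractionRing k1[X]) Ω a) ∧
      γ (θ i) = θ i') : Irreducible p ∧ resultant p (derivative p) p.natDegree p.natDegree ≠ 0 := by
  constructor
  · rw [hp.irreducible_iff_irreducible_map_fraction_map (K := FractionRing k1[X])]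
    set q := p.map (aM k1[X] (FractionRing k1[X])) with hq
    have hqm : q.Monic := hp.map _
    have hqq : q.map (aM (FractionRing k1[X]) Ω) = ∏ i, (X - C (θ i)) := by rw [hq, map_map, hpr]
    obtain ⟨i0⟩ := (inferInstance : Nonempty ι)
    have hroot : ∀ i, aeval (θ i) q = 0 := fun i => by
      rw [aeval_def, ← eval_map, hqq, eval_prod]
      exact prod_eq_zero (mem_univ i) (by simp)
    have hint : IsIntegral (FractionRing k1[X]) (θ i0) := ⟨q, hqm, hroot i0⟩
    have hall : ∀ i, aeval (θ i) (minpoly (FractionRing k1[X]) (θ i0)) = 0 := fun i => by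
      obtain ⟨γ, hγ, hi⟩ := htr i0 i
      have := congrArg γ (minpoly.aeval (FractionRing k1[X]) (θ i0))
      rw [aeval_def, ← RingEquiv.coe_toRingHom, hom_eval₂, map_zero] at this
      rw [aeval_def, ← hi]
      convert this using 2
      · exact RingHom.ext fun a => (hγ a).symm
      · rfl
    have hdvd : q ∣ minpoly (FractionRing k1[X]) (θ i0) := by
      rw [← map_dvd_map' (aM (FractionRing k1[X]) Ω), hqq]
      refine Finset.prod_dvd_of_coprime ?_ ?_
      · intro i _ i' _ h
        exact pairwise_coprime_X_sub_C hθ h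
      · intro i _
        rw [dvd_iff_isRoot, IsRoot, eval_map]
        exact hall i
    have : q = minpoly (FractionRing k1[X]) (θ i0) :=
      eq_of_monic_of_associated hqm (minpoly.monic hint) (associated_of_dvd_dvd hdvd (minpoly.dvd _ _ (hroot i0)))
    rw [this]
    exact minpoly.irreducible hint
  · have hd : p.natDegree = card ι := by
      rw [← hp.natDegree_map ((aM (FractionRing k1[X]) Ω).comp (aM k1[X] (FractionRing k1[X]))), hpr]
      simp [natDegree_prod_of_monic, monic_X_sub_C]
    intro h
    apply res_der_ne θ hθ p.natDegree hpr hd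
    rw [derivative_map, resultant_map_map]
    rw [h, map_zero]

end GalA
section GalB
open Polynomial

lemma alg_tower {k k1 Ω : Type} [Field k] [Field k1] [Algebra k[X] k1] [FaithfulSMul k[X] k1] [Algebra.IsAlgebraic k[X] k1] [Field Ω]
    [Algebra (FractionRing k1[X]) Ω] [Algebra.IsAlgebraic (FractionRing k1[X]) Ω] (x : Ω) :
    ∃ p : k[X][X][X], p ≠ 0 ∧ eval₂ (((aM (FractionRing k1[X]) Ω).comp (aM k1[X] (FractionRing k1[X]))).comp
      (mRH (aM k[X] k1))) x p = 0 := by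
  let _ : Algebra k[X][X] k1[X] := Polynomial.algebra _ _
  let _ : Algebra k1[X] Ω := ((aM (FractionRing k1[X]) Ω).comp (aM k1[X] (FractionRing k1[X]))).toAlgebra
  let _ : Algebra k[X][X] Ω := ((aM k1[X] Ω).comp (aM k[X][X] k1[X])).toAlgebra
  have t1 : IsScalarTower k1[X] (FractionRing k1[X]) Ω := IsScalarTower.of_algebraMap_eq fun _ => rfl
  have t2 : IsScalarTower k[X][X] k1[X] Ω := IsScalarTower.of_algebraMap_eq fun _ => rfl
  have i1 : Algebra.IsAlgebraic k1[X] (FractionRing k1[X]) := IsLocalization.isAlgebraic (R := k1[X]) _ (nonZeroDivisors k1[X])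
  have i2 : Algebra.IsAlgebraic k1[X] Ω := Algebra.IsAlgebraic.trans k1[X] (FractionRing k1[X]) Ω
  have i4 : Algebra.IsAlgebraic k[X][X] k1[X] := inferInstance
  have i3 : Algebra.IsAlgebraic k[X][X] Ω := Algebra.IsAlgebraic.trans k[X][X] k1[X] Ω
  obtain ⟨p, hp, h⟩ := i3.isAlgebraic x
  exact ⟨p, hp, h⟩

lemma fin_roots {L : Type} [Field L] {p : L[X]} (hm : p.Monic) (hs : p.Splits) {n : ℕ} (hn : p.natDegree = n) :
    ∃ η : Fin n → L, p = ∏ i, (X - C (η i)) := by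
  have hc : p.roots.toList.length = n := by
    rw [Multiset.length_toList, ← hn]; exact hs.natDegree_eq_card_roots.symm
  subst hc
  refine ⟨fun i => p.roots.toList.get i, ?_⟩
  conv_lhs => rw [hs.eq_prod_roots_of_monic hm, ← Multiset.coe_toList p.roots]
  rw [Multiset.map_coe, Multiset.prod_coe, ← List.prod_ofFn]
  congr 1
  conv_lhs => rw [← List.ofFn_get p.roots.toList]
  rw [List.map_ofFn]; rfl

lemma swap_lem {k : Type} [Field k] {n : ℕ} (μ : Fin n → k) (y0 : k) (g : k[X])
    (h : ∏ i, (X - C (μ i)) = (X - C y0) ^ 2 * g) (hg : g.Separable) (hy : g.eval y0 ≠ 0)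
    (τ : Perm (Fin n)) (hτ : τ ≠ 1) (hμ : ∀ i, μ (τ i) = μ i) :
    ∃ a b, a ≠ b ∧ τ a = b ∧ τ b = a ∧ ∀ i, i ≠ a → i ≠ b → τ i = i := by
  have c1 : ∀ i i', i ≠ i' → μ i = μ i' → μ i = y0 := by
    intro i i' hii hm
    by_contra hne
    have hd : (X - C (μ i)) ^ 2 ∣ (X - C y0) ^ 2 * g := by
      rw [← h, ← mul_prod_erase _ _ (mem_univ i),
        ← mul_prod_erase _ _ (mem_erase.2 ⟨hii.symm, mem_univ i'⟩), hm, ← mul_assoc, ← sq]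
      exact dvd_mul_right _ _
    have hcop : IsCoprime ((X - C (μ i)) ^ 2) ((X - C y0) ^ 2) :=
      (isCoprime_X_sub_C_of_isUnit_sub (sub_ne_zero.2 hne).isUnit).pow
    have := hcop.dvd_of_dvd_mul_left hd
    rw [sq] at this
    exact not_isUnit_X_sub_C _ (hg.squarefree _ this)
  have c2 : ∀ i i' i'', i ≠ i' → i ≠ i'' → i' ≠ i'' → μ i = y0 → μ i' = y0 → μ i'' = y0 → False := by
    intro i i' i'' h1 h2 h3 m1 m2 m3
    have hd : (X - C y0) ^ 2 * (X - C y0) ∣ (X - C y0) ^ 2 * g := by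
      rw [← h, ← mul_prod_erase _ _ (mem_univ i),
        ← mul_prod_erase _ _ (mem_erase.2 ⟨h1.symm, mem_univ i'⟩),
        ← mul_prod_erase _ _ (mem_erase.2 ⟨h3.symm, mem_erase.2 ⟨h2.symm, mem_univ i''⟩⟩), m1, m2, m3]
      rw [← mul_assoc, ← mul_assoc, sq]
      exact dvd_mul_right _ _
    rw [mul_dvd_mul_iff_left (pow_ne_zero _ (X_sub_C_ne_zero y0)), dvd_iff_isRoot] at hd
    exact hy hd
  obtain ⟨a, ha⟩ : ∃ a, τ a ≠ a := by
    by_contra! hcon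
    exact hτ (Equiv.ext hcon)
  have c3 : ∀ i, τ i ≠ i → μ i = y0 := fun i hi => c1 i (τ i) hi.symm (hμ i).symm
  have hb : τ (τ a) ≠ τ a := fun h => ha (τ.injective h)
  have ma := c3 a ha
  have mb := c3 (τ a) hb
  refine ⟨a, τ a, ha.symm, rfl, ?_, fun i hia hib => ?_⟩
  · by_contra hne
    exact c2 a (τ a) (τ (τ a)) ha.symm (Ne.symm hne) hb.symm ma mb (by rw [hμ, mb])
  · by_contra hne
    exact c2 a (τ a) i ha.symm hia.symm hib.symm ma mb (c3 i hne)

theorem gal {k k1 : Type} [Field k] [IsAlgClosed k] [Field k1] [IsAlgClosed k1] [Algebra k[X] k1]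
    [FaithfulSMul k[X] k1] [Algebra.IsAlgebraic k[X] k1]
    {P E : k[X][X]} (hP : P.Monic) (hirr : Irreducible P) {f : k[X][X][X]} (hf : f.Monic) {n : ℕ}
    (hn : f.natDegree = n) (c : k[X]) (hc : c ≠ 0)
    (hroots : ∀ (Ω : Type) [Field Ω] [IsAlgClosed Ω] (i : k →+* Ω) (s t : Ω), eval₂ i s c ≠ 0 →
      ∀ y, eval₂ (bev i s t) (eval₂ i s c * y) f = 0 → ∃ x, OnPt i P E s t y x)
    (y0 : k) (g : k[X]) (A : k[X][X])
    (hf0 : f.map (mRH (eRH 0)) = (X - C (C y0)) ^ 2 * g.map C + C X * A)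
    (hA : A.evalEval 0 y0 ≠ 0) (hg : g.Separable) (hgy : g.eval y0 ≠ 0)
    (s0 t0 y1 : k) (hs1 : eval₂ (bev (RingHom.id k) s0 t0) y1 f = 0)
    (hs2 : eval₂ (bev (RingHom.id k) s0 t0) y1 (derivative f) ≠ 0) :
    Irreducible (f.map (mRH (aM k[X] k1))) ∧
    ∃ c' : Fin n → k, Irreducible ((resol c' f).map (mRH (aM k[X] k1))) ∧
      resultant (resol c' f) (derivative (resol c' f)) (resol c' f).natDegree (resol c' f).natDegree ≠ 0 := by
  classical
  have hj : Injective (aM k[X] k1) := FaithfulSMul.algebraMap_injective _ _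
  set j := aM k[X] k1 with hjdef
  let q : (FractionRing k1[X])[X] := f.map ((aM k1[X] (FractionRing k1[X])).comp (mRH j))
  have hqm : q.Monic := hf.map _
  have hqn : q.natDegree = n := by rw [← hn]; exact hf.natDegree_map _
  obtain ⟨L, _, _, _, hsp⟩ : ∃ (L : Type) (_ : Field L) (_ : Algebra (FractionRing k1[X]) L)
      (_ : FiniteDimensional (FractionRing k1[X]) L), q.IsSplittingField (FractionRing k1[X]) L :=
    ⟨q.SplittingField, inferInstance, inferInstance, inferInstance, inferInstance⟩
  obtain ⟨Ω, _, _, _, _, _, _⟩ : ∃ (Ω : Type) (_ : Field Ω) (_ : IsAlgClosed Ω) (_ : Algebra (FractionRing k1[X]) Ω)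
      (_ : Algebra L Ω) (_ : IsScalarTower (FractionRing k1[X]) L Ω), Algebra.IsAlgebraic (FractionRing k1[X]) Ω :=
    ⟨AlgebraicClosure L, inferInstance, inferInstance, inferInstance, inferInstance, inferInstance,
      Algebra.IsAlgebraic.trans (FractionRing k1[X]) L (AlgebraicClosure L)⟩
  let a1 : k1[X] →+* Ω := (aM (FractionRing k1[X]) Ω).comp (aM k1[X] (FractionRing k1[X]))
  have ha1 : Injective a1 := (aM (FractionRing k1[X]) Ω).injective.comp (injective _ _)
  let a0 : k[X][X] →+* Ω := a1.comp (mRH j)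
  have ha0 : Injective a0 := ha1.comp (map_injective _ hj)
  let _ : Algebra k Ω := (a0.comp (C.comp C)).toAlgebra
  have hbev : bev (aM k Ω) (a0 (C X)) (a0 X) = a0 := by
    refine ringHom_ext' (ringHom_ext' ?_ ?_) ?_
    · refine RingHom.ext fun x => ?_
      simp [bev]; rfl
    · simp [bev]
    · simp [bev]
  set s := a0 (C X)
  set t := a0 X
  have hinj : Injective (bev (aM k Ω) s t) := by rw [hbev]; exact ha0
  have hal : ∀ x : Ω, ∃ p : k[X][X][X], p ≠ 0 ∧ eval₂ (bev (aM k Ω) s t) x p = 0 := by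
    rw [hbev]; exact fun x => alg_tower x
  obtain ⟨η', hη'⟩ := fin_roots (hqm.map (aM (FractionRing k1[X]) L)) hsp.splits'
    (by rw [hqm.natDegree_map, hqn])
  let η : Fin n → Ω := fun i => aM L Ω (η' i)
  have hη : f.map a0 = ∏ i, (X - C (η i)) := by
    have := congrArg (Polynomial.map (aM L Ω)) hη'
    rw [map_map, ← IsScalarTower.algebraMap_eq, map_map, Polynomial.map_prod] at this
    simp only [Polynomial.map_sub, map_X, map_C] at this
    exact this
  have hηr : ∀ i, eval₂ a0 (η i) f = 0 := fun i => by
    rw [← eval_map, hη, eval_prod]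
    exact prod_eq_zero (mem_univ i) (by simp)
  have hrη : ∀ x, eval₂ a0 x f = 0 → ∃ i, x = η i := fun x hx => by
    rw [← eval_map, hη, eval_prod, prod_eq_zero_iff] at hx
    obtain ⟨i, -, hi⟩ := hx
    exact ⟨i, by simpa [sub_eq_zero] using hi⟩
  have hcs : eval₂ (aM k Ω) s c = a0 (C c) := by
    have := congrArg (fun r : k[X][X] →+* Ω => r (C c)) hbev
    simpa [bev] using this
  have hcs0 : a0 (C c) ≠ 0 := by rw [Ne, map_eq_zero_iff a0 ha0]; simpa using hc
  have hpt : ∀ i, ∃ x, OnPt (aM k Ω) P E s t (η i / a0 (C c)) x := fun i => by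
    apply hroots Ω (aM k Ω) s t (by rw [hcs]; exact hcs0)
    rw [hcs, mul_div_cancel₀ _ hcs0, hbev]
    exact hηr i
  have htw : ∀ a b a' b', η a ≠ η b → η a' ≠ η b' → ∃ g : Ω ≃+* Ω, (∀ x, g (a0 x) = a0 x) ∧ g (η a) = η a' ∧ g (η b) = η b' := by
    intro a b a' b' hab hab'
    obtain ⟨x1, h1⟩ := hpt a
    obtain ⟨x2, h2⟩ := hpt b
    obtain ⟨x3, h3⟩ := hpt a'
    obtain ⟨x4, h4⟩ := hpt b'
    obtain ⟨g, g1, g2, g3, g4, g5⟩ := two_trans hP hirr hinj hal h1 h2 h3 h4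
      (fun h => hab ((div_left_inj' hcs0).1 h)) (fun h => hab' ((div_left_inj' hcs0).1 h))
    have gf : ∀ x, g (a0 x) = a0 x := by
      intro x
      rw [← hbev, ← RingEquiv.coe_toRingHom, comp_bev]
      have e1 : (g : Ω →+* Ω).comp (aM k Ω) = aM k Ω := RingHom.ext g1
      rw [e1, RingEquiv.coe_toRingHom, g2, g3]
    refine ⟨g, gf, ?_, ?_⟩
    · rw [map_div₀, gf] at g4; exact (div_left_inj' hcs0).1 g4
    · rw [map_div₀, gf] at g5; exact (div_left_inj' hcs0).1 g5
  have gev : ∀ (g : Ω ≃+* Ω), (∀ x, g (a0 x) = a0 x) → ∀ (p : k[X][X][X]) (x : Ω), eval₂ a0 x p = 0 → eval₂ a0 (g x) p = 0 := by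
    intro g hg p x hx
    have := congrArg (g : Ω →+* Ω) hx
    rw [hom_eval₂, map_zero] at this
    have e1 : (g : Ω →+* Ω).comp a0 = a0 := RingHom.ext hg
    rwa [e1] at this
  have hηi : Injective η := by
    intro i i' hii
    by_contra hne
    have hd1 : eval₂ a0 (η i) (derivative f) = 0 := by
      rw [← eval_map, ← derivative_map, hη, ← mul_prod_erase _ _ (mem_univ i),
        ← mul_prod_erase _ _ (mem_erase.2 ⟨Ne.symm hne, mem_univ i'⟩), hii]
      simp [derivative_mul]
    have hd : ∀ m, eval₂ a0 (η m) (derivative f) = 0 := by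
      intro m
      by_cases hm : η m = η i
      · rw [hm, hd1]
      obtain ⟨g, gf, g1, -⟩ := htw i m m i (Ne.symm hm) hm
      rw [← g1]
      exact gev g gf _ _ hd1
    obtain ⟨B, _, v, b0, ψ, β, hv, hvb, hψ, hβ, hfb⟩ := spec_lift a0 ha0 (bev (RingHom.id k) s0 t0) hf hη
    have hr := hs1
    rw [← hψ, ← eval_map, ← map_map, hfb, Polynomial.map_prod, eval_prod, prod_eq_zero_iff] at hr
    obtain ⟨m, -, hm⟩ := hr
    have hm' : y1 = ψ (β m) := by simpa [sub_eq_zero] using hm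
    apply hs2
    have h3 : eval₂ b0 (β m) (derivative f) = 0 := by
      apply hv
      rw [hom_eval₂, hvb, hβ, hd, map_zero]
    rw [hm', ← hψ, ← hom_eval₂, h3, map_zero]
  have hqs : q.Separable := by
    rw [← separable_map (aM (FractionRing k1[X]) L), hη', separable_prod_X_sub_C_iff]
    intro a b hab
    exact hηi (congrArg (aM L Ω) hab)
  have hgal : IsGalois (FractionRing k1[X]) L := IsGalois.of_separable_splitting_field hqs
  let Γ : Subgroup (Ω ≃+* Ω) :=
    { carrier := {γ | ∀ x, γ (aM (FractionRing k1[X]) Ω x) = aM (FractionRing k1[X]) Ω x}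
      mul_mem' := fun {a b} ha hb x => by rw [RingAut.mul_apply, hb x, ha x]
      one_mem' := fun x => rfl
      inv_mem' := fun {a} ha x => by
        apply a.injective
        rw [ha x]
        change (a * a⁻¹) _ = _
        rw [mul_inv_cancel]; rfl }
  obtain ⟨σ, μ, hσ, hμ, hσμ⟩ := inertia_gal (L := L) j hj
    ((aM (FractionRing k1[X]) L).comp ((aM k1[X] (FractionRing k1[X])).comp (mRH j))) rfl f η'
    (by rw [← hη', map_map]) y0 g A hf0 hA
  have hnorm : Normal (FractionRing k1[X]) Ω := normal_iff.2 fun x =>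
    ⟨(Algebra.IsAlgebraic.isAlgebraic x).isIntegral, splits _⟩
  let γ₀ : Ω ≃+* Ω := (AlgEquiv.liftNormal σ Ω : Ω ≃ₐ[FractionRing k1[X]] Ω).toRingEquiv
  have hγ₀ : γ₀ ∈ Γ := fun x => (AlgEquiv.liftNormal σ Ω).commutes x
  have hγσ : ∀ x, γ₀ (aM L Ω x) = aM L Ω (σ x) := fun x => AlgEquiv.liftNormal_commutes σ Ω x
  have hΓ0 : ∀ γ ∈ Γ, ∀ x, γ (a0 x) = a0 x := fun γ hγ x => hγ _
  have hmv : ∀ g : Ω ≃+* Ω, (∀ x, g (a0 x) = a0 x) → ∀ i, ∃ i', g (η i) = η i' := fun g hg i => hrη _ (gev g hg f _ (hηr i))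
  choose τ hτ using hmv γ₀ (hΓ0 _ hγ₀)
  have hτi : Injective τ := fun a b h => hηi (γ₀.injective (by rw [hτ, hτ, h]))
  let τp : Perm (Fin n) := Equiv.ofBijective τ (Finite.injective_iff_bijective.1 hτi)
  have hτσ : ∀ i, σ (η' i) = η' (τ i) := fun i => (aM L Ω).injective (by rw [← hγσ]; exact hτ i)
  have hτ1 : τp ≠ 1 := by
    intro h
    apply hσ
    have h1 : ∀ i, τ i = i := fun i => congrArg (fun r : Perm (Fin n) => r i) h
    have : (σ : L →ₐ[FractionRing k1[X]] L) = AlgHom.id _ _ := by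
      refine AlgHom.ext_of_adjoin_eq_top hsp.adjoin_rootSet' ?_
      intro x hx
      have hx2 := (mem_rootSet.1 hx).2
      rw [aeval_def, ← eval_map, hη', eval_prod, prod_eq_zero_iff] at hx2
      obtain ⟨i, -, hi⟩ := hx2
      have : x = η' i := by simpa [sub_eq_zero] using hi
      subst this
      change σ (η' i) = η' i
      rw [hτσ, h1]
    exact AlgEquiv.ext fun x => congrArg (fun r : L →ₐ[FractionRing k1[X]] L => r x) this
  obtain ⟨a, b, hab, h1, h2, h3⟩ := swap_lem μ y0 g (by
    rw [← hμ, hf0]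
    simp only [Polynomial.map_add, Polynomial.map_mul, Polynomial.map_pow, Polynomial.map_sub, map_X, map_C, map_map]
    have : (eRH (0 : k)).comp C = RingHom.id k := RingHom.ext fun x => by simp
    rw [this, map_id]; simp) hg hgy τp hτ1 (fun i => (hσμ i (τ i) (hτσ i)).symm)
  have hfull := full_perm Γ (η := η) (by
    intro a b a' b' hab hab'
    obtain ⟨g, gf, g1, g2⟩ := htw a b a' b' (hηi.ne hab) (hηi.ne hab')
    refine ⟨g, g1, g2, hmv g gf, fun γ hγ => ?_⟩
    have gf' : ∀ x, g⁻¹ (a0 x) = a0 x := fun x => by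
      apply g.injective
      rw [gf]
      change (g * g⁻¹) _ = _
      rw [mul_inv_cancel]; rfl
    have gin : ∀ x, g (g⁻¹ x) = x := fun x => by
      change (g * g⁻¹) _ = _
      rw [mul_inv_cancel]; rfl
    have key : ((g * γ * g⁻¹ : Ω ≃+* Ω) : Ω →+* Ω).comp (aM (FractionRing k1[X]) Ω) = aM (FractionRing k1[X]) Ω := by
      refine IsLocalization.ringHom_ext (nonZeroDivisors k1[X]) ?_
      refine ringHom_ext' (RingHom.ext fun x => ?_) ?_
      · change g (γ (g⁻¹ (a1 (C x)))) = a1 (C x)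
        obtain ⟨p, hp0, hp⟩ := Algebra.IsAlgebraic.isAlgebraic (R := k[X]) x
        let _ : Algebra k1 Ω := (a1.comp C).toAlgebra
        obtain ⟨y, hy⟩ := alg_mem (k := k1) (x := g⁻¹ (a1 (C x))) ⟨p.map j, by
            rwa [Polynomial.map_ne_zero_iff hj], by
            rw [aeval_def, eval₂_map]
            have hh : (aM k1 Ω).comp j = ((g⁻¹ : Ω ≃+* Ω) : Ω →+* Ω).comp ((a1.comp C).comp j) := by
              refine RingHom.ext fun z => ?_
              change a1 (C (j z)) = g⁻¹ (a1 (C (j z)))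
              have := gf' (C z)
              simp only [a0, comp_apply, coe_mapRingHom, map_C] at this
              exact this.symm
            rw [hh]
            change eval₂ _ (((g⁻¹ : Ω ≃+* Ω) : Ω →+* Ω) ((a1.comp C) x)) p = 0
            rw [← hom_eval₂, ← hom_eval₂]
            rw [aeval_def] at hp
            rw [hp, map_zero, map_zero]⟩
        have hy' : a1 (C y) = g⁻¹ (a1 (C x)) := hy
        have e := hγ (aM k1[X] _ (C y))
        change γ (a1 (C y)) = a1 (C y) at e
        rw [← hy', e, hy', gin]
      · change g (γ (g⁻¹ (a1 X))) = a1 X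
        have e : a0 X = a1 X := by simp [a0]
        rw [← e, gf', hΓ0 γ hγ, gf]
    exact fun x => congrArg (fun r : FractionRing k1[X] →+* Ω => r x) key) hηi hγ₀ hab (by rw [hτ]; exact congrArg η h1)
    (by rw [hτ]; exact congrArg η h2) (fun i hi hi' => by rw [hτ]; exact congrArg η (h3 i hi hi'))
  obtain ⟨c', hc'⟩ := exists_thet (k := k) hηi
  have hne : Nonempty (Fin n) := ⟨a⟩
  let a0' : k[X][X] →ₐ[k] Ω := { a0 with commutes' := fun r => rfl }
  have hRη : (resol c' f).map a0 = ∏ π, (X - C (thet c' η π)) := by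
    have := resol_map c' a0' f
    have e : (a0' : k[X][X] →+* Ω) = a0 := rfl
    rw [e, hη, resol_prod] at this
    exact this.symm
  have r1 := irr_of_trans (k1 := k1) (Ω := Ω) η hηi (p := f.map (mRH j)) (hf.map _) (by rw [map_map, ← hη]) (by
    intro i i'
    obtain ⟨γ, hγ, h⟩ := hfull (Equiv.swap i i')
    exact ⟨γ, hγ, by rw [h, Equiv.swap_apply_left]⟩)
  have r2 := irr_of_trans (k1 := k1) (Ω := Ω) (thet c' η) hc' (p := (resol c' f).map (mRH j)) ((monic_resol c' f).map _)
    (by rw [map_map, ← hRη]) (by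
    intro π π'
    obtain ⟨γ, hγ, h⟩ := hfull (π' * π⁻¹)
    refine ⟨γ, hγ, ?_⟩
    have hγk : ∀ r : k, γ (aM k Ω r) = aM k Ω r := fun r => hΓ0 γ hγ _
    simp only [thet, map_sum, smul_def, map_mul, hγk, h]
    simp)
  refine ⟨r1.1, c', r2.1, fun h0 => r2.2 ?_⟩
  rw [(monic_resol c' f).natDegree_map, derivative_map, resultant_map_map, h0, map_zero]

end GalB
section Cheb
open Polynomial

lemma frob_data {k : Type} [Field k] [IsAlgClosed k] {p : ℕ} [Fact p.Prime] [CharP k p] {n a : ℕ} (c' : Fin n → k) {f : k[X][X]}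
    (hf : f.Monic) (hn : f.natDegree = n) (hfr : ∀ x y : k, (f.evalEval x y) ^ (p ^ a) = f.evalEval (x ^ (p ^ a)) (y ^ (p ^ a)))
    {t : k} (ht : t ^ (p ^ a) = t)
    (hD : (resultant (resol c' f) (derivative (resol c' f)) n.factorial n.factorial).eval t ≠ 0) :
    ∃ (η : Fin n → k) (τ : Perm (Fin n)), f.map (eRH t) = ∏ i, (X - C (η i)) ∧
      Injective η ∧ Injective (thet c' η) ∧ (∀ i, η i ^ (p ^ a) = η (τ i)) := by
  classical
  obtain ⟨η, hη⟩ := fin_roots (hf.map (eRH t)) (splits _) ((hf.natDegree_map _).trans hn)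
  have hR : (resol c' f).map (eRH t) = ∏ π, (X - C (thet c' η π)) := by
    have := resol_map c' (aeval t : k[X] →ₐ[k] k) f
    rw [coe_aeval_eq_evalRingHom, hη, resol_prod] at this
    exact this.symm
  have hth : Injective (thet c' η) := by
    intro π π' h
    by_contra hne
    apply hD
    rw [← coe_evalRingHom, ← resultant_map_map, ← derivative_map, hR]
    have hcard : n.factorial = card (Perm (Fin n)) := by rw [card_perm, card_fin]
    rw [hcard, res_prod]
    · refine prod_eq_zero (mem_univ π) ?_
      rw [← mul_prod_erase _ _ (mem_univ π),
        ← mul_prod_erase _ _ (mem_erase.2 ⟨Ne.symm hne, mem_univ π'⟩), h]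
      simp [derivative_mul]
    · refine (natDegree_derivative_le _).trans ((Nat.sub_le _ _).trans ?_)
      simp [natDegree_prod_of_monic, monic_X_sub_C]
  have hηi : Injective η := by
    intro i i' h
    by_contra hne
    have h1 : thet c' η (Equiv.swap i i') = thet c' η 1 := by
      refine sum_congr rfl fun m _ => ?_
      congr 1
      by_cases h1 : m = i
      · subst h1; simp [h]
      by_cases h2 : m = i'
      · subst h2; simp [h]
      simp [Equiv.swap_apply_of_ne_of_ne h1 h2]
    have := congrArg (fun r : Perm (Fin n) => r i) (hth h1)
    simp at this
    exact hne this.symm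
  have hev : ∀ y, f.evalEval t y = ∏ i, (y - η i) := fun y => by
    rw [← map_evalRingHom_eval, hη, eval_prod]; simp
  have hr : ∀ i, ∃ i', η i ^ (p ^ a) = η i' := by
    intro i
    have h0 : f.evalEval t (η i) = 0 := by
      rw [hev]; exact prod_eq_zero (mem_univ i) (sub_self _)
    have h1 := hfr t (η i)
    rw [h0, ht, hev, zero_pow (pow_ne_zero _ (Fact.out : p.Prime).ne_zero)] at h1
    obtain ⟨i', -, h2⟩ := prod_eq_zero_iff.1 h1.symm
    exact ⟨i', sub_eq_zero.1 h2⟩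
  choose τ hτ using hr
  have hτi : Injective τ := by
    intro i i' h
    apply hηi
    have : η i ^ (p ^ a) = η i' ^ (p ^ a) := by rw [hτ, hτ, h]
    rw [← iterateFrobenius_def, ← iterateFrobenius_def] at this
    exact (iterateFrobenius k p a).injective this
  exact ⟨η, Equiv.ofBijective τ (Finite.injective_iff_bijective.1 hτi), hη, hηi, hth, hτ⟩

noncomputable def FQ (k : Type) [Field k] (Q : ℕ) : Finset k := by
  classical
  exact (X ^ Q - X : k[X]).roots.toFinset

lemma mem_FQ {k : Type} [Field k] {Q : ℕ} (hQ : 1 < Q) (x : k) : x ∈ FQ k Q ↔ x ^ Q = x := by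
  classical
  rw [FQ, mem_toFinset, mem_roots (FiniteField.X_pow_card_sub_X_ne_zero k hQ), IsRoot]
  simp [sub_eq_zero]

lemma card_FQ {k : Type} [Field k] [IsAlgClosed k] {p : ℕ} [Fact p.Prime] [CharP k p] {a : ℕ} (ha : a ≠ 0) :
    (FQ k (p ^ a)).card = p ^ a := by
  classical
  have hQ : 1 < p ^ a := one_lt_pow ha (Fact.out : p.Prime).one_lt
  rw [FQ, Multiset.toFinset_card_of_nodup]
  · rw [← (splits (X ^ (p ^ a) - X : k[X])).natDegree_eq_card_roots,
      FiniteField.X_pow_card_sub_X_natDegree_eq k hQ]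
  · exact nodup_roots (galois_poly_separable p _ (dvd_pow_self p ha))

lemma frob_H {k : Type} [Field k] {p : ℕ} [Fact p.Prime] [CharP k p] {n a : ℕ} (c' : Fin n → k) {f : k[X][X]}
    {t : k} {η : Fin n → k} {τ : Perm (Fin n)} (hη : f.map (eRH t) = ∏ i, (X - C (η i)))
    (hth : Injective (thet c' η)) (hτ : ∀ i, η i ^ (p ^ a) = η (τ i)) {σ π : Perm (Fin n)} (hπ : τ * π = π * σ) :
    (resol c' f).evalEval t (thet c' η π) = 0 ∧ (derivative (resol c' f)).evalEval t (thet c' η π) ≠ 0 ∧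
    (thet c' η π) ^ (p ^ a) * (derivative (resol c' f)).evalEval t (thet c' η π) =
      (∑ i, C (C (c' i ^ (p ^ a))) * resolH c' f (σ i)).evalEval t (thet c' η π) := by
  classical
  have hR : (resol c' f).map (eRH t) = ∏ π, (X - C (thet c' η π)) := by
    have := resol_map c' (aeval t : k[X] →ₐ[k] k) f
    rw [coe_aeval_eq_evalRingHom, hη, resol_prod] at this
    exact this.symm
  have hH : ∀ j, (resolH c' f j).map (eRH t) = resH c' η j := fun j => by
    have := resolH_map c' (aeval t : k[X] →ₐ[k] k) f j
    rw [coe_aeval_eq_evalRingHom, hη, resolH_prod] at this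
    exact this.symm
  have hd : (derivative (resol c' f)).evalEval t (thet c' η π) = ∏ π' ∈ univ.erase π, (thet c' η π - thet c' η π') := by
    rw [← map_evalRingHom_eval, ← derivative_map, hR, ← mul_prod_erase _ _ (mem_univ π)]
    simp [derivative_mul, eval_prod]
  have hHe : ∀ j, (resolH c' f j).evalEval t (thet c' η π) = η (π j) * ∏ π' ∈ univ.erase π, (thet c' η π - thet c' η π') := by
    intro j
    rw [← map_evalRingHom_eval, hH, resH, eval_finsetSum, sum_eq_single π]
    · simp [eval_prod]
    · intro π' _ h
      rw [eval_mul, eval_prod]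
      rw [prod_eq_zero (mem_erase.2 ⟨Ne.symm h, mem_univ π⟩), mul_zero]
      simp
    · simp
  refine ⟨?_, ?_, ?_⟩
  · rw [← map_evalRingHom_eval, hR, eval_prod]
    exact prod_eq_zero (mem_univ π) (by simp)
  · rw [hd, prod_ne_zero_iff]
    intro π' h
    exact sub_ne_zero.2 (hth.ne (ne_of_mem_erase h).symm)
  · have : (∑ i, C (C (c' i ^ (p ^ a))) * resolH c' f (σ i)).evalEval t (thet c' η π) =
      ∑ i, c' i ^ (p ^ a) * (resolH c' f (σ i)).evalEval t (thet c' η π) := by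
      simp [evalEval, eval_finsetSum]
    rw [this, hd]
    simp only [hHe, ← mul_assoc]
    rw [← sum_mul]
    congr 1
    rw [thet, sum_pow_char_pow]
    refine sum_congr rfl fun i _ => ?_
    rw [smul_eq_mul, mul_pow, hτ, ← Perm.mul_apply, hπ]
    rfl

end Cheb
section ChebB
open Polynomial

lemma conj_count {T : Type} {n : ℕ} (G : Finset T) (τ : T → Perm (Fin n)) (U : ℕ)
    (hU : ∀ σ : Perm (Fin n), ∑ t ∈ G, (univ.filter fun π => τ t * π = π * σ).card ≤ U) (κ : ℕ) :
    n.factorial * (G.filter fun t => (univ.filter fun i => τ t i = i).card = κ).card ≤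
      (univ.filter (fun σ : Perm (Fin n) => (univ.filter (fun i => σ i = i)).card = κ)).card * U ∧
    n.factorial * G.card + (univ.filter (fun σ : Perm (Fin n) => (univ.filter (fun i => σ i = i)).card = κ)).card * U
     ≤ n.factorial * (G.filter fun t => (univ.filter fun i => τ t i = i).card = κ).card + n.factorial * U := by
  classical
  set fx : Perm (Fin n) → ℕ := fun σ => (univ.filter (fun i => σ i = i)).card with hfx
  have hconj : ∀ τ π : Perm (Fin n), fx (π⁻¹ * τ * π) = fx τ := by
    intro τ π
    refine Finset.card_bij (fun i _ => π i) ?_ ?_ ?_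
    · intro i hi
      rw [mem_filter] at hi ⊢
      refine ⟨mem_univ _, ?_⟩
      exact Perm.inv_eq_iff_eq.1 hi.2
    · intro i _ i' _ h; exact π.injective h
    · intro i hi
      refine ⟨π⁻¹ i, ?_, by simp⟩
      rw [mem_filter] at hi ⊢
      refine ⟨mem_univ _, ?_⟩
      simp [hi.2]
  have key : ∀ q : ℕ → Prop, [DecidablePred q] → ∑ σ ∈ univ.filter (fun σ => q (fx σ)), ∑ t ∈ G, (univ.filter fun π => τ t * π = π * σ).card =
      n.factorial * (G.filter fun t => q (fx (τ t))).card := by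
    intro q _
    rw [sum_comm, card_filter, mul_sum]
    refine sum_congr rfl fun t _ => ?_
    have h1 : ∀ σ, (univ.filter fun π => τ t * π = π * σ).card = ∑ π : Perm (Fin n), if π⁻¹ * τ t * π = σ then 1 else 0 := by
      intro σ
      rw [card_filter]
      refine sum_congr rfl fun π _ => ?_
      have : (τ t * π = π * σ) ↔ π⁻¹ * τ t * π = σ := by
        rw [mul_assoc, inv_mul_eq_iff_eq_mul]
      simp only [this]
    simp only [h1]
    rw [sum_comm]
    have h2 : ∀ π : Perm (Fin n), (∑ σ ∈ univ.filter (fun σ => q (fx σ)), if π⁻¹ * τ t * π = σ then 1 else 0) = if q (fx (τ t)) then 1 else 0 := by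
      intro π
      rw [Finset.sum_ite_eq]
      simp [hconj]
    simp only [h2]
    rw [sum_const, card_univ, card_perm, card_fin, smul_eq_mul]
  have k1 := key (fun m => m = κ)
  have k2 := key (fun m => ¬ m = κ)
  have b1 : ∑ σ ∈ univ.filter (fun σ => fx σ = κ), ∑ t ∈ G, (univ.filter fun π => τ t * π = π * σ).card ≤
      (univ.filter (fun σ => fx σ = κ)).card * U := by
    rw [← smul_eq_mul]; exact Finset.sum_le_card_nsmul _ _ _ fun σ _ => hU σ
  have b2 : ∑ σ ∈ univ.filter (fun σ => ¬ fx σ = κ), ∑ t ∈ G, (univ.filter fun π => τ t * π = π * σ).card ≤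
      (univ.filter (fun σ => ¬ fx σ = κ)).card * U := by
    rw [← smul_eq_mul]; exact Finset.sum_le_card_nsmul _ _ _ fun σ _ => hU σ
  have s1 := card_filter_add_card_filter_not (s := (univ : Finset (Perm (Fin n)))) (fun σ => fx σ = κ)
  have s2 := card_filter_add_card_filter_not (s := G) (fun t => fx (τ t) = κ)
  rw [card_univ, card_perm, card_fin] at s1
  rw [k1] at b1
  rw [k2] at b2
  refine ⟨b1, ?_⟩
  rw [← s2]
  nlinarith

open Classical in
theorem cheb (k : Type) [Field k] [IsAlgClosed k] (p : ℕ) [Fact p.Prime] [CharP k p] (n w h : ℕ) :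
    ∃ C a₀ : ℕ, ∀ a, a₀ ≤ a → ∀ (c' : Fin n → k) (f : k[X][X]), f.Monic → f.natDegree = n →
      (∀ x y : k, (f.evalEval x y) ^ (p ^ a) = f.evalEval (x ^ (p ^ a)) (y ^ (p ^ a))) →
      Irreducible (resol c' f) → (∀ j, ((resol c' f).coeff j).natDegree ≤ w) →
      (∀ i, (resolH c' f i).natDegree ≤ h) → (∀ i j, ((resolH c' f i).coeff j).natDegree ≤ h) →
      resultant (resol c' f) (derivative (resol c' f)) n.factorial n.factorial ≠ 0 →
      (resultant (resol c' f) (derivative (resol c' f)) n.factorial n.factorial).natDegree ≤ h →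
      ∀ κ, |(n.factorial : ℝ) * ((FQ k (p ^ a)).filter fun t => ((FQ k (p ^ a)).filter fun y => f.evalEval t y = 0).card = κ).card -
        (p : ℝ) ^ a * (univ.filter (fun σ : Perm (Fin n) => (univ.filter (fun i => σ i = i)).card = κ)).card| ≤
        C * (p : ℝ) ^ (a - a / 2) := by
  obtain ⟨C, a₀, hst⟩ := step k p n.factorial w h
  refine ⟨n.factorial * (C + h), a₀ + 1, ?_⟩
  intro a ha c' f hf hn hfr hirr hw hh1 hh2 hD0 hDd κ
  have hp := (Fact.out : p.Prime)
  have ha0 : a ≠ 0 := by omega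
  have hQ : 1 < p ^ a := one_lt_pow ha0 hp.one_lt
  set Δ := resultant (resol c' f) (derivative (resol c' f)) n.factorial n.factorial with hΔ
  set G := (FQ k (p ^ a)).filter fun t => Δ.eval t ≠ 0 with hG
  have hdat : ∀ t, ∃ (η : Fin n → k) (τ : Perm (Fin n)), t ∈ G → f.map (eRH t) = ∏ i, (X - Polynomial.C (η i)) ∧
      Injective η ∧ Injective (thet c' η) ∧ (∀ i, η i ^ (p ^ a) = η (τ i)) := by
    intro t
    by_cases ht : t ∈ G
    · rw [hG, mem_filter, mem_FQ hQ] at ht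
      obtain ⟨η, τ, h⟩ := frob_data c' hf hn hfr ht.1 ht.2
      exact ⟨η, τ, fun _ => h⟩
    · exact ⟨fun _ => 0, 1, fun h => absurd h ht⟩
  choose η τ hητ using hdat
  have hGQ : ∀ t ∈ G, t ^ (p ^ a) = t := fun t ht => (mem_FQ hQ t).1 (mem_filter.1 ht).1
  have hU : ∀ σ : Perm (Fin n), ∑ t ∈ G, (univ.filter fun π => τ t * π = π * σ).card ≤ p ^ a + C * p ^ (a - a / 2) := by
    intro σ
    let S0 : Finset (Σ _ : k, Perm (Fin n)) := G.sigma fun t => univ.filter fun π => τ t * π = π * σ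
    have hS0 : S0.card = ∑ t ∈ G, (univ.filter fun π => τ t * π = π * σ).card := Finset.card_sigma _ _
    let S := S0.image fun x => (x.1, thet c' (η x.1) x.2)
    have hS : S.card = S0.card := by
      apply Finset.card_image_of_injOn
      rintro ⟨t, π⟩ hx ⟨t', π'⟩ hx' h
      simp only [Prod.mk.injEq] at h
      obtain ⟨rfl, h⟩ := h
      have ht : t ∈ G := (Finset.mem_sigma.1 hx).1
      rw [(hητ t ht).2.2.1 h]
    rw [← hS0, ← hS]
    refine hst a (by omega) (resol c' f) (∑ i, Polynomial.C (Polynomial.C (c' i ^ (p ^ a))) * resolH c' f (σ i)) (monic_resol _ _) hirr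
      (natDegree_resol _ _) hw ?_ ?_ S ?_
    · refine natDegree_sum_le_of_forall_le _ _ fun i _ => ?_
      exact (natDegree_C_mul_le _ _).trans (hh1 _)
    · intro j
      rw [finsetSum_coeff]
      refine natDegree_sum_le_of_forall_le _ _ fun i _ => ?_
      rw [coeff_C_mul]
      exact (natDegree_C_mul_le _ _).trans (hh2 _ _)
    · intro x hx
      obtain ⟨⟨t, π⟩, hx0, rfl⟩ := Finset.mem_image.1 hx
      obtain ⟨ht, hπ⟩ := Finset.mem_sigma.1 hx0
      have := frob_H c' (hητ t ht).1 (hητ t ht).2.2.1 (hητ t ht).2.2.2 (mem_filter.1 hπ).2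
      exact ⟨this.1, this.2.1, hGQ t ht, this.2.2⟩
  obtain ⟨u1, u2⟩ := conj_count G τ _ hU κ
  set M := (univ.filter (fun σ : Perm (Fin n) => (univ.filter (fun i => σ i = i)).card = κ)).card
  have hfix : ∀ t ∈ G, ((FQ k (p ^ a)).filter fun y => f.evalEval t y = 0).card = (univ.filter fun i => τ t i = i).card := by
    intro t ht
    obtain ⟨h1, h2, h3, h4⟩ := hητ t ht
    symm
    refine Finset.card_bij (fun i _ => η t i) ?_ ?_ ?_
    · intro i hi
      rw [mem_filter] at hi
      rw [mem_filter, mem_FQ hQ, h4, hi.2, ← map_evalRingHom_eval, h1, eval_prod]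
      exact ⟨rfl, prod_eq_zero (mem_univ i) (by simp)⟩
    · intro i _ i' _ h; exact h2 h
    · intro y hy
      rw [mem_filter, mem_FQ hQ, ← map_evalRingHom_eval, h1, eval_prod, prod_eq_zero_iff] at hy
      obtain ⟨hy1, i, -, hi⟩ := hy
      have hyi : y = η t i := by simpa [sub_eq_zero] using hi
      refine ⟨i, ?_, hyi.symm⟩
      rw [mem_filter]
      refine ⟨mem_univ _, h2 ?_⟩
      rw [← h4, ← hyi, hy1]
  set A' := ((FQ k (p ^ a)).filter fun t => ((FQ k (p ^ a)).filter fun y => f.evalEval t y = 0).card = κ).card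
  set A := (G.filter fun t => (univ.filter fun i => τ t i = i).card = κ).card
  have hbad : ((FQ k (p ^ a)).filter fun t => ¬ Δ.eval t ≠ 0).card ≤ h := by
    refine le_trans ?_ hDd
    refine le_trans (card_le_card (t := Δ.roots.toFinset) ?_) ((toFinset_card_le _).trans (card_roots' _))
    intro t ht
    rw [mem_filter, not_not] at ht
    rw [mem_toFinset, mem_roots hD0]
    exact ht.2
  have hGc : p ^ a ≤ G.card + h := by
    have := card_filter_add_card_filter_not (s := FQ k (p ^ a)) (fun t => Δ.eval t ≠ 0)
    rw [card_FQ ha0, ← hG] at this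
    omega
  have hGc' : G.card ≤ p ^ a := by
    rw [← card_FQ (k := k) (p := p) ha0]; exact card_filter_le _ _
  have hA1 : A ≤ A' := by
    refine card_le_card fun t ht => ?_
    rw [mem_filter] at ht ⊢
    exact ⟨(mem_filter.1 ht.1).1, by rw [hfix t ht.1]; exact ht.2⟩
  have hA2 : A' ≤ A + h := by
    refine le_trans (card_le_card (t := (G.filter fun t => (univ.filter fun i => τ t i = i).card = κ) ∪
      ((FQ k (p ^ a)).filter fun t => ¬ Δ.eval t ≠ 0)) ?_) ((card_union_le _ _).trans (by gcongr))
    intro t ht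
    rw [mem_filter] at ht
    rw [Finset.mem_union]
    by_cases h0 : Δ.eval t ≠ 0
    · have htG : t ∈ G := mem_filter.2 ⟨ht.1, h0⟩
      exact Or.inl (mem_filter.2 ⟨htG, by rw [← hfix t htG]; exact ht.2⟩)
    · exact Or.inr (mem_filter.2 ⟨ht.1, h0⟩)
  have hM : M ≤ n.factorial := by
    refine (card_filter_le _ _).trans ?_
    rw [card_univ, card_perm, card_fin]
  have hE : 1 ≤ p ^ (a - a / 2) := Nat.one_le_pow _ _ hp.pos
  have e1 : n.factorial * A' ≤ p ^ a * M + n.factorial * (C + h) * p ^ (a - a / 2) := by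
    calc n.factorial * A' ≤ n.factorial * (A + h) := by gcongr
      _ = n.factorial * A + n.factorial * h := by ring
      _ ≤ M * (p ^ a + C * p ^ (a - a / 2)) + n.factorial * h := by gcongr
      _ = p ^ a * M + (M * C * p ^ (a - a / 2) + n.factorial * h * 1) := by ring
      _ ≤ p ^ a * M + (n.factorial * C * p ^ (a - a / 2) + n.factorial * h * p ^ (a - a / 2)) := by gcongr
      _ = _ := by ring
  have e2 : p ^ a * M ≤ n.factorial * A' + n.factorial * (C + h) * p ^ (a - a / 2) := by
    have x1 : n.factorial * p ^ a ≤ n.factorial * G.card + n.factorial * h := by rw [← mul_add]; gcongr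
    have x2 : n.factorial * A ≤ n.factorial * A' := by gcongr
    have x3 : n.factorial * h * 1 ≤ n.factorial * h * p ^ (a - a / 2) := by gcongr
    have x4 : 0 ≤ M * (C * p ^ (a - a / 2)) := Nat.zero_le _
    linarith
  rw [abs_le]
  have e1' : (n.factorial : ℝ) * A' ≤ p ^ a * M + n.factorial * (C + h) * p ^ (a - a / 2) := by exact_mod_cast e1
  have e2' : (p : ℝ) ^ a * M ≤ n.factorial * A' + n.factorial * (C + h) * p ^ (a - a / 2) := by exact_mod_cast e2
  push_cast
  constructor <;> linarith

end ChebB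
section ResPiece
open Polynomial

abbrev MP (A : Type) [CommRing A] := MvPolynomial (Fin 3) A

variable {A B : Type} [CommRing A] [CommRing B]

noncomputable def ln (y z : A) : MP A →+* A[X] := MvPolynomial.eval₂Hom C ![X, C y, C z]

noncomputable def rs (d e : ℕ) (P G : MP A) (y z : A) : A := resultant (ln y z P) (ln y z G) d e

noncomputable def fr (d e : ℕ) (P G : MP A) : A[X] :=
  rs d e (mmap C P) (mmap C G) X 1

noncomputable def ci (d e : ℕ) (P G : MP A) : A := rs d e P G 1 0

noncomputable def ft (d e : ℕ) (P G : MP A) : A[X] :=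
  X ^ (d * e) + ∑ i ∈ range (d * e), C (ci d e P G ^ (d * e - 1 - i) * (fr d e P G).coeff i) * X ^ i

lemma ln_map (φ : A →+* B) (y z : A) (P : MP A) :
    ln (φ y) (φ z) (mmap φ P) = (ln y z P).map φ := by
  have : (ln (φ y) (φ z)).comp (mmap φ) = (mRH φ).comp (ln y z) := by
    refine MvPolynomial.ringHom_ext ?_ ?_
    · intro r; simp [ln]
    · intro i; fin_cases i <;> simp [ln]
  exact congrArg (fun g => g P) this

lemma rs_map (φ : A →+* B) (d e : ℕ) (y z : A) (P G : MP A) :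
    rs d e (mmap φ P) (mmap φ G) (φ y) (φ z) = φ (rs d e P G y z) := by
  rw [rs, rs, ln_map, ln_map, resultant_map_map]

lemma ci_map (φ : A →+* B) (d e : ℕ) (P G : MP A) :
    ci d e (mmap φ P) (mmap φ G) = φ (ci d e P G) := by
  rw [ci, ci, ← rs_map, map_one, map_zero]

lemma fr_map (φ : A →+* B) (d e : ℕ) (P G : MP A) :
    fr d e (mmap φ P) (mmap φ G) = (fr d e P G).map φ := by
  have := rs_map (mRH φ) d e X 1 (mmap C P) (mmap C G)
  rw [MvPolynomial.map_map, MvPolynomial.map_map] at this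
  rw [fr, fr, MvPolynomial.map_map, MvPolynomial.map_map]
  have h2 : (mRH φ).comp C = C.comp φ := by ext; simp
  rw [h2] at this
  simpa using this

lemma fr_eval (d e : ℕ) (P G : MP A) (y : A) : (fr d e P G).eval y = rs d e P G y 1 := by
  have := rs_map (eRH y) d e X 1 (mmap C P) (mmap C G)
  rw [MvPolynomial.map_map, MvPolynomial.map_map] at this
  have h2 : (eRH y).comp C = RingHom.id A := by ext; simp
  rw [h2, MvPolynomial.map_id, MvPolynomial.map_id] at this
  simpa [fr] using this.symm

lemma ft_map (φ : A →+* B) (d e : ℕ) (P G : MP A) :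
    ft d e (mmap φ P) (mmap φ G) = (ft d e P G).map φ := by
  simp [ft, ci_map, fr_map, Polynomial.map_sum]

lemma ft_deg [Nontrivial A] (d e : ℕ) (P G : MP A) : (ft d e P G).Monic ∧ (ft d e P G).natDegree = d * e := by
  have h : (∑ i ∈ range (d * e), C (ci d e P G ^ (d * e - 1 - i) * (fr d e P G).coeff i) * X ^ i).degree
      < ((d * e : ℕ) : WithBot ℕ) := by
    refine (degree_sum_le _ _).trans_lt ?_
    rw [Finset.sup_lt_iff (WithBot.bot_lt_coe _)]
    intro i hi
    refine (degree_C_mul_X_pow_le _ _).trans_lt ?_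
    exact_mod_cast mem_range.1 hi
  constructor
  · exact monic_X_pow_add h
  · rw [ft, natDegree_eq_of_degree_eq (degree_add_eq_left_of_degree_lt (by rwa [degree_X_pow]))]
    exact natDegree_X_pow _

lemma ln_eval (y z x : A) (P : MP A) : (ln y z P).eval x = mev ![x, y, z] P := by
  have : (eRH x).comp (ln y z) = mev ![x, y, z] := by
    refine MvPolynomial.ringHom_ext ?_ ?_
    · intro r; simp [ln]
    · intro i; fin_cases i <;> simp [ln]
  exact congrArg (fun g => g P) this

lemma ln_sum (y z : A) (P : MP A) : ln y z P =
    ∑ m ∈ P.support, C (P.coeff m * y ^ m 1 * z ^ m 2) * X ^ m 0 := by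
  rw [ln, MvPolynomial.coe_eval₂Hom, MvPolynomial.eval₂_eq']
  refine sum_congr rfl fun m _ => ?_
  simp only [Fin.prod_univ_three, Matrix.cons_val_zero, Matrix.cons_val_one, cons_val]
  simp only [map_mul, map_pow]
  ring

lemma hom_deg {d : ℕ} {P : MP A} (hP : P.IsHomogeneous d) {m : Fin 3 →₀ ℕ} (hm : m ∈ P.support) :
    m 0 + m 1 + m 2 = d := by
  have := hP.degree_eq_sum_deg_support hm
  rw [this, ← Fin.sum_univ_three]
  exact (Finsupp.sum_fintype m (fun _ i => i) (by simp)).symm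

lemma ln_deg {d : ℕ} {P : MP A} (hP : P.IsHomogeneous d) (y z : A) :
    (ln y z P).natDegree ≤ d := by
  rw [ln_sum]
  refine natDegree_sum_le_of_forall_le _ _ fun m hm => ?_
  refine (natDegree_C_mul_X_pow_le _ _).trans ?_
  have := hom_deg hP hm
  omega

lemma ln_lead {d : ℕ} {P : MP A} (hP : P.IsHomogeneous d) (y z : A) :
    (ln y z P).coeff d = mev ![1, 0, 0] P := by
  rw [ln_sum, finsetSum_coeff, eval_eq']
  refine sum_congr rfl fun m hm => ?_
  have := hom_deg hP hm
  rw [coeff_C_mul, coeff_X_pow, Fin.prod_univ_three]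
  by_cases h : d = m 0
  · have h1 : m 1 = 0 := by omega
    have h2 : m 2 = 0 := by omega
    simp [h, h1, h2]
  · have h12 : m 1 ≠ 0 ∨ m 2 ≠ 0 := by omega
    rcases h12 with h1 | h1 <;> simp [h, h1]

lemma rs_prod [Nontrivial A] {d e : ℕ} {P G : MP A} (hG : G.IsHomogeneous e) {y z ρ : A} {ξ : Fin d → A}
    (h : ln y z P = C ρ * ∏ i, (X - C (ξ i))) :
    rs d e P G y z = ρ ^ e * ∏ i, mev ![ξ i, y, z] G := by
  rw [rs, h, resultant_C_mul_left]
  have := res_prod ξ (ln y z G) e (ln_deg hG y z)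
  rw [card_fin] at this
  rw [this]
  simp only [ln_eval]

variable {L : Type} [Field L] [IsAlgClosed L]

lemma ln_roots {d : ℕ} {P : MP L} (hP : P.IsHomogeneous d) (hρ : mev ![1, 0, 0] P ≠ 0) (y z : L) :
    ∃ ξ : Fin d → L, ln y z P = C (mev ![1, 0, 0] P) * ∏ i, (X - C (ξ i)) := by
  set ρ := mev ![1, 0, 0] P
  have hl := ln_lead hP y z
  have hd : (ln y z P).natDegree = d := le_antisymm (ln_deg hP y z) (le_natDegree_of_ne_zero (by rw [hl]; exact hρ))
  have hlc : (ln y z P).leadingCoeff = ρ := by rw [leadingCoeff, hd, hl]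
  have hm : (C ρ⁻¹ * ln y z P).Monic := by
    rw [Monic, leadingCoeff_mul, leadingCoeff_C, hlc, inv_mul_cancel₀ hρ]
  obtain ⟨ξ, h⟩ := fin_roots hm (splits _) (n := d) (by rw [natDegree_C_mul (inv_ne_zero hρ), hd])
  refine ⟨ξ, ?_⟩
  rw [← h, ← mul_assoc, ← C_mul, mul_inv_cancel₀ hρ, C_1, one_mul]

lemma eval_root {d : ℕ} {P : MP L} {y z ρ : L} (hρ : ρ ≠ 0) {ξ : Fin d → L}
    (h : ln y z P = C ρ * ∏ i, (X - C (ξ i))) (x : L) : mev ![x, y, z] P = 0 ↔ ∃ i, x = ξ i := by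
  rw [← ln_eval, h, eval_mul, eval_C, eval_prod, mul_eq_zero, or_iff_right hρ, prod_eq_zero_iff]
  simp [sub_eq_zero]

lemma rs_zero {d e : ℕ} {P G : MP L} (hP : P.IsHomogeneous d) (hρ : mev ![1, 0, 0] P ≠ 0)
    (hG : G.IsHomogeneous e) (y z : L) : rs d e P G y z = 0 ↔
      ∃ x, mev ![x, y, z] P = 0 ∧ mev ![x, y, z] G = 0 := by
  obtain ⟨ξ, h⟩ := ln_roots hP hρ y z
  rw [rs_prod hG h, mul_eq_zero, or_iff_right (pow_ne_zero _ hρ), prod_eq_zero_iff]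
  constructor
  · rintro ⟨i, -, hi⟩
    exact ⟨ξ i, (eval_root hρ h _).2 ⟨i, rfl⟩, hi⟩
  · rintro ⟨x, hx, hx2⟩
    obtain ⟨i, rfl⟩ := (eval_root hρ h _).1 hx
    exact ⟨i, mem_univ _, hx2⟩

lemma hom_smul {d : ℕ} {P : MP A} (hP : P.IsHomogeneous d) (l : A) (v : Fin 3 → A) :
    mev (fun i => l * v i) P = l ^ d * mev v P := by
  rw [eval_eq', eval_eq', mul_sum]
  refine sum_congr rfl fun m hm => ?_
  have := hom_deg hP hm
  rw [Fin.prod_univ_three, Fin.prod_univ_three, ← this]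
  ring

lemma hom_smul3 {d : ℕ} {P : MP A} (hP : P.IsHomogeneous d) (l x y z : A) :
    mev ![l * x, l * y, l * z] P = l ^ d * mev ![x, y, z] P := by
  rw [← hom_smul hP]
  congr 2
  funext i; fin_cases i <;> rfl

lemma rs_smul {d e : ℕ} {P G : MP L} (hP : P.IsHomogeneous d) (hρ : mev ![1, 0, 0] P ≠ 0)
    (hG : G.IsHomogeneous e) (l : L) (hl : l ≠ 0) (y z : L) :
    rs d e P G (l * y) (l * z) = l ^ (d * e) * rs d e P G y z := by
  obtain ⟨ξ, h⟩ := ln_roots hP hρ y z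
  have h2 : ln (l * y) (l * z) P = C (mev ![1, 0, 0] P) * ∏ i, (X - C (l * ξ i)) := by
    refine Polynomial.funext fun x => ?_
    have hx : x = l * (l⁻¹ * x) := by field_simp
    rw [ln_eval, hx, hom_smul3 hP, ← ln_eval, h, eval_mul, eval_mul, eval_prod, eval_prod]
    simp only [eval_C, eval_sub, eval_X, ← mul_sub]
    rw [prod_mul_distrib, prod_const, card_univ, card_fin]
    ring
  rw [rs_prod hG h, rs_prod hG h2]
  simp only [hom_smul3 hG]
  rw [prod_mul_distrib, prod_const, card_univ, card_fin, ← pow_mul, mul_comm e d]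
  ring

lemma fr_top {d e : ℕ} {P G : MP L} (hP : P.IsHomogeneous d) (hρ : mev ![1, 0, 0] P ≠ 0)
    (hG : G.IsHomogeneous e) : (fr d e P G).natDegree ≤ d * e ∧ (fr d e P G).coeff (d * e) = ci d e P G := by
  set f := fr d e P G with hf
  set n := d * e with hn
  set g : L[X] := rs d e (mmap C P) (mmap C G) 1 X with hg
  have hge : ∀ l, g.eval l = rs d e P G 1 l := by
    intro y
    have := rs_map (eRH y) d e 1 X (mmap C P) (mmap C G)
    rw [MvPolynomial.map_map, MvPolynomial.map_map] at this
    have h2 : (eRH y).comp C = RingHom.id L := by ext; simp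
    rw [h2, MvPolynomial.map_id, MvPolynomial.map_id] at this
    simpa using this.symm
  obtain ⟨m, hm1, hm2⟩ : ∃ m, f.natDegree ≤ m ∧ n ≤ m := ⟨max f.natDegree n, le_max_left _ _, le_max_right _ _⟩
  have key : reflect m f * X ^ n = g * X ^ m := by
    have : (reflect m f * X ^ n - g * X ^ m) * X = 0 := by
      refine Polynomial.funext fun l => ?_
      by_cases hl : l = 0
      · simp [hl]
      let _ : Invertible l⁻¹ := invertibleOfNonzero (inv_ne_zero hl)
      have h1 := eval₂_reflect_mul_pow (RingHom.id L) (l⁻¹) m f hm1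
      rw [invOf_eq_inv, inv_inv] at h1
      have h2 : f.eval l⁻¹ = l⁻¹ ^ n * g.eval l := by
        rw [hf, fr_eval, hge, ← rs_smul hP hρ hG _ (inv_ne_zero hl), mul_one, inv_mul_cancel₀ hl]
      rw [eval₂_id, eval₂_id, h2] at h1
      have h3 : (reflect m f).eval l * l ^ n = g.eval l * l ^ m := by
        rw [inv_pow, inv_pow] at h1
        have hm := pow_ne_zero m hl
        have hn' := pow_ne_zero n hl
        field_simp at h1
        linear_combination h1
      simp [h3]
    have h0 := (mul_eq_zero.1 this).resolve_right X_ne_zero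
    exact sub_eq_zero.1 h0
  have key2 : reflect m f = g * X ^ (m - n) := by
    have : (X : L[X]) ^ m = X ^ (m - n) * X ^ n := by rw [← pow_add]; congr 1; omega
    rw [this, ← mul_assoc] at key
    exact mul_right_cancel₀ (pow_ne_zero _ X_ne_zero) key
  have hco : ∀ i, i ≤ m → f.coeff i = (g * X ^ (m - n)).coeff (m - i) := by
    intro i hi
    rw [← key2, coeff_reflect, revAt_le (by omega)]
    congr 1; omega
  constructor
  · rw [natDegree_le_iff_coeff_eq_zero]
    intro i hi
    by_cases him : i ≤ m
    · rw [hco i him, coeff_mul_X_pow', if_neg (by omega)]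
    · exact coeff_eq_zero_of_natDegree_lt (by omega)
  · rw [hco n hm2, coeff_mul_X_pow', if_pos le_rfl, Nat.sub_self, coeff_zero_eq_eval_zero, hge]
    rfl

lemma ft_eval {d e : ℕ} {P G : MP L} (hP : P.IsHomogeneous d) (hρ : mev ![1, 0, 0] P ≠ 0)
    (hG : G.IsHomogeneous e) (hn : d * e ≠ 0) (y : L) :
    (ft d e P G).eval (ci d e P G * y) = ci d e P G ^ (d * e - 1) * (fr d e P G).eval y := by
  obtain ⟨h1, h2⟩ := fr_top hP hρ hG
  rw [eval_eq_sum_range' (lt_succ_of_le h1), Finset.sum_range_succ, h2, ft, eval_add, eval_finsetSum,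
    eval_pow, eval_X, add_comm, mul_add, mul_sum]
  congr 1
  · refine sum_congr rfl fun i hi => ?_
    have : d * e - 1 = (d * e - 1 - i) + i := by have := mem_range.1 hi; omega
    conv_rhs => rw [this, pow_add]
    rw [eval_mul, eval_C, eval_pow, eval_X]
    ring
  · conv_lhs => rw [show d * e = d * e - 1 + 1 by omega]
    conv_rhs => rw [← mul_assoc, ← pow_succ, Nat.sub_add_cancel (Nat.pos_of_ne_zero hn)]
    rw [Nat.sub_add_cancel (Nat.pos_of_ne_zero hn)]; ring

end ResPiece
section AffPiece
open Polynomial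

variable {A B : Type} [CommRing A] [CommRing B]

noncomputable def cm (M : Matrix (Fin 3) (Fin 3) A) : MP A →ₐ[A] MP A :=
  MvPolynomial.aeval (fun i => ∑ j, MvPolynomial.C (M i j) * MvPolynomial.X j)

lemma cm_eval (M : Matrix (Fin 3) (Fin 3) A) (v : Fin 3 → A) (P : MP A) :
    mev v (cm M P) = mev (M.mulVec v) P := by
  have : (mev v).comp (cm M : MP A →+* MP A) = mev (M.mulVec v) := by
    refine MvPolynomial.ringHom_ext ?_ ?_
    · intro r; simp [cm]
    · intro i; simp [cm, mulVec, dotProduct]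
  exact congrArg (fun g => g P) this

lemma cm_hom {d : ℕ} {P : MP A} (hP : P.IsHomogeneous d) (M : Matrix (Fin 3) (Fin 3) A) :
    (cm M P).IsHomogeneous d := by
  have := hP.aeval (S := A) (fun i => ∑ j, MvPolynomial.C (M i j) * MvPolynomial.X j) (n := 1) (fun i =>
    MvPolynomial.IsHomogeneous.sum _ _ _ fun j _ => isHomogeneous_C_mul_X _ _)
  rw [one_mul] at this
  exact this

lemma cm_map (φ : A →+* B) (M : Matrix (Fin 3) (Fin 3) A) (P : MP A) :
    mmap φ (cm M P) = cm (M.map φ) (mmap φ P) := by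
  have : (mmap φ).comp (cm M : MP A →+* MP A) = (cm (M.map φ) : MP B →+* MP B).comp (mmap φ) := by
    refine MvPolynomial.ringHom_ext ?_ ?_
    · intro r; simp [cm]
    · intro i; simp [cm]
  exact congrArg (fun g => g P) this

lemma cm_cm (M N : Matrix (Fin 3) (Fin 3) A) (P : MP A) : cm M (cm N P) = cm (N * M) P := by
  have : (cm M).comp (cm N) = cm (N * M) := by
    refine MvPolynomial.algHom_ext fun i => ?_
    simp only [cm, AlgHom.comp_apply, MvPolynomial.aeval_X, map_sum, map_mul, Matrix.mul_apply, MvPolynomial.algHom_C,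
      MvPolynomial.algebraMap_eq, mul_sum, sum_mul]
    rw [sum_comm]
    simp only [mul_assoc]
  exact congrArg (fun g => g P) this

lemma cm_one (P : MP A) : cm (1 : Matrix (Fin 3) (Fin 3) A) P = P := by
  have : cm (1 : Matrix (Fin 3) (Fin 3) A) = AlgHom.id A (MP A) := by
    refine MvPolynomial.algHom_ext fun i => ?_
    simp [cm, Matrix.one_apply]
  rw [this]; rfl

lemma cm_irr {M : Matrix (Fin 3) (Fin 3) A} (hM : IsUnit M.det) {P : MP A} (hP : Irreducible P) :
    Irreducible (cm M P) := by
  have e : MP A ≃+* MP A := RingEquiv.refl _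
  let e : MP A ≃+* MP A :=
    { toFun := cm M
      invFun := cm M⁻¹
      left_inv := fun P => by rw [cm_cm, mul_nonsing_inv _ hM, cm_one]
      right_inv := fun P => by rw [cm_cm, nonsing_inv_mul _ hM, cm_one]
      map_mul' := map_mul _
      map_add' := map_add _ }
  exact (MulEquiv.irreducible_iff e).2 hP

variable {k : Type} [Field k] [IsAlgClosed k]

lemma vec3 (v : Fin 3 → A) : v = ![v 0, v 1, v 2] := by
  funext i; fin_cases i <;> rfl

lemma homogz (F : k[X][X]) : ∃ (N : ℕ) (G : MP k), ∀ x y z : k,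
    mev ![x * z, y * z, z] G = z ^ N * F.evalEval y x := by
  induction F using induction_on' with
  | add p q hp hq =>
    obtain ⟨N, G, h⟩ := hp
    obtain ⟨N', G', h'⟩ := hq
    refine ⟨N + N', MvPolynomial.X 2 ^ N' * G + MvPolynomial.X 2 ^ N * G', fun x y z => ?_⟩
    simp only [map_add, map_mul, map_pow, MvPolynomial.eval_X, h, h', evalEval_add]
    simp only [cons_val]
    ring
  | monomial n a =>
    induction a using induction_on' with
    | add p q hp hq =>
      obtain ⟨N, G, h⟩ := hp
      obtain ⟨N', G', h'⟩ := hq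
      refine ⟨N + N', MvPolynomial.X 2 ^ N' * G + MvPolynomial.X 2 ^ N * G', fun x y z => ?_⟩
      simp only [map_add, map_mul, map_pow, MvPolynomial.eval_X, h, h', evalEval_add]
      simp only [cons_val]
      ring
    | monomial m b =>
      refine ⟨n + m, MvPolynomial.C b * MvPolynomial.X 0 ^ n * MvPolynomial.X 1 ^ m, fun x y z => ?_⟩
      simp only [map_mul, map_pow, MvPolynomial.eval_X, MvPolynomial.eval_C, evalEval, eval_monomial, eval_mul, eval_pow, eval_C]
      simp only [cons_val]
      ring

noncomputable def aff (P : MP A) : A[X][X] := ln X 1 (mmap C P)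

lemma aff_bev (i : A →+* B) (y x : B) (P : MP A) :
    bev i y x (aff P) = mev ![x, y, 1] (mmap i P) := by
  have : (bev i y x).comp ((ln X 1).comp (mmap C)) = (mev ![x, y, 1]).comp (mmap i) := by
    refine MvPolynomial.ringHom_ext ?_ ?_
    · intro r; simp [ln, bev]
    · intro i; fin_cases i <;> simp [ln, bev]
  exact congrArg (fun g => g P) this

lemma aff_evalEval (y x : A) (P : MP A) : (aff P).evalEval y x = mev ![x, y, 1] P := by
  have : (evalEvalRingHom y x).comp ((ln X 1).comp (mmap C)) = mev ![x, y, 1] := by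
    refine MvPolynomial.ringHom_ext ?_ ?_
    · intro r; simp [ln]
    · intro i; fin_cases i <;> simp [ln]
  exact congrArg (fun g => g P) this

lemma biv_ext {F G : k[X][X]} (h : ∀ x y, F.evalEval y x = G.evalEval y x) : F = G := by
  ext1 n
  refine Polynomial.funext fun y => ?_
  have : F.map (eRH y) = G.map (eRH y) := by
    refine Polynomial.funext fun x => ?_
    rw [map_evalRingHom_eval, map_evalRingHom_eval, h]
  have := congrArg (fun p => p.coeff n) this
  simpa using this

lemma aff_irr {d : ℕ} {P : MP k} (hd : d ≠ 0) (hP : P.IsHomogeneous d) (hirr : Irreducible P)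
    (hρ : mev ![1, 0, 0] P ≠ 0) : Irreducible (aff P) := by
  have hz : Irreducible (MvPolynomial.X 2 : MP k) := MvPolynomial.X_prime.irreducible
  have hPz : ¬ P ∣ MvPolynomial.X 2 := by
    intro h
    obtain ⟨u, hu⟩ := hirr.associated_of_dvd hz h
    obtain ⟨c, hc, hcu⟩ := MvPolynomial.isUnit_iff_eq_C_of_isReduced.1 u.isUnit
    have := congrArg (mev ![1, 0, 0]) hu
    rw [hcu] at this
    simp only [map_mul, MvPolynomial.eval_C, MvPolynomial.eval_X, cons_val] at this
    rcases mul_eq_zero.1 this with h1 | h1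
    · exact hρ h1
    · exact hc.ne_zero h1
  have hpr : Prime P := hirr.prime
  have hlead : (aff P).coeff d = C (mev ![1, 0, 0] P) := by
    rw [aff, ln_lead (hP.map _)]
    have := MvPolynomial.eval₂_comp_left (C : k →+* k[X]) (RingHom.id k) ![1, 0, 0] P
    rw [MvPolynomial.eval_map]
    rw [MvPolynomial.eval₂_id] at this
    rw [this]
    simp only [RingHomCompTriple.comp_eq]
    congr 1
    funext i; fin_cases i <;> simp
  have hne : aff P ≠ 0 := by
    intro h
    rw [h, coeff_zero] at hlead
    exact hρ (C_eq_zero.1 hlead.symm)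
  refine ⟨?_, ?_⟩
  · intro hu
    have h1 := natDegree_eq_zero_of_isUnit hu
    have h2 : d ≤ (aff P).natDegree := le_natDegree_of_ne_zero (by rw [hlead]; exact C_ne_zero.2 hρ)
    omega
  · intro F G hFG
    obtain ⟨N, F', hF⟩ := homogz F
    obtain ⟨N', G', hG⟩ := homogz G
    have key : MvPolynomial.X 2 ^ (N + N') * P = MvPolynomial.X 2 ^ d * (F' * G') := by
      refine mul_left_cancel₀ hz.ne_zero (MvPolynomial.funext fun v => ?_)
      rw [vec3 v]
      simp only [map_mul, map_pow, MvPolynomial.eval_X, cons_val]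
      by_cases h2 : v 2 = 0
      · simp [h2]
      have h0 : v 0 = (v 0 / v 2) * v 2 := by field_simp
      have h1 : v 1 = (v 1 / v 2) * v 2 := by field_simp
      generalize v 0 / v 2 = x at *
      generalize v 1 / v 2 = y at *
      generalize v 2 = z at *
      rw [h0, h1, hF, hG]
      have h3 := hom_smul3 hP z x y 1
      rw [mul_comm z x, mul_comm z y, mul_one, ← aff_evalEval, hFG] at h3
      rw [h3, evalEval_mul]
      ring
    have hdvd : P ∣ MvPolynomial.X 2 ^ d * (F' * G') := ⟨_, by rw [← key, mul_comm]⟩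
    rcases hpr.dvd_or_dvd hdvd with h | h
    · exact absurd (hpr.dvd_of_dvd_pow h) hPz
    have main : ∀ (F G : k[X][X]) (F' : MP k) (N : ℕ), aff P = F * G → (∀ x y z : k,
        mev ![x * z, y * z, z] F' = z ^ N * F.evalEval y x) → P ∣ F' → IsUnit G := by
      intro F G F' N hFG hF ⟨R, hR⟩
      have hFR : F = F * (G * aff R) := by
        rw [← mul_assoc, ← hFG]
        refine biv_ext fun x y => ?_
        have := hF x y 1
        rw [hR, map_mul, mul_one, mul_one, one_pow, one_mul] at this
        rw [evalEval_mul, aff_evalEval, aff_evalEval, this]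
      have hF0 : F ≠ 0 := by rintro rfl; exact hne (by rw [hFG, zero_mul])
      have : G * aff R = 1 := by
        refine mul_left_cancel₀ hF0 ?_
        rw [← hFR, mul_one]
      exact IsUnit.of_mul_eq_one _ this
    rcases hpr.dvd_or_dvd h with h | h
    · exact Or.inr (main F G F' N hFG hF h)
    · exact Or.inl (main G F G' N' (by rw [hFG, mul_comm]) hG h)

end AffPiece
section NForm
open Polynomial

variable {A : Type} [CommRing A]

lemma ln_der (y z : A) (P : MP A) : derivative (ln y z P) = ln y z (pderiv 0 P) := by
  induction P using MvPolynomial.induction_on with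
  | C a => simp [ln]
  | add p q hp hq => simp only [map_add, hp, hq]
  | mul_X p i hp =>
    rw [map_mul, derivative_mul, hp, pderiv_mul, map_add, map_mul, map_mul]
    congr 2
    fin_cases i <;> simp [ln, pderiv_X]

lemma cm_pderiv (M : Matrix (Fin 3) (Fin 3) A) (j : Fin 3) (P : MP A) :
    pderiv j (cm M P) = ∑ i, MvPolynomial.C (M i j) * cm M (pderiv i P) := by
  induction P using MvPolynomial.induction_on with
  | C a => simp [cm]
  | add p q hp hq => simp only [map_add, hp, hq, mul_add, sum_add_distrib]
  | mul_X p l hp =>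
    have hX : pderiv j (cm M (MvPolynomial.X l)) = MvPolynomial.C (M l j) := by
      simp [cm, pderiv_X, single_apply]
    rw [map_mul, pderiv_mul, hp, hX]
    simp only [pderiv_mul, map_add, map_mul, mul_add, sum_add_distrib]
    congr 1
    · rw [sum_mul]
      exact sum_congr rfl fun i _ => by ring
    · simp [pderiv_X, single_apply, apply_ite, mul_comm]

def Nb (b : A) : Matrix (Fin 3) (Fin 3) A := !![-b, -1, 0; 1, 0, 0; 0, 0, 1]

lemma Nb_vec (b y t z : A) : (Nb b).mulVec ![y, t, z] = ![-b * y - t, y, z] := by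
  funext i
  fin_cases i <;> simp [Nb, mulVec, dotProduct, Fin.sum_univ_three]; ring

lemma Nb_det (b : A) : (Nb b).det = 1 := by
  simp [Nb, Matrix.det_fin_three]

noncomputable def pl (b t : A) (P : MP A) : A[X] := ln t 1 (cm (Nb b) P)

lemma pl_eval (b t y : A) (P : MP A) : (pl b t P).eval y = mev ![-b * y - t, y, 1] P := by
  rw [pl, ln_eval, cm_eval, Nb_vec]

lemma pl_der (b t y : A) (P : MP A) : (derivative (pl b t P)).eval y =
    -b * mev ![-b * y - t, y, 1] (pderiv 0 P) +
     mev ![-b * y - t, y, 1] (pderiv 1 P) := by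
  rw [pl, ln_der, ln_eval, cm_pderiv, Fin.sum_univ_three]
  simp only [map_add, map_mul, cm_eval, Nb_vec, MvPolynomial.eval_C]
  simp [Nb]

variable {k : Type} [Field k] [IsAlgClosed k]

open Classical in
lemma dbl_root {d : ℕ} {p : k[X]} (hd : p.natDegree = d) (h0 : p.eval 0 = 0) (h1 : (derivative p).eval 0 = 0)
    (hp : p ≠ 0) (hc : d - 1 ≤ p.roots.toFinset.card) :
    2 ≤ d ∧ ∃ g : k[X], p = X ^ 2 * g ∧ g.Separable ∧ g.eval 0 ≠ 0 := by
  obtain ⟨q, rfl⟩ := dvd_iff_isRoot.2 h0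
  rw [C_0, sub_zero] at *
  rw [derivative_mul, derivative_X, eval_add, eval_mul, eval_mul, eval_X, zero_mul, add_zero, eval_one, one_mul] at h1
  obtain ⟨g, rfl⟩ := dvd_iff_isRoot.2 h1
  rw [C_0, sub_zero] at *
  have hg : g ≠ 0 := by rintro rfl; simp at hp
  have hd' : d = g.natDegree + 2 := by
    rw [← hd, natDegree_X_mul (mul_ne_zero X_ne_zero hg), natDegree_X_mul hg]
  refine ⟨by omega, g, by ring, ?_⟩
  have hr : (X * (X * g)).roots = 0 ::ₘ 0 ::ₘ g.roots := by
    rw [roots_mul hp, roots_mul (right_ne_zero_of_mul hp), roots_X]; rfl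
  rw [hr] at hc
  have hgc := card_roots' g
  have hsub := toFinset_card_le g.roots
  simp only [Multiset.toFinset_cons, Finset.insert_eq_of_mem (Finset.mem_insert_self _ _)] at hc
  have hi := Finset.card_insert_le (0 : k) g.roots.toFinset
  constructor
  · rw [← nodup_roots_iff_of_splits hg (splits g)]
    apply Multiset.toFinset_card_eq_card_iff_nodup.1
    omega
  · intro h
    have : (0 : k) ∈ g.roots.toFinset := by
      rw [mem_toFinset, mem_roots hg]; exact h
    rw [Finset.insert_eq_of_mem this] at hc
    omega

lemma nform {d : ℕ} {P : MP k} (hP : P.IsHomogeneous d) (hirr : Irreducible P) (htan : SimpleTangencyPlane d P) :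
    2 ≤ d ∧ ∃ M : Matrix (Fin 3) (Fin 3) k, IsUnit M.det ∧
      mev ![1, 0, 0] (cm M P) ≠ 0 ∧ mev ![0, 0, 1] (cm M P) = 0 ∧
      mev ![0, 1, 0] (cm M P) ≠ 0 ∧
      mev ![0, 0, 1] (pderiv 0 (cm M P)) ≠ 0 ∧
      mev ![0, 0, 1] (pderiv 1 (cm M P)) = 0 ∧
      ∃ g : k[X], pl 0 0 (cm M P) = X ^ 2 * g ∧ g.Separable ∧ g.eval 0 ≠ 0 := by
  classical
  obtain ⟨a, ha0, hcard, hsm, x₀, ⟨hx1, hx2⟩, ⟨c, hc⟩, huniq⟩ := htan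
  set u := x₀.rep with hu
  have hu0 : u ≠ 0 := x₀.rep_nonzero
  have hP0 : P ≠ 0 := hirr.ne_zero
  have hPu : mev u P = 0 := hx1
  have hd0 : d ≠ 0 := by
    rintro rfl
    apply hP0
    refine MvPolynomial.funext fun v => ?_
    have h1 := hom_smul hP 0 v
    have h2 := hom_smul hP 0 u
    simp only [zero_mul, pow_zero, one_mul] at h1 h2
    rw [← h1, h2, hPu, map_zero]
  have hc0 : c ≠ 0 := by
    rintro rfl
    exact hsm x₀ hx1 hx2 (by rw [hc, zero_smul])
  let al : (Fin 3 → k) →ₗ[k] k := linearCombination k a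
  have hal : ∀ v, al v = ∑ i, a i * v i := by
    intro v; simp [al, linearCombination_apply, mul_comm]
  obtain ⟨v0, hv0, hPv0⟩ : ∃ v0, al v0 = 1 ∧ mev v0 P ≠ 0 := by
    have h1 : (∑ i, MvPolynomial.C (a i) * MvPolynomial.X i : MP k) ≠ 0 := by
      intro h
      apply ha0
      funext j
      have := congrArg (mev (single j 1)) h
      simpa [single_apply] using this
    obtain ⟨v, hv⟩ : ∃ v, mev v (P * ∑ i, MvPolynomial.C (a i) * MvPolynomial.X i) ≠ 0 := by
      by_contra hcon
      push Not at hcon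
      exact mul_ne_zero hP0 h1 (MvPolynomial.funext fun v => by rw [hcon v, map_zero])
    rw [map_mul] at hv
    have hv2 : al v ≠ 0 := by
      intro h
      apply right_ne_zero_of_mul hv
      rw [hal] at h
      simpa using h
    refine ⟨(al v)⁻¹ • v, by rw [map_smul, smul_eq_mul, inv_mul_cancel₀ hv2], ?_⟩
    have := hom_smul hP (al v)⁻¹ v
    intro h
    have h' : mev (fun i => (al v)⁻¹ * v i) P = 0 := h
    rw [this] at h'
    exact mul_ne_zero (pow_ne_zero _ (inv_ne_zero hv2)) (left_ne_zero_of_mul hv) h'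
  have hau : al u = 0 := by rw [hal]; exact hx2
  obtain ⟨v1, hv1, hPv1⟩ : ∃ v1, al v1 = 0 ∧ mev v1 P ≠ 0 := by
    by_contra hcon
    push Not at hcon
    obtain ⟨w, hw⟩ : ∃ w, w ∉ Submodule.span k ({v0, u} : Set (Fin 3 → k)) := by
      by_contra hcon
      push Not at hcon
      have h1 : Submodule.span k ({v0, u} : Set (Fin 3 → k)) = ⊤ := by
        rw [eq_top_iff]; exact fun x _ => hcon x
      have h2 := finrank_span_le_card (R := k) ({v0, u} : Set (Fin 3 → k))
      rw [h1, finrank_top, Module.finrank_fin_fun] at h2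
      have h3 : ({v0, u} : Set (Fin 3 → k)).toFinset.card ≤ 2 := by
        rw [Set.toFinset_insert, Set.toFinset_singleton]; exact Finset.card_le_two
      omega
    set v := w - al w • v0 with hv
    have hav : al v = 0 := by rw [hv, map_sub, map_smul, hv0, smul_eq_mul, mul_one, sub_self]
    have hvne : ∀ l : k, v ≠ l • u := by
      intro l h
      apply hw
      have : w = al w • v0 + l • u := by rw [← h, hv]; abel
      rw [this]
      exact add_mem (Submodule.smul_mem _ _ (Submodule.subset_span (by simp))) (Submodule.smul_mem _ _ (Submodule.subset_span (by simp)))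
    have hv00 : v ≠ 0 := by simpa using hvne 0
    have hy := hvne
    set y : P2 k := Projectivization.mk k v hv00 with hydef
    obtain ⟨l, hl⟩ := exists_smul_eq_mk_rep k v hv00
    have hyr : al y.rep = 0 := by
      rw [hydef, ← hl]
      change al ((l : k) • v) = 0
      rw [map_smul, hav, smul_zero]
    have hyx : y = x₀ := by
      refine huniq y (hcon _ hyr) (by rw [← hal]; exact hyr) ?_
      set r := y.rep
      refine ⟨∑ i, v0 i * mev r (pderiv i P), ?_⟩
      have key : ∀ w, al w = 0 → ∑ i, w i * mev r (pderiv i P) = 0 := by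
        intro w hw
        let N : Matrix (Fin 3) (Fin 3) k := Matrix.of fun i => ![w i, 0, r i]
        have hN : ∀ x, N.mulVec ![x, 0, 1] = x • w + r := by
          intro x
          funext i
          simp [N, mulVec, dotProduct, Fin.sum_univ_three, mul_comm]
        have h0 : ln 0 1 (cm N P) = 0 := by
          refine Polynomial.funext fun x => ?_
          rw [ln_eval, cm_eval, hN, hcon, eval_zero]
          rw [map_add, map_smul, hw, hyr, smul_zero, add_zero]
        have h1 := ln_der 0 1 (cm N P)
        rw [h0, derivative_zero, cm_pderiv] at h1
        have h2 := congrArg (eval 0) h1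
        rw [ln_eval, eval_zero, map_sum] at h2
        rw [h2]
        refine sum_congr rfl fun i _ => ?_
        rw [map_mul, cm_eval, hN, zero_smul, zero_add, MvPolynomial.eval_C]
        simp [N]
      funext j
      have h1 := key (single j 1 - a j • v0) (by
        rw [map_sub, map_smul, hv0, hal]; simp [single_apply])
      simp only [Pi.sub_apply, Pi.smul_apply, sub_mul, sum_sub_distrib, single_apply, ite_mul, one_mul,
        zero_mul, Finset.sum_ite_eq', mem_univ, if_true, smul_eq_mul, mul_assoc, ← mul_sum] at h1
      rw [Pi.smul_apply, smul_eq_mul, mul_comm]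
      exact sub_eq_zero.1 h1
    have h3 : (l : k) • v = u := by
      rw [hu, ← hyx, hydef]; exact hl
    refine hvne ((l : k)⁻¹) ?_
    rw [← h3, smul_smul, inv_mul_cancel₀ l.ne_zero, one_smul]
  let M : Matrix (Fin 3) (Fin 3) k := Matrix.of fun i => ![v0 i, v1 i, u i]
  have hM : ∀ x y z, M.mulVec ![x, y, z] = x • v0 + y • v1 + z • u := by
    intro x y z
    funext i
    simp [M, mulVec, dotProduct, Fin.sum_univ_three, mul_comm]
  have hsm1 : ∀ l : k, ∀ v, mev (l • v) P = l ^ d * mev v P := fun l v => hom_smul hP l v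
  have hinj : ∀ v, M.mulVec v = 0 → v = 0 := by
    intro v hv
    rw [vec3 v, hM] at hv
    have h0 : v 0 = 0 := by
      have := congrArg al hv
      simpa [hv0, hv1, hau] using this
    have h1 : v 1 = 0 := by
      by_contra h1
      have : v1 = (-(v 2 / v 1)) • u := by
        rw [h0, zero_smul, zero_add] at hv
        have := congrArg (fun x => (v 1)⁻¹ • x) hv
        simp only [smul_add, smul_smul, inv_mul_cancel₀ h1, one_smul, smul_zero] at this
        rw [eq_neg_of_add_eq_zero_left this, neg_smul]
        congr 2; field_simp
      apply hPv1
      rw [this, hsm1, hPu, mul_zero]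
    have h2 : v 2 = 0 := by
      rw [h0, h1, zero_smul, zero_smul, zero_add, zero_add] at hv
      exact (smul_eq_zero.1 hv).resolve_right hu0
    rw [vec3 v, h0, h1, h2]
    funext i; fin_cases i <;> rfl
  have hMd : IsUnit M.det := by
    rw [isUnit_iff_ne_zero]
    intro h
    obtain ⟨v, hv, hv2⟩ := Matrix.exists_mulVec_eq_zero_iff.2 h
    exact hv (hinj v hv2)
  have he : ∀ x y z, mev ![x, y, z] (cm M P) = mev (x • v0 + y • v1 + z • u) P := by
    intro x y z; rw [cm_eval, hM]
  have hgr : ∀ i, mev u (pderiv i P) = c * a i := by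
    intro i; exact congrFun hc i
  have hgr2 : ∀ j, mev ![0, 0, 1] (pderiv j (cm M P)) = c * ∑ i, a i * M i j := by
    intro j
    rw [cm_pderiv, map_sum, mul_sum]
    refine sum_congr rfl fun i _ => ?_
    rw [map_mul, cm_eval, hM, MvPolynomial.eval_C]
    simp only [zero_smul, one_smul, zero_add, hgr]
    ring
  have hg0 : mev ![0, 0, 1] (pderiv 0 (cm M P)) = c := by
    rw [hgr2]
    have := hal v0
    rw [hv0] at this
    simp [M, ← this]
  have hg1 : mev ![0, 0, 1] (pderiv 1 (cm M P)) = 0 := by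
    rw [hgr2]
    have := hal v1
    rw [hv1] at this
    simp [M, ← this]
  have h001 : mev ![0, 0, 1] (cm M P) = 0 := by rw [he]; simpa using hPu
  have h010 : mev ![0, 1, 0] (cm M P) ≠ 0 := by rw [he]; simpa using hPv1
  have h100 : mev ![1, 0, 0] (cm M P) ≠ 0 := by rw [he]; simpa using hPv0
  set p := pl 0 0 (cm M P) with hp
  have hpl : p.coeff d ≠ 0 := by
    rw [hp, pl, ln_lead (cm_hom (cm_hom hP _) _), cm_eval, Nb_vec]
    simpa using h010
  have hpd : p.natDegree = d := le_antisymm (ln_deg (cm_hom (cm_hom hP _) _) _ _) (le_natDegree_of_ne_zero hpl)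
  have hp0 : p ≠ 0 := by intro h; rw [h] at hpl; exact hpl (coeff_zero _)
  have hroots : d - 1 ≤ p.roots.toFinset.card ∧ 1 ≤ d - 1 := by
    have hex : ∀ x : {x : P2 k // OnCurve P x ∧ (∑ i, a i * x.rep i = 0)}, ∃ y : k, p.eval y = 0 ∧
        ∃ z : k, x.1.rep = z • (y • v1 + u) := by
      rintro ⟨x, hx1, hx2⟩
      obtain ⟨v, hv⟩ : ∃ v, M.mulVec v = x.rep := ⟨M⁻¹.mulVec x.rep, by
        rw [mulVec_mulVec, mul_nonsing_inv _ hMd, one_mulVec]⟩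
      rw [vec3 v, hM] at hv
      have h0 : v 0 = 0 := by
        rw [← hal, ← hv] at hx2
        simpa [hv0, hv1, hau] using hx2
      rw [h0, zero_smul, zero_add] at hv
      have hPx : mev x.rep P = 0 := hx1
      have h2 : v 2 ≠ 0 := by
        intro h2
        rw [h2, zero_smul, add_zero] at hv
        rw [← hv, hsm1] at hPx
        have h1 : v 1 = 0 := by
          by_contra h1
          exact mul_ne_zero (pow_ne_zero _ h1) hPv1 hPx
        rw [h1, zero_smul] at hv
        exact x.rep_nonzero hv.symm
      have hxv : x.rep = v 2 • ((v 1 / v 2) • v1 + u) := by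
        rw [← hv, smul_add, smul_smul]; congr 2; field_simp
      refine ⟨v 1 / v 2, ?_, v 2, hxv⟩
      rw [hp, pl_eval, he]
      rw [hxv, hsm1] at hPx
      have := (mul_eq_zero.1 hPx).resolve_left (pow_ne_zero _ h2)
      simpa using this
    choose y hy z hz using hex
    have hinjy : Injective (fun x => (⟨y x, by
        rw [mem_toFinset, mem_roots hp0]; exact hy x⟩ : p.roots.toFinset)) := by
      intro x x' h
      have h1 : y x = y x' := congrArg val h
      apply Subtype.ext
      rw [← Projectivization.mk_rep x.1, ← Projectivization.mk_rep x'.1, mk_eq_mk_iff']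
      have hz0 : z x' ≠ 0 := by
        intro h0
        have := hz x'
        rw [h0, zero_smul] at this
        exact x'.1.rep_nonzero this
      refine ⟨z x * (z x')⁻¹, ?_⟩
      rw [hz x, hz x', h1, smul_smul, mul_assoc, inv_mul_cancel₀ hz0, mul_one]
    have hfin := Finite.of_injective _ hinjy
    have hle := card_le_card_of_injective _ hinjy
    rw [hcard, card_eq_fintype_card, card_coe] at hle
    refine ⟨hle, ?_⟩
    rw [← hcard]
    have : Nonempty {x : P2 k // OnCurve P x ∧ (∑ i, a i * x.rep i = 0)} := ⟨⟨x₀, hx1, hx2⟩⟩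
    exact Nat.card_pos
  obtain ⟨-, hgg⟩ := dbl_root hpd (by rw [hp, pl_eval]; simpa using h001)
    (by rw [hp, pl_der]; simpa using hg1) hp0 hroots.1
  exact ⟨by omega, M, hMd, h100, h001, h010, by rw [hg0]; exact hc0, hg1, hgg⟩

end NForm
section SpecialE
open Polynomial

lemma res_ne {k1 : Type} [Field k1] {f h : k1[X][X]} (hf : f.Monic) (hirr : Irreducible f) (hh : h ≠ 0)
    (hd : h.natDegree < f.natDegree) {m : ℕ} (hm : h.natDegree ≤ m) : resultant f h f.natDegree m ≠ 0 := by
  let K := FractionRing k1[X]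
  have hinj : Injective (aM k1[X] K) := injective _ _
  obtain ⟨j, rfl⟩ := Nat.exists_eq_add_of_le hm
  rw [resultant_add_right_deg f h _ _ j le_rfl, coeff_natDegree, hf.leadingCoeff, one_pow, one_mul]
  intro h0
  have h1 : Irreducible (f.map (aM k1[X] K)) :=
    (hf.irreducible_iff_irreducible_map_fraction_map (K := K)).1 hirr
  have h2 : IsCoprime (f.map (aM k1[X] K)) (h.map (aM k1[X] K)) := by
    refine (h1.coprime_iff_not_dvd).2 fun hdv => ?_
    have := natDegree_le_of_dvd hdv ((Polynomial.map_ne_zero_iff hinj).2 hh)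
    rw [natDegree_map_eq_of_injective hinj, natDegree_map_eq_of_injective hinj] at this
    omega
  refine resultant_ne_zero _ _ h2 ?_
  rw [natDegree_map_eq_of_injective hinj, natDegree_map_eq_of_injective hinj, resultant_map_map, h0, map_zero]

variable {k : Type} [Field k] [IsAlgClosed k]

lemma aff_eval (P : MP k) (t : k) : (aff P).map (eRH t) = ln t 1 P := by
  refine Polynomial.funext fun x => ?_
  rw [map_evalRingHom_eval, aff_evalEval, ln_eval]

lemma ex_eval {p : k[X]} (hp : p ≠ 0) : ∃ t, p.eval t ≠ 0 := by
  by_contra hcon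
  push Not at hcon
  exact hp (Polynomial.funext fun t => by rw [hcon, eval_zero])

lemma trans_line {d : ℕ} {P : MP k} (hd : 2 ≤ d) (hP : P.IsHomogeneous d) (hirr : Irreducible P)
    (h100 : mev ![1, 0, 0] P ≠ 0)
    (hg0 : mev ![0, 0, 1] (pderiv 0 P) ≠ 0)
    (hg1 : mev ![0, 0, 1] (pderiv 1 P) = 0) {b : k} (hb : b ≠ 0)
    (hPb : mev ![-b, 1, 0] P ≠ 0) {h : k[X]} (hh : h ≠ 0) :
    ∃ t, (pl b t P).Separable ∧ IsCoprime (pl b t P) h := by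
  classical
  set Q := cm (Nb b) P with hQ
  have hQh : Q.IsHomogeneous d := cm_hom hP _
  have hQ1 : mev ![1, 0, 0] Q = mev ![-b, 1, 0] P := by
    rw [hQ, cm_eval, Nb_vec]; simp
  set ρ := mev ![-b, 1, 0] P with hρ
  have hFi : Irreducible (aff Q) := aff_irr (by omega) hQh (cm_irr (by rw [Nb_det]; exact isUnit_one) hirr)
    (by rw [hQ1]; exact hPb)
  have hlead : (aff Q).coeff d = C ρ := by
    ext1 n
    have : ∀ t, ((aff Q).coeff d).eval t = ρ := by
      intro t
      have := congrArg (fun p => p.coeff d) (aff_eval Q t)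
      simp only [coeff_map, coe_evalRingHom] at this
      rw [this, ln_lead hQh, hQ1]
    rw [Polynomial.funext (p := (aff Q).coeff d) (q := C ρ) (fun t => by rw [this, eval_C])]
  have hdeg : (aff Q).natDegree = d := le_antisymm (ln_deg (hQh.map _) _ _)
    (le_natDegree_of_ne_zero (by rw [hlead]; exact C_ne_zero.2 hPb))
  have hu : IsUnit (C (C ρ⁻¹) : k[X][X]) := by
    rw [isUnit_C, isUnit_C]; exact (inv_ne_zero hPb).isUnit
  set f : k[X][X] := C (C ρ⁻¹) * aff Q with hf
  have hfd : f.natDegree = d := by rw [hf, natDegree_C_mul (C_ne_zero.2 (inv_ne_zero hPb)), hdeg]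
  have hfm : f.Monic := by
    rw [Monic, leadingCoeff, hfd, hf, coeff_C_mul, hlead, ← C_mul, inv_mul_cancel₀ hPb, C_1]
  have hfi : Irreducible f := (irreducible_isUnit_mul hu).2 hFi
  have hft : ∀ t, f.map (eRH t) = C ρ⁻¹ * pl b t P := by
    intro t
    rw [hf, Polynomial.map_mul, aff_eval, map_C, coe_evalRingHom, eval_C]; rfl
  have hf' : derivative f ≠ 0 := by
    intro h0
    have h1 := congrArg (Polynomial.map (eRH 0)) h0
    rw [← derivative_map, hft, Polynomial.map_zero, derivative_C_mul] at h1
    have h2 := congrArg (eval 0) h1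
    rw [eval_mul, pl_der, eval_C, eval_zero] at h2
    simp only [mul_zero, sub_zero, hg1, add_zero] at h2
    exact mul_ne_zero (inv_ne_zero hPb) (mul_ne_zero (neg_ne_zero.2 hb) hg0) h2
  have hdl : (derivative f).natDegree < f.natDegree := natDegree_derivative_lt (by omega)
  have hr := res_ne hfm hfi hf' hdl hdl.le
  set r := resultant f (derivative f) f.natDegree f.natDegree with hrdef
  let s : k → k[X] := fun η => (ln η 1 P).comp (C (-b * η) - X)
  have hs : ∀ η, s η ≠ 0 := by
    intro η h0
    apply h100
    rw [← ln_lead hP η 1]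
    have : ln η 1 P = 0 := by
      refine Polynomial.funext fun x => ?_
      have := congrArg (eval (-b * η - x)) h0
      simp only [s, eval_comp, eval_sub, eval_C, eval_X, eval_zero, sub_sub_cancel] at this
      rw [this, eval_zero]
    rw [this, coeff_zero]
  obtain ⟨t, ht⟩ := ex_eval (p := r * ∏ η ∈ h.roots.toFinset, s η)
    (mul_ne_zero hr (prod_ne_zero_iff.2 fun η _ => hs η))
  rw [eval_mul, eval_prod] at ht
  refine ⟨t, ?_, ?_⟩
  · have h1 : resultant (f.map (eRH t)) (derivative (f.map (eRH t))) f.natDegree f.natDegree ≠ 0 := by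
      rw [derivative_map, resultant_map_map]
      exact left_ne_zero_of_mul ht
    obtain ⟨p, q, -, -, hpq⟩ := exists_mul_add_mul_eq_C_resultant (m := f.natDegree) (n := f.natDegree)
      (f.map (eRH t)) (derivative (f.map (eRH t))) natDegree_map_le
      (by rw [derivative_map]; exact natDegree_map_le.trans hdl.le) (by left; omega)
    have h2 : (f.map (eRH t)).Separable := by
      set R := resultant (f.map (eRH t)) (derivative (f.map (eRH t))) f.natDegree f.natDegree
      refine ⟨C R⁻¹ * p, C R⁻¹ * q, ?_⟩
      have : C R⁻¹ * C R = 1 := by rw [← C_mul, inv_mul_cancel₀ h1, C_1]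
      linear_combination C R⁻¹ * hpq + this
    rw [hft] at h2
    exact h2.of_mul_right
  · rw [isCoprime_iff_aeval_ne_zero_of_isAlgClosed k k]
    intro η
    by_contra hcon
    push Not at hcon
    rw [coe_aeval_eq_eval] at hcon
    have h1 := prod_ne_zero_iff.1 (right_ne_zero_of_mul ht) η (by
      rw [mem_toFinset, mem_roots hh]; exact hcon.2)
    apply h1
    have := hcon.1
    rw [pl_eval] at this
    simp only [s, eval_comp, eval_sub, eval_C, eval_X]
    rw [ln_eval, this]

noncomputable def li (b t : k) : MP k := MvPolynomial.X 0 + MvPolynomial.C b * MvPolynomial.X 1 + MvPolynomial.C t * MvPolynomial.X 2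

lemma li_hom (b t : k) : (li b t).IsHomogeneous 1 :=
  ((MvPolynomial.isHomogeneous_X _ _).add (isHomogeneous_C_mul_X _ _)).add (isHomogeneous_C_mul_X _ _)

lemma rs_li {d : ℕ} {P : MP k} (hP : P.IsHomogeneous d) (h100 : mev ![1, 0, 0] P ≠ 0) (b t y z : k) :
    rs d 1 P (li b t) y z = (-1) ^ d * mev ![-b * y - t * z, y, z] P := by
  obtain ⟨ξ, h⟩ := ln_roots hP h100 y z
  rw [rs_prod (li_hom b t) h, ← ln_eval y z (-b * y - t * z) P, h, eval_mul, eval_C, eval_prod, pow_one, mul_left_comm]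
  congr 1
  have : ∀ i, mev ![ξ i, y, z] (li b t) = -1 * eval (-b * y - t * z) (X - C (ξ i)) := by
    intro i
    simp [li]; ring
  simp only [this]
  rw [prod_mul_distrib, prod_const, card_univ, card_fin]

lemma rs_mul {d m m' : ℕ} {P E E' : MP k} (hP : P.IsHomogeneous d) (h100 : mev ![1, 0, 0] P ≠ 0)
    (hE : E.IsHomogeneous m) (hE' : E'.IsHomogeneous m') (y z : k) :
    rs d (m + m') P (E * E') y z = rs d m P E y z * rs d m' P E' y z := by
  obtain ⟨ξ, h⟩ := ln_roots hP h100 y z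
  rw [rs_prod hE h, rs_prod hE' h, rs_prod (hE.mul hE') h]
  simp only [map_mul, prod_mul_distrib]
  ring

lemma fr_mul {d m m' : ℕ} {P E E' : MP k} (hP : P.IsHomogeneous d) (h100 : mev ![1, 0, 0] P ≠ 0)
    (hE : E.IsHomogeneous m) (hE' : E'.IsHomogeneous m') :
    fr d (m + m') P (E * E') = fr d m P E * fr d m' P E' :=
  Polynomial.funext fun y => by rw [eval_mul, fr_eval, fr_eval, fr_eval, rs_mul hP h100 hE hE']

lemma rs_C_mul {d m : ℕ} (P E : MP k) (c y z : k) : rs d m P (MvPolynomial.C c * E) y z = c ^ d * rs d m P E y z := by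
  rw [rs, rs, map_mul, show ln y z (MvPolynomial.C c) = C c by simp [ln], resultant_C_mul_right]

lemma fr_C_mul {d m : ℕ} (P E : MP k) (c : k) : fr d m P (MvPolynomial.C c * E) = C (c ^ d) * fr d m P E :=
  Polynomial.funext fun y => by rw [eval_mul, fr_eval, fr_eval, rs_C_mul, eval_C]

lemma fr_li {d : ℕ} {P : MP k} (hP : P.IsHomogeneous d) (h100 : mev ![1, 0, 0] P ≠ 0) (b t : k) :
    fr d 1 P (li b t) = C ((-1) ^ d) * pl b t P :=
  Polynomial.funext fun y => by rw [eval_mul, fr_eval, rs_li hP h100, eval_C, pl_eval, mul_one]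

lemma sep_unit {p : k[X]} {c : k} (hc : c ≠ 0) (hp : p.Separable) : (C c * p).Separable := by
  obtain ⟨u, v, huv⟩ := hp
  have : C c⁻¹ * C c = 1 := by rw [← C_mul, inv_mul_cancel₀ hc, C_1]
  refine ⟨C c⁻¹ * u, C c⁻¹ * v, ?_⟩
  rw [derivative_C_mul]
  linear_combination huv + (u * p + v * derivative p) * this

lemma special {d : ℕ} {P : MP k} (hd : 2 ≤ d) (hP : P.IsHomogeneous d) (hirr : Irreducible P)
    (h100 : mev ![1, 0, 0] P ≠ 0) (h001 : mev ![0, 0, 1] P = 0)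
    (h010 : mev ![0, 1, 0] P ≠ 0)
    (hg0 : mev ![0, 0, 1] (pderiv 0 P) ≠ 0)
    (hg1 : mev ![0, 0, 1] (pderiv 1 P) = 0)
    {g : k[X]} (hpl : pl 0 0 P = X ^ 2 * g) (hgs : g.Separable) (hg : g.eval 0 ≠ 0) (m : ℕ) :
    ∃ E : MP k, E.IsHomogeneous (m + 1) ∧ ci d (m + 1) P E = 1 ∧
      (∃ G : k[X], fr d (m + 1) P E = X ^ 2 * G ∧ G.Separable ∧ G.eval 0 ≠ 0) ∧
      (∀ x, mev ![x, 0, 1] P = 0 → (mev ![x, 0, 1] E = 0 ↔ x = 0)) ∧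
      (m = 0 → ∃ l b t : k, (fr d 1 P (MvPolynomial.C l * li b t)).Separable ∧ E = MvPolynomial.C l * li 0 0 ∧
        ci d 1 P (MvPolynomial.C l * li b t) ≠ 0) := by
  obtain ⟨b, hb, hPb⟩ : ∃ b : k, b ≠ 0 ∧ mev ![-b, 1, 0] P ≠ 0 := by
    have : ln 1 0 P ≠ 0 := by
      intro h; apply h100; rw [← ln_lead hP 1 0, h, coeff_zero]
    obtain ⟨t, ht⟩ := ex_eval (mul_ne_zero X_ne_zero this)
    rw [eval_mul, eval_X, ln_eval] at ht
    exact ⟨-t, neg_ne_zero.2 (left_ne_zero_of_mul ht), by rw [neg_neg]; exact right_ne_zero_of_mul ht⟩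
  have h1d : ((-1 : k)) ^ d ≠ 0 := pow_ne_zero _ (neg_ne_zero.2 one_ne_zero)
  have hpl0 : pl 0 0 P ≠ 0 := by
    rw [hpl]; refine mul_ne_zero (pow_ne_zero _ X_ne_zero) ?_
    rintro rfl; simp at hg
  have hlic : ∀ t, ci d 1 P (li b t) ≠ 0 := by
    intro t
    rw [ci, rs_li hP h100]
    simp only [mul_one, mul_zero, sub_zero]
    exact mul_ne_zero h1d hPb
  have hrest : ∀ m, ∃ E : MP k, E.IsHomogeneous m ∧ ci d m P E ≠ 0 ∧ (fr d m P E).Separable ∧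
      IsCoprime (fr d m P E) (pl 0 0 P) := by
    intro m
    induction m with
    | zero =>
      have h1 : ∀ y z, rs d 0 P 1 y z = 1 := by
        intro y z
        obtain ⟨ξ, h⟩ := ln_roots hP h100 y z
        rw [rs_prod (isHomogeneous_one _ _) h]; simp
      have h2 : fr d 0 P 1 = 1 := Polynomial.funext fun y => by rw [fr_eval, h1, eval_one]
      refine ⟨1, isHomogeneous_one _ _, by rw [ci, h1]; exact one_ne_zero, ?_, ?_⟩
      · rw [h2]; exact separable_one
      · rw [h2]; exact isCoprime_one_left
    | succ m ih =>
      obtain ⟨E, hE, hc, hs, hco⟩ := ih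
      obtain ⟨t, ht1, ht2⟩ := trans_line hd hP hirr h100 hg0 hg1 hb hPb (h := fr d m P E * pl 0 0 P)
        (mul_ne_zero hs.ne_zero hpl0)
      have hu : IsUnit (C ((-1 : k) ^ d)) := isUnit_C.2 h1d.isUnit
      refine ⟨E * li b t, hE.mul (li_hom _ _), ?_, ?_, ?_⟩
      · rw [ci, rs_mul hP h100 hE (li_hom _ _)]; exact mul_ne_zero hc (hlic t)
      · rw [fr_mul hP h100 hE (li_hom _ _), fr_li hP h100]
        refine hs.mul (sep_unit h1d ht1) ?_
        rw [isCoprime_mul_unit_left_right hu]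
        exact ht2.symm.of_mul_left_left
      · rw [fr_mul hP h100 hE (li_hom _ _), fr_li hP h100]
        refine hco.mul_left ?_
        rw [isCoprime_mul_unit_left_left hu]
        exact ht2.of_mul_right_right
  obtain ⟨E, hE, hc, hs, hco⟩ := hrest m
  have hE1 : (li 0 0 * E).IsHomogeneous (1 + m) := (li_hom _ _).mul hE
  have hci0 : ci d 1 P (li (0 : k) 0) ≠ 0 := by
    rw [ci, rs_li hP h100]
    simpa using h010
  have hciE : ci d (1 + m) P (li 0 0 * E) ≠ 0 := by
    rw [ci, rs_mul hP h100 (li_hom _ _) hE]; exact mul_ne_zero hci0 hc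
  obtain ⟨l, hl⟩ := IsAlgClosed.exists_pow_nat_eq (ci d (1 + m) P (li 0 0 * E))⁻¹ (n := d) (by omega)
  have hl0 : l ^ d ≠ 0 := by rw [hl]; exact inv_ne_zero hciE
  have hl00 : l ≠ 0 := by rintro rfl; rw [zero_pow (by omega)] at hl0; exact hl0 rfl
  refine ⟨MvPolynomial.C l * (li 0 0 * E), ?_, ?_, ?_, ?_, ?_⟩
  · rw [add_comm]; exact hE1.C_mul l
  · rw [add_comm, ci, rs_C_mul, hl]; exact inv_mul_cancel₀ hciE
  · have hcg : IsCoprime (fr d m P E) g := by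
      rw [hpl] at hco; exact hco.of_mul_right_right
    refine ⟨C (l ^ d * (-1) ^ d) * (g * fr d m P E), ?_, ?_, ?_⟩
    · rw [add_comm m 1, fr_C_mul, fr_mul hP h100 (li_hom _ _) hE, fr_li hP h100, hpl, C_mul]; ring
    · exact sep_unit (mul_ne_zero hl0 h1d) (hgs.mul hs hcg.symm)
    · rw [eval_mul, eval_C, eval_mul]
      refine mul_ne_zero (mul_ne_zero hl0 h1d) (mul_ne_zero hg ?_)
      intro h0
      obtain ⟨u, v, huv⟩ := hco
      have := congrArg (eval 0) huv
      rw [hpl] at this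
      simp [h0] at this
  · intro x hx
    rw [map_mul, map_mul, MvPolynomial.eval_C, mul_eq_zero, or_iff_right hl00, mul_eq_zero]
    have h1 : mev ![x, 0, 1] (li (0 : k) 0) = x := by simp [li]
    rw [h1, or_iff_left]
    intro h2
    have h3 : (fr d m P E).eval 0 = 0 := by
      rw [fr_eval, rs_zero hP h100 hE]; exact ⟨x, hx, h2⟩
    obtain ⟨u, v, huv⟩ := hco
    have := congrArg (eval 0) huv
    rw [hpl] at this
    simp [h3] at this
  · rintro rfl
    obtain ⟨t, ht1, -⟩ := trans_line hd hP hirr h100 hg0 hg1 hb hPb (h := 1) one_ne_zero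
    have hEc : ∃ c, E = MvPolynomial.C c := by
      have := (MvPolynomial.totalDegree_zero_iff_isHomogeneous _).2 hE
      exact ⟨_, MvPolynomial.totalDegree_eq_zero_iff_eq_C.1 this⟩
    obtain ⟨c, rfl⟩ := hEc
    have hc0 : c ≠ 0 := by
      rintro rfl
      apply hciE
      rw [map_zero, mul_zero, ← mul_zero (1 : MP k), mul_zero, ← zero_mul (1 : MP k), ← map_zero MvPolynomial.C, ci, rs_C_mul,
        zero_pow (by omega), zero_mul]
    refine ⟨l * c, b, t, ?_, ?_, ?_⟩
    · rw [fr_C_mul, fr_li hP h100, ← mul_assoc, ← C_mul]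
      exact sep_unit (mul_ne_zero (pow_ne_zero _ (mul_ne_zero hl00 hc0)) h1d) ht1
    · rw [map_mul]; ring
    · rw [ci, rs_C_mul]
      exact mul_ne_zero (pow_ne_zero _ (mul_ne_zero hl00 hc0)) (hlic t)

end SpecialE
section GalApp
open Polynomial

section dtpart
variable {A B : Type} [CommRing A] [CommRing B]

noncomputable def dt (f : A[X][X]) : A[X][X] := ∑ i ∈ range (f.natDegree + 1), C (derivative (f.coeff i)) * X ^ i

lemma dt_coeff (f : A[X][X]) (i : ℕ) : (dt f).coeff i = derivative (f.coeff i) := by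
  rw [dt, finsetSum_coeff]
  simp only [coeff_C_mul, coeff_X_pow, mul_ite, mul_one, mul_zero]
  rw [Finset.sum_ite_eq]
  split_ifs with h
  · rfl
  · rw [coeff_eq_zero_of_natDegree_lt (by simpa using h), derivative_zero]

lemma dt_map (φ : A →+* B) (f : A[X][X]) : dt (f.map (mRH φ)) = (dt f).map (mRH φ) := by
  ext1 i
  rw [dt_coeff, coeff_map, coeff_map, dt_coeff, coe_mapRingHom, derivative_map]

lemma dt_deg {f : A[X][X]} (hf : f.Monic) (hn : f.natDegree ≠ 0) : (dt f).natDegree < f.natDegree := by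
  refine lt_of_le_of_lt (b := f.natDegree - 1) (natDegree_le_iff_coeff_eq_zero.2 fun i hi => ?_) (by omega)
  replace hi : f.natDegree ≤ i := by omega
  rw [dt_coeff]
  rcases hi.eq_or_lt with rfl | h
  · rw [hf.coeff_natDegree, derivative_one]
  · rw [coeff_eq_zero_of_natDegree_lt h, derivative_zero]

lemma dt_eval (f : A[X][X]) (y : A) : (dt f).eval (C y) = derivative (f.eval (C y)) := by
  rw [dt, eval_finsetSum, eval_eq_sum_range, derivative_sum]
  refine sum_congr rfl fun i _ => ?_
  rw [← C_pow, derivative_mul, derivative_C, mul_zero, add_zero, eval_mul, eval_C, eval_pow, eval_X, C_pow]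

noncomputable def pen (m : ℕ) (E : MP A) (s t : A) : MP A :=
  E + MvPolynomial.C s * MvPolynomial.X 1 * MvPolynomial.X 2 ^ m + MvPolynomial.C t * MvPolynomial.X 2 ^ (m + 1)

lemma pen_map (φ : A →+* B) (m : ℕ) (E : MP A) (s t : A) :
    mmap φ (pen m E s t) = pen m (mmap φ E) (φ s) (φ t) := by
  simp [pen]

lemma pen_zero (m : ℕ) (E : MP A) : pen m E 0 0 = E := by simp [pen]

lemma pen_hom {m : ℕ} {E : MP A} (hE : E.IsHomogeneous (m + 1)) (s t : A) : (pen m E s t).IsHomogeneous (m + 1) := by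
  refine (hE.add ?_).add ((MvPolynomial.isHomogeneous_X_pow _ _).C_mul t)
  rw [mul_assoc, add_comm m 1]
  exact ((MvPolynomial.isHomogeneous_X _ _).mul (MvPolynomial.isHomogeneous_X_pow _ _)).C_mul s

lemma pen_eval (m : ℕ) (E : MP A) (s t x y : A) :
    mev ![x, y, 1] (pen m E s t) = mev ![x, y, 1] E + s * y + t := by
  simp [pen]

lemma ci_pen (d m : ℕ) (P E : MP A) (s t : A) : ci d (m + 1) P (pen m E s t) = ci d (m + 1) P (pen m E s 0) := by
  have : ln 1 0 (pen m E s t) = ln 1 0 (pen m E s 0) := by simp [pen, ln]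
  rw [ci, ci, rs, rs, this]

noncomputable def fp (d m : ℕ) (P E : MP A) : A[X][X] :=
  ft d (m + 1) (mmap C P) (pen m (mmap C E) 0 X)

lemma fp_map (φ : A →+* B) (d m : ℕ) (P E : MP A) :
    fp d m (mmap φ P) (mmap φ E) = (fp d m P E).map (mRH φ) := by
  have h : ∀ Q : MP A, mmap (mRH φ) (mmap C Q) =
      mmap C (mmap φ Q) := by
    intro Q
    rw [MvPolynomial.map_map, MvPolynomial.map_map]
    exact congrArg (fun g : A →+* B[X] => mmap g Q) (RingHom.ext fun x => by simp)
  rw [fp, fp, ← ft_map, pen_map, map_zero, h, h, coe_mapRingHom, map_X]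

lemma map_ev (t : A) (Q : MP A) : mmap (eRH t) (mmap C Q) = Q := by
  rw [MvPolynomial.map_map, show (eRH t).comp C = RingHom.id A from RingHom.ext fun x => by simp, MvPolynomial.map_id]

lemma fp_ev (d m : ℕ) (P E : MP A) (t : A) :
    (fp d m P E).map (eRH t) = ft d (m + 1) P (pen m E 0 t) := by
  rw [fp, ← ft_map, pen_map, map_zero, map_ev, map_ev, coe_evalRingHom, eval_X]

end dtpart

variable {k : Type} [Field k] [IsAlgClosed k]

lemma ft_one {d e : ℕ} {P G : MP k} (hP : P.IsHomogeneous d) (hρ : mev ![1, 0, 0] P ≠ 0)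
    (hG : G.IsHomogeneous e) (hn : d * e ≠ 0) (h1 : ci d e P G = 1) : ft d e P G = fr d e P G :=
  Polynomial.funext fun y => by
    have := ft_eval hP hρ hG hn y
    rwa [h1, one_mul, one_pow, one_mul] at this

lemma ft_simple {d e : ℕ} {P G : MP k} (hP : P.IsHomogeneous d) (hρ : mev ![1, 0, 0] P ≠ 0)
    (hG : G.IsHomogeneous e) (hn : d * e ≠ 0) (hc : ci d e P G ≠ 0) {y : k} (h0 : (fr d e P G).eval y = 0)
    (h1 : (derivative (fr d e P G)).eval y ≠ 0) : ∃ y1, (ft d e P G).eval y1 = 0 ∧ (derivative (ft d e P G)).eval y1 ≠ 0 := by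
  refine ⟨ci d e P G * y, by rw [ft_eval hP hρ hG hn, h0, mul_zero], fun h => h1 ?_⟩
  have h2 : (ft d e P G).comp (C (ci d e P G) * X) = C (ci d e P G ^ (d * e - 1)) * fr d e P G :=
    Polynomial.funext fun y => by simp [eval_comp, ft_eval hP hρ hG hn]
  have h3 := congrArg (fun p => (derivative p).eval y) h2
  simp only [derivative_comp, derivative_C_mul, derivative_X, eval_mul, eval_C, mul_one, eval_comp, eval_X, h, mul_zero] at h3
  exact (mul_eq_zero.1 h3.symm).resolve_left (pow_ne_zero _ hc)

lemma monic_aff {d : ℕ} {P : MP k} (hd : d ≠ 0) (hP : P.IsHomogeneous d) (hirr : Irreducible P)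
    (hρ : mev ![1, 0, 0] P ≠ 0) :
    (C (C (mev ![1, 0, 0] P)⁻¹) * aff P).Monic ∧
    Irreducible (C (C (mev ![1, 0, 0] P)⁻¹) * aff P) := by
  set ρ := mev ![1, 0, 0] P
  have hFi : Irreducible (aff P) := aff_irr hd hP hirr hρ
  have hlead : (aff P).coeff d = C ρ := by
    refine Polynomial.funext fun t => ?_
    have := congrArg (fun p => p.coeff d) (aff_eval P t)
    simp only [coeff_map, coe_evalRingHom] at this
    rw [this, ln_lead hP, eval_C]
  have hdeg : (aff P).natDegree = d := le_antisymm (ln_deg (hP.map _) _ _)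
    (le_natDegree_of_ne_zero (by rw [hlead]; exact C_ne_zero.2 hρ))
  have hu : IsUnit (C (C ρ⁻¹) : k[X][X]) := by
    rw [isUnit_C, isUnit_C]; exact (inv_ne_zero hρ).isUnit
  refine ⟨?_, (irreducible_isUnit_mul hu).2 hFi⟩
  rw [Monic, leadingCoeff, natDegree_C_mul (C_ne_zero.2 (inv_ne_zero hρ)), hdeg, coeff_C_mul, hlead, ← C_mul,
    inv_mul_cancel₀ hρ, C_1]

lemma pen_pen {A : Type} [CommRing A] (m : ℕ) (E : MP A) (s t : A) : pen m (pen m E s 0) 0 t = pen m E s t := by simp [pen]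

noncomputable def fg (d m : ℕ) (P E : MP k) : k[X][X][X] :=
  fp d m (mmap C P) (pen m (mmap C E) X 0)

lemma fg_ev {Ω : Type} [CommRing Ω] (d m : ℕ) (P E : MP k) (i : k →+* Ω) (s t : Ω) :
    (fg d m P E).map (bev i s t) = ft d (m + 1) (mmap i P) (pen m (mmap i E) s t) := by
  have h1 : bev i s t = (eRH t).comp (mRH (eval₂RingHom i s)) := by
    ext <;> simp [bev]
  have h2 : ∀ Q : MP k, mmap (eval₂RingHom i s) (mmap C Q) = mmap i Q := by
    intro Q
    rw [MvPolynomial.map_map]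
    exact congrArg (fun g : k →+* Ω => mmap g Q) (RingHom.ext fun x => by simp)
  rw [h1, ← map_map, fg, ← fp_map, fp_ev, pen_map, h2, h2, map_zero, coe_eval₂RingHom, eval₂_X, pen_pen]

lemma fg_ev0 (d m : ℕ) (P E : MP k) : (fg d m P E).map (mRH (eRH 0)) = fp d m P E := by
  rw [fg, ← fp_map, pen_map, map_ev, map_ev, map_zero, coe_evalRingHom, eval_X, pen_zero]

theorem gal_app {d : ℕ} {P : MP k} (hd : 2 ≤ d) (hP : P.IsHomogeneous d) (hirr : Irreducible P)
    (h100 : mev ![1, 0, 0] P ≠ 0) (h001 : mev ![0, 0, 1] P = 0)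
    (h010 : mev ![0, 1, 0] P ≠ 0)
    (hg0 : mev ![0, 0, 1] (pderiv 0 P) ≠ 0)
    (hg1 : mev ![0, 0, 1] (pderiv 1 P) = 0)
    {g : k[X]} (hpl : pl 0 0 P = X ^ 2 * g) (hgs : g.Separable) (hg : g.eval 0 ≠ 0) (m : ℕ)
    (k1 : Type) [Field k1] [IsAlgClosed k1] [Algebra k[X] k1] [FaithfulSMul k[X] k1] [Algebra.IsAlgebraic k[X] k1] :
    ∃ E : MP k, E.IsHomogeneous (m + 1) ∧
      ci d (m + 1) (mmap C P) (pen m (mmap C E) X 0) ≠ 0 ∧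
      resultant (fg d m P E) (dt (fg d m P E)) (d * (m + 1)) (d * (m + 1)) ≠ 0 ∧
      ∃ c' : Fin (d * (m + 1)) → k, Irreducible ((resol c' (fg d m P E)).map (mRH (aM k[X] k1))) ∧
      resultant (resol c' (fg d m P E)) (derivative (resol c' (fg d m P E)))
        (d * (m + 1)).factorial (d * (m + 1)).factorial ≠ 0 := by
  classical
  obtain ⟨E, hE, hci, ⟨G, hG, hGs, hG0⟩, hroot, hm0⟩ := special hd hP hirr h100 h001 h010 hg0 hg1 hpl hgs hg m
  have hn : d * (m + 1) ≠ 0 := mul_ne_zero (by omega) (by omega)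
  set f := fg d m P E with hf
  obtain ⟨hfm, hfn⟩ : f.Monic ∧ f.natDegree = d * (m + 1) := ft_deg _ _ _ _
  set c := ci d (m + 1) (mmap C P) (pen m (mmap C E) X 0) with hc
  have hcev : ∀ {Ω : Type} [CommRing Ω] (i : k →+* Ω) (s t : Ω), eval₂ i s c =
      ci d (m + 1) (mmap i P) (pen m (mmap i E) s t) := by
    intro Ω _ i s t
    have h2 : ∀ Q : MP k, mmap (eval₂RingHom i s) (mmap C Q) = mmap i Q := by
      intro Q
      rw [MvPolynomial.map_map]
      exact congrArg (fun g : k →+* Ω => mmap g Q) (RingHom.ext fun x => by simp)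
    rw [ci_pen, ← coe_eval₂RingHom, hc, ← ci_map, pen_map, h2, h2, map_zero, coe_eval₂RingHom, eval₂_X]
  have hc0 : c ≠ 0 := by
    intro h
    have := hcev (RingHom.id k) 0 0
    rw [h, eval₂_zero, MvPolynomial.map_id, MvPolynomial.map_id, pen_zero, hci] at this
    exact zero_ne_one this
  obtain ⟨hPm, hPi⟩ := monic_aff (by omega) hP hirr h100
  have hroots : ∀ (Ω : Type) [Field Ω] [IsAlgClosed Ω] (i : k →+* Ω) (s t : Ω), eval₂ i s c ≠ 0 →
      ∀ y, eval₂ (bev i s t) (eval₂ i s c * y) f = 0 →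
        ∃ x, OnPt i (C (C (mev ![1, 0, 0] P)⁻¹) * aff P) (aff E) s t y x := by
    intro Ω _ _ i s t hcn y hy
    have hPi := hP.map i
    have hρi : mev ![1, 0, 0] (mmap i P) ≠ 0 := by
      rw [← ln_lead hPi (i 0) (i 0), ln_map, coeff_map, ln_lead hP]
      exact (map_ne_zero i).2 h100
    have hEi := pen_hom (hE.map i) s t
    rw [← eval_map, fg_ev, hcev i s t, ft_eval hPi hρi hEi hn] at hy
    rw [hcev i s t] at hcn
    have h1 := (mul_eq_zero.1 hy).resolve_left (pow_ne_zero _ hcn)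
    rw [fr_eval, rs_zero hPi hρi hEi] at h1
    obtain ⟨x, hx1, hx2⟩ := h1
    refine ⟨x, ?_, ?_⟩
    · rw [map_mul, aff_bev, hx1, mul_zero]
    · rw [aff_bev, ← pen_eval, hx2]
  have hf0 := fg_ev0 d m P E
  have hfE : ft d (m + 1) P E = X ^ 2 * G := by rw [ft_one hP h100 hE hn hci, hG]
  obtain ⟨A, hA⟩ : (C X : k[X][X]) ∣ fp d m P E - (X ^ 2 * G).map C := by
    rw [C_dvd_iff_dvd_coeff]
    intro i
    rw [X_dvd_iff, coeff_sub, coeff_sub, coeff_map, coeff_C_zero, sub_eq_zero, ← hfE, ← pen_zero m E, ← fp_ev, coeff_map,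
      pen_zero, coe_evalRingHom, coeff_zero_eq_eval_zero]
  obtain ⟨ξ, hξ⟩ := ln_roots hP h100 0 1
  obtain ⟨i0, hi0⟩ := (eval_root h100 hξ 0).1 h001
  have hi1 : ∀ i, i ≠ i0 → ξ i ≠ 0 := by
    intro i hi h0
    have h1 : ln 0 1 P = X ^ 2 * (C (mev ![1, 0, 0] P) *
        ∏ j ∈ (univ.erase i0).erase i, (X - C (ξ j))) := by
      rw [hξ, ← mul_prod_erase _ _ (mem_univ i0), ← mul_prod_erase _ _ (mem_erase.2 ⟨hi, mem_univ i⟩),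
        h0, ← hi0, C_0]
      ring
    apply hg0
    rw [← ln_eval, ← ln_der, h1]
    simp
  have hf00 : (fp d m P E).eval 0 = X * A.eval 0 := by
    have := congrArg (eval 0) hA
    rw [eval_sub, eval_mul, eval_C, Polynomial.map_mul] at this
    simpa using this
  have hA0 : A.evalEval 0 0 ≠ 0 := by
    have h1 : (fp d m P E).eval 0 = X * (C (mev ![1, 0, 0] P ^ (m + 1)) *
        ∏ i ∈ univ.erase i0, (C (mev ![ξ i, 0, 1] E) + X)) := by
      refine Polynomial.funext fun t => ?_
      have h2 : ((fp d m P E).eval 0).eval t = (ft d (m + 1) P (pen m E 0 t)).eval 0 := by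
        rw [← fp_ev, map_evalRingHom_eval, evalEval, C_0]
      have hci' : ci d (m + 1) P (pen m E 0 t) = 1 := by rw [ci_pen, pen_zero, hci]
      rw [h2, ft_one hP h100 (pen_hom hE _ _) hn hci', fr_eval, rs_prod (pen_hom hE _ _) hξ,
        ← mul_prod_erase _ _ (mem_univ i0)]
      simp only [pen_eval, mul_zero, add_zero, eval_mul, eval_X, eval_C, eval_prod, eval_add]
      rw [← hi0, (hroot 0 h001).2 rfl]
      ring
    rw [hf00] at h1
    have h2 := mul_left_cancel₀ X_ne_zero h1
    rw [evalEval, C_0, h2, eval_mul, eval_C, eval_prod]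
    refine mul_ne_zero (pow_ne_zero _ h100) (prod_ne_zero_iff.2 fun i hi => ?_)
    rw [eval_add, eval_C, eval_X, add_zero]
    exact fun h => hi1 i (ne_of_mem_erase hi) ((hroot _ ((eval_root h100 hξ _).2 ⟨i, rfl⟩)).1 h)
  obtain ⟨s0, t0, y1, hs1, hs2⟩ : ∃ s0 t0 y1 : k, eval₂ (bev (RingHom.id k) s0 t0) y1 f = 0 ∧
      eval₂ (bev (RingHom.id k) s0 t0) y1 (derivative f) ≠ 0 := by
    have key : ∃ s0 t0 y, ci d (m + 1) P (pen m E s0 t0) ≠ 0 ∧ (fr d (m + 1) P (pen m E s0 t0)).eval y = 0 ∧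
        (derivative (fr d (m + 1) P (pen m E s0 t0))).eval y ≠ 0 := by
      by_cases hn3 : 3 ≤ d * (m + 1)
      · refine ⟨0, 0, ?_⟩
        rw [pen_zero, hG, hci]
        have hdeg : G.natDegree ≠ 0 := by
          have h1 := (fr_top hP h100 hE).2
          rw [hci, hG] at h1
          have h2 : d * (m + 1) ≤ (X ^ 2 * G).natDegree := le_natDegree_of_ne_zero (by rw [h1]; exact one_ne_zero)
          rw [natDegree_X_pow_mul _ hGs.ne_zero] at h2
          omega
        obtain ⟨y, hy⟩ := IsAlgClosed.exists_root G (by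
          intro h; exact hdeg (natDegree_eq_zero_iff_degree_le_zero.2 h.le))
        refine ⟨y, one_ne_zero, by rw [eval_mul, hy.eq_zero, mul_zero], ?_⟩
        rw [derivative_mul, eval_add, eval_mul, eval_mul, hy.eq_zero, mul_zero, zero_add, eval_pow, eval_X]
        refine mul_ne_zero (pow_ne_zero _ ?_) ?_
        · rintro rfl; exact hG0 hy
        · have := hGs.eval₂_derivative_ne_zero (RingHom.id k) (x := y) (by rw [eval₂_id]; exact hy)
          rwa [eval₂_id] at this
      · obtain ⟨rfl, rfl⟩ : d = 2 ∧ m = 0 := by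
          have : m = 0 := by by_contra h; exact hn3 (by nlinarith [Nat.pos_of_ne_zero h])
          subst this; omega
        obtain ⟨l, b, t, hsep, hEl, hcl⟩ := hm0 rfl
        have hpe : pen 0 E (l * b) (l * t) = MvPolynomial.C l * li b t := by
          rw [hEl, pen, li, li]; simp; ring
        refine ⟨l * b, l * t, ?_⟩
        rw [hpe]
        have h1 := (fr_top (e := 1) hP h100 ((li_hom b t).C_mul l)).2
        obtain ⟨y, hy⟩ := IsAlgClosed.exists_root (fr 2 1 P (MvPolynomial.C l * li b t)) (by
          intro h
          rw [coeff_eq_zero_of_degree_lt (by rw [h]; exact WithBot.coe_lt_coe.2 (by norm_num))] at h1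
          exact hcl h1.symm)
        refine ⟨y, hcl, hy, ?_⟩
        have := hsep.eval₂_derivative_ne_zero (RingHom.id k) (x := y) (by rw [eval₂_id]; exact hy)
        rwa [eval₂_id] at this
    obtain ⟨s0, t0, y, h1, h2, h3⟩ := key
    obtain ⟨y1, h4, h5⟩ := ft_simple hP h100 (pen_hom hE _ _) hn h1 h2 h3
    have h6 := fg_ev d m P E (RingHom.id k) s0 t0
    rw [MvPolynomial.map_id, MvPolynomial.map_id] at h6
    refine ⟨s0, t0, y1, ?_, ?_⟩
    · rw [← eval_map, h6, h4]
    · rw [← eval_map, ← derivative_map, h6]; exact h5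
  obtain ⟨hfi, c', hc'1, hc'2⟩ := gal (k1 := k1) (f := f) (n := d * (m + 1)) hPm hPi hfm hfn c hc0 hroots 0 G A
    (by rw [hf0, ← sub_eq_iff_eq_add']; simpa using hA) hA0 hGs hG0 s0 t0 y1 hs1 hs2
  rw [natDegree_resol] at hc'2
  refine ⟨E, hE, hc0, ?_, c', hc'1, hc'2⟩
  have hj : Injective (mRH (aM k[X] k1)) := map_injective _ (FaithfulSMul.algebraMap_injective _ _)
  have hdt : dt f ≠ 0 := by
    intro h
    have h1 := dt_map (eRH 0) f
    rw [h, Polynomial.map_zero, hf0] at h1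
    have h2 := dt_eval (fp d m P E) 0
    rw [h1, eval_zero, C_0, hf00, derivative_mul, derivative_X] at h2
    have h3 := congrArg (eval 0) h2
    simp only [eval_add, eval_mul, eval_X, zero_mul, add_zero, eval_one, one_mul, eval_zero] at h3
    rw [evalEval, C_0] at hA0
    exact hA0 h3.symm
  have h1 := res_ne (hfm.map (mRH (aM k[X] k1))) hfi (h := (dt f).map (mRH (aM k[X] k1)))
    ((Polynomial.map_ne_zero_iff hj).2 hdt)
    (by rw [natDegree_map_eq_of_injective hj, natDegree_map_eq_of_injective hj]; exact dt_deg hfm (by rw [hfn]; exact hn))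
    (m := d * (m + 1)) (by rw [natDegree_map_eq_of_injective hj, ← hfn]; exact (dt_deg hfm (by rw [hfn]; exact hn)).le)
  rw [natDegree_map_eq_of_injective hj, hfn, resultant_map_map] at h1
  exact fun h => h1 (by rw [h, map_zero])

end GalApp
section Univ
open Polynomial

abbrev Mon (e : ℕ) := {m : Fin 3 →₀ ℕ // m ∈ finsuppAntidiag (univ : Finset (Fin 3)) e}
abbrev Va (e : ℕ) := (Fin 3 × Fin 3) ⊕ Mon e

section basic
variable {A B : Type} [CommRing A] [CommRing B]

noncomputable def Eu {e : ℕ} (u : Mon e → A) : MP A := ∑ m : Mon e, MvPolynomial.monomial m.1 (u m)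

def mx {e : ℕ} (v : Va e → A) : Matrix (Fin 3) (Fin 3) A := Matrix.of fun i j => v (Sum.inl (i, j))

lemma mem_mon {e : ℕ} (m : Fin 3 →₀ ℕ) : m ∈ finsuppAntidiag (univ : Finset (Fin 3)) e ↔ m.degree = e := by
  rw [Finset.mem_finsuppAntidiag, Finsupp.degree_eq_sum]
  simp

lemma Eu_map {e : ℕ} (φ : A →+* B) (u : Mon e → A) : mmap φ (Eu u) = Eu (fun m => φ (u m)) := by
  simp [Eu]

lemma Eu_hom {e : ℕ} (u : Mon e → A) : (Eu u).IsHomogeneous e :=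
  MvPolynomial.IsHomogeneous.sum _ _ _ fun m _ => MvPolynomial.isHomogeneous_monomial _ ((mem_mon m.1).1 m.2)

lemma Eu_coeff {e : ℕ} (u : Mon e → A) (m : Mon e) : (Eu u).coeff m.1 = u m := by
  classical
  rw [Eu, MvPolynomial.coeff_sum]
  simp only [MvPolynomial.coeff_monomial, Subtype.coe_inj]
  rw [Finset.sum_ite_eq']
  simp

lemma Eu_surj {e : ℕ} {E : MP A} (hE : E.IsHomogeneous e) : Eu (fun m : Mon e => E.coeff m.1) = E := by
  ext m
  by_cases hm : m ∈ finsuppAntidiag (univ : Finset (Fin 3)) e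
  · exact Eu_coeff _ ⟨m, hm⟩
  · rw [mem_mon] at hm
    rw [(Eu_hom _).coeff_eq_zero hm, hE.coeff_eq_zero hm]

lemma mx_map {e : ℕ} (φ : A →+* B) (v : Va e → A) : (mx v).map φ = mx (fun a => φ (v a)) := rfl

lemma deg_bd (R : A[X][X]) : ∃ w, ∀ j, (R.coeff j).natDegree ≤ w := by
  refine ⟨R.support.sup fun j => (R.coeff j).natDegree, fun j => ?_⟩
  by_cases h : j ∈ R.support
  · exact le_sup (f := fun j => (R.coeff j).natDegree) h
  · rw [notMem_support_iff.1 h, natDegree_zero]; exact Nat.zero_le _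

end basic

structure Good {k : Type} [Field k] {n : ℕ} (c' : Fin n → k) (w h d m : ℕ) (P : MP k) (M : Matrix (Fin 3) (Fin 3) k)
    (E : MP k) : Prop where
  det : M.det ≠ 0
  rho : mev ![1, 0, 0] (cm M P) ≠ 0
  hci : ci d (m + 1) (cm M P) E ≠ 0
  irr : Irreducible (resol c' (fp d m (cm M P) E))
  b1 : ∀ j, ((resol c' (fp d m (cm M P) E)).coeff j).natDegree ≤ w
  b2 : ∀ i, (resolH c' (fp d m (cm M P) E) i).natDegree ≤ h
  b3 : ∀ i j, ((resolH c' (fp d m (cm M P) E) i).coeff j).natDegree ≤ h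
  r1 : resultant (resol c' (fp d m (cm M P) E)) (derivative (resol c' (fp d m (cm M P) E))) n.factorial n.factorial ≠ 0
  r2 : (resultant (resol c' (fp d m (cm M P) E)) (derivative (resol c' (fp d m (cm M P) E)))
    n.factorial n.factorial).natDegree ≤ h
  d1 : resultant (fp d m (cm M P) E) (dt (fp d m (cm M P) E)) n n ≠ 0
  d2 : (resultant (fp d m (cm M P) E) (dt (fp d m (cm M P) E)) n n).natDegree ≤ h

abbrev UW (k : Type) [Field k] (e : ℕ) := MvPolynomial (Va e) k

noncomputable def PU {k : Type} [Field k] {e : ℕ} (P : MP k) : MP (UW k e) :=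
  cm (mx fun a : Va e => (MvPolynomial.X a : UW k e)) (mmap MvPolynomial.C P)

noncomputable def EU {k : Type} [Field k] {e : ℕ} : MP (UW k e) := Eu (fun a : Mon e => (MvPolynomial.X (Sum.inr a) : UW k e))

noncomputable def av {k B : Type} [Field k] [CommRing B] [Algebra k B] {e : ℕ} (v : Va e → B) : UW k e →+* B :=
  (MvPolynomial.aeval (R := k) v : UW k e →+* B)

lemma map_comp2 {A B D : Type} [CommRing A] [CommRing B] [CommRing D] (φ : A →+* B) (j : B →+* D) (f : A[X][X]) :
    (f.map (mRH φ)).map (mRH j) = f.map (mRH (j.comp φ)) := by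
  rw [map_map, mapRingHom_comp]

section key
variable {k B : Type} [Field k] [CommRing B] [Algebra k B] {e : ℕ} (v : Va e → B)

lemma av_X (a : Va e) : av (k := k) v (MvPolynomial.X a) = v a := by simp [av]

lemma av_C (x : k) : av v (MvPolynomial.C x) = aM k B x := by simp [av]

lemma key1 (P : MP k) : mmap (av v) (PU P) = cm (mx v) (mmap (aM k B) P) := by
  have h1 : (av v).comp MvPolynomial.C = aM k B := RingHom.ext fun x => av_C v x
  rw [PU, cm_map, mx_map, MvPolynomial.map_map, h1]
  simp only [av_X]

lemma key2 : mmap (av (k := k) v) EU = Eu (fun a => v (Sum.inr a)) := by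
  rw [EU, Eu_map]
  simp only [av_X]

lemma keyf (d m : ℕ) (v : Va (m + 1) → B) (P : MP k) : fp d m (cm (mx v) (mmap (aM k B) P)) (Eu (fun a => v (Sum.inr a))) =
      (fp d m (PU P) EU).map (mRH (av v)) := by
  rw [← key1, ← key2 (k := k), fp_map]

lemma keyr {n : ℕ} (c' : Fin n → k) (f : (UW k e)[X][X]) : resol c' (f.map (mRH (av v))) =
    (resol c' f).map (mRH (av v)) :=
  resol_map c' (Polynomial.mapAlgHom (MvPolynomial.aeval (R := k) v)) f

lemma keyh {n : ℕ} (c' : Fin n → k) (f : (UW k e)[X][X]) (i : Fin n) : resolH c' (f.map (mRH (av v))) i =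
    (resolH c' f i).map (mRH (av v)) :=
  resolH_map c' (Polynomial.mapAlgHom (MvPolynomial.aeval (R := k) v)) f i

lemma kd : av (k := k) v (mx fun a : Va e => (MvPolynomial.X a : UW k e)).det = (mx v).det := by
  rw [map_det, mapMatrix_apply, mx_map]
  simp only [av_X]

lemma kρ {A B : Type} [CommRing A] [CommRing B] (ψ : A →+* B) (P : MP A) :
    mev ![1, 0, 0] (mmap ψ P) = ψ (mev ![1, 0, 0] P) := by
  rw [← ln_eval, ← ln_eval, ← map_zero ψ, ln_map, ← map_one ψ, eval_map_apply]

end key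

variable {k : Type} [Field k] [IsAlgClosed k]

theorem univ_good {d : ℕ} {P : MP k} (hP : P.IsHomogeneous d) (hirr : Irreducible P) (htan : SimpleTangencyPlane d P) (m : ℕ) :
    ∃ (c' : Fin (d * (m + 1)) → k) (g : MvPolynomial (Va (m + 1)) k) (w h : ℕ), g ≠ 0 ∧
      ∀ v : Va (m + 1) → k, mev v g ≠ 0 → Good c' w h d m P (mx v) (Eu fun a => v (Sum.inr a)) := by
  classical
  obtain ⟨hd, M, hM, h100, h001, h010, hg0, hg1, g, hpl, hgs, hg⟩ := nform hP hirr htan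
  obtain ⟨k1, _, _, _, _, _⟩ : ∃ (k1 : Type) (_ : Field k1) (_ : IsAlgClosed k1) (_ : Algebra k[X] k1),
      FaithfulSMul k[X] k1 ∧ Algebra.IsAlgebraic k[X] k1 :=
    ⟨AlgebraicClosure (FractionRing k[X]), inferInstance, inferInstance, inferInstance,
      FaithfulSMul.trans k[X] (FractionRing k[X]) _, (IsFractionRing.comap_isAlgebraic_iff (K := FractionRing k[X])).2 inferInstance⟩
  have hj : Injective (aM k[X] k1) := FaithfulSMul.algebraMap_injective _ _
  obtain ⟨E, hE, hc, hr, c', hi, hr'⟩ := gal_app hd (cm_hom hP M) (cm_irr hM hirr) h100 h001 h010 hg0 hg1 hpl hgs hg m k1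
  let fU : (UW k (m + 1))[X][X] := fp d m (PU P) EU
  let vs : Va (m + 1) → k[X] := Sum.elim (fun ij => C (M ij.1 ij.2)) (fun a => (pen m (mmap C E) X 0).coeff a.1)
  let φ : UW k (m + 1) →+* k[X] := av vs
  have hvs1 : cm (mx vs) (mmap (aM k k[X]) P) = mmap C (cm M P) := by
    rw [cm_map]; rfl
  have hvs2 : Eu (fun a => vs (Sum.inr a)) = pen m (mmap C E) X 0 := Eu_surj (pen_hom (hE.map _) _ _)
  have hfg : fU.map (mRH φ) = fg d m (cm M P) E := by
    rw [← keyf, hvs1, hvs2, fg]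
  obtain ⟨g1, hg1a, hg1b⟩ := open_irr (R := resol c' fU) (monic_resol _ _) ((aM k[X] k1).comp φ) (by
    rw [← map_comp2, ← keyr, hfg]
    exact hi)
  have hex : ∀ D : (UW k (m + 1))[X], D.map φ ≠ 0 → ∃ j, φ (D.coeff j) ≠ 0 := by
    intro D hD
    by_contra hcon
    push Not at hcon
    exact hD (by ext1 j; rw [coeff_map, hcon, coeff_zero])
  obtain ⟨j2, hj2⟩ := hex (resultant (resol c' fU) (derivative (resol c' fU)) (d * (m + 1)).factorial (d * (m + 1)).factorial) (by
    rw [← coe_mapRingHom, ← resultant_map_map, ← derivative_map, ← keyr, hfg]; exact hr')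
  obtain ⟨j3, hj3⟩ := hex (resultant fU (dt fU) (d * (m + 1)) (d * (m + 1))) (by
    rw [← coe_mapRingHom, ← resultant_map_map, ← dt_map, hfg]; exact hr)
  obtain ⟨w, hw⟩ := deg_bd (resol c' fU)
  choose h1 hh1 using fun i => deg_bd (resolH c' fU i)
  let D1 := resultant (resol c' fU) (derivative (resol c' fU)) (d * (m + 1)).factorial (d * (m + 1)).factorial
  let D2 := resultant fU (dt fU) (d * (m + 1)) (d * (m + 1))
  let h := (∑ i, (h1 i + (resolH c' fU i).natDegree)) + (D1.natDegree + D2.natDegree)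
  have hle : ∀ i, h1 i + (resolH c' fU i).natDegree ≤ h := fun i =>
    (Finset.single_le_sum (f := fun i => h1 i + (resolH c' fU i).natDegree) (fun _ _ => Nat.zero_le _) (mem_univ i)).trans
      (Nat.le_add_right _ _)
  let dU : UW k (m + 1) := (mx fun a : Va (m + 1) => (MvPolynomial.X a : UW k (m + 1))).det
  let ρU : UW k (m + 1) := mev ![1, 0, 0] (PU P)
  let cU : UW k (m + 1) := ci d (m + 1) (PU P) EU
  have hgne : φ (g1 * D1.coeff j2 * D2.coeff j3 * dU * ρU * cU) ≠ 0 := by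
    rw [map_mul, map_mul, map_mul, map_mul, map_mul]
    refine mul_ne_zero (mul_ne_zero (mul_ne_zero (mul_ne_zero (mul_ne_zero ?_ hj2) hj3) ?_) ?_) ?_
    · intro h; apply hg1a; rw [comp_apply, h, map_zero]
    · rw [kd]
      have : mx vs = M.map C := rfl
      rw [this, ← mapMatrix_apply, ← map_det]
      exact C_ne_zero.2 hM.ne_zero
    · rw [← kρ, key1, hvs1]
      rw [← ln_lead ((cm_hom hP M).map C) (C 0) (C 0), ln_map, coeff_map, ln_lead (cm_hom hP M)]
      exact C_ne_zero.2 h100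
    · rw [← ci_map, key1, key2, hvs1, hvs2]; exact hc
  refine ⟨c', g1 * D1.coeff j2 * D2.coeff j3 * dU * ρU * cU, w, h, ?_, ?_⟩
  · intro h0; rw [h0, map_zero] at hgne; exact hgne rfl
  intro v hv
  let ψ : UW k (m + 1) →+* k := av v
  have hψ : ∀ q, mev v q = ψ q := fun q => by
    simp only [ψ, av, MvPolynomial.coe_aeval_eq_eval]
  rw [hψ, map_mul, map_mul, map_mul, map_mul, map_mul] at hv
  have hv6 := right_ne_zero_of_mul hv
  have hv5 := right_ne_zero_of_mul (left_ne_zero_of_mul hv)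
  have hv4 := right_ne_zero_of_mul (left_ne_zero_of_mul (left_ne_zero_of_mul hv))
  have hv3 := left_ne_zero_of_mul (left_ne_zero_of_mul (left_ne_zero_of_mul hv))
  have hid : mmap (aM k k) P = P := MvPolynomial.map_id P
  have kP : cm (mx v) P = mmap ψ (PU P) := by rw [key1, hid]
  have kE : Eu (fun a => v (Sum.inr a)) = mmap ψ EU := by rw [key2]
  have kf : fp d m (cm (mx v) P) (Eu fun a => v (Sum.inr a)) = fU.map (mRH ψ) := by
    rw [← keyf, hid]
  have kr1 : resultant ((resol c' fU).map (mRH ψ)) (derivative ((resol c' fU).map (mRH ψ))) (d * (m + 1)).factorial (d * (m + 1)).factorial =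
      D1.map ψ := by
    rw [derivative_map, resultant_map_map]; rfl
  have kr2 : resultant (fU.map (mRH ψ)) (dt (fU.map (mRH ψ))) (d * (m + 1)) (d * (m + 1)) = D2.map ψ := by
    rw [dt_map, resultant_map_map]; rfl
  have hne : ∀ (D : (UW k (m + 1))[X]) (j : ℕ), ψ (D.coeff j) ≠ 0 → D.map ψ ≠ 0 := by
    intro D j hD h0
    apply hD
    rw [← coeff_map, h0, coeff_zero]
  refine ⟨?_, ?_, ?_, ?_, ?_, ?_, ?_, ?_, ?_, ?_, ?_⟩
  · rw [← kd (k := k)]; exact hv4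
  · rw [kP, kρ]; exact hv5
  · rw [kP, kE, ci_map]; exact hv6
  · rw [kf, keyr]; exact hg1b k ψ (left_ne_zero_of_mul (left_ne_zero_of_mul hv3))
  · intro j; rw [kf, keyr, coeff_map]; exact natDegree_map_le.trans (hw j)
  · intro i; rw [kf, keyh]
    exact natDegree_map_le.trans ((Nat.le_add_left _ _).trans (hle i))
  · intro i j; rw [kf, keyh, coeff_map]
    exact natDegree_map_le.trans ((hh1 i j).trans ((Nat.le_add_right _ _).trans (hle i)))
  · rw [kf, keyr, kr1]; exact hne _ _ (right_ne_zero_of_mul (left_ne_zero_of_mul hv3))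
  · rw [kf, keyr, kr1]
    exact natDegree_map_le.trans ((Nat.le_add_right _ _).trans (Nat.le_add_left _ _))
  · rw [kf, kr2]; exact hne _ _ (right_ne_zero_of_mul hv3)
  · rw [kf, kr2]
    exact natDegree_map_le.trans ((Nat.le_add_left _ _).trans (Nat.le_add_left _ _))

end Univ
section Cnt
open Polynomial

noncomputable def npts (K : Type) [Field K] (P G : MP K) : ℕ :=
  Nat.card {x : P2 K // mev x.rep P = 0 ∧ mev x.rep G = 0}

lemma mk_rep {K : Type} [Field K] {d : ℕ} {P : MP K} (hP : P.IsHomogeneous d) (v : Fin 3 → K) (hv : v ≠ 0) :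
    mev (Projectivization.mk K v hv).rep P = 0 ↔ mev v P = 0 := by
  obtain ⟨a, ha⟩ := exists_smul_eq_mk_rep K v hv
  have : (Projectivization.mk K v hv).rep = fun i => (a : K) * v i := by rw [← ha]; rfl
  rw [this, hom_smul hP, mul_eq_zero, or_iff_right (pow_ne_zero _ a.ne_zero)]

lemma bev_ee {A B : Type} [CommRing A] [CommRing B] (i : A →+* B) (f : A[X][X]) (x y : B) :
    (f.map (mRH i)).evalEval x y = bev i x y f := by
  rw [← RingHom.id_comp i, ← bev_map, bev, coe_eval₂RingHom, ← eval_map, RingHom.id_comp, evalEval,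
    ← coe_evalRingHom x, ← coe_evalRingHom (C y), ]
  rw [coe_evalRingHom, coe_evalRingHom, show eval₂RingHom (RingHom.id B) x = eRH x from rfl, map_evalRingHom_eval, evalEval]

variable {k : Type} [Field k] [IsAlgClosed k]

lemma uniq {d m : ℕ} (hn : d * (m + 1) ≠ 0) {P E : MP k} (hP : P.IsHomogeneous d) (hE : E.IsHomogeneous (m + 1))
    (hρ : mev ![1, 0, 0] P ≠ 0) {t : k}
    (hr : (resultant (fp d m P E) (dt (fp d m P E)) (d * (m + 1)) (d * (m + 1))).eval t ≠ 0) {x x' y : k}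
    (h1 : mev ![x, y, 1] P = 0) (h2 : mev ![x, y, 1] (pen m E 0 t) = 0)
    (h1' : mev ![x', y, 1] P = 0) (h2' : mev ![x', y, 1] (pen m E 0 t) = 0) : x = x' := by
  classical
  by_contra hne
  obtain ⟨ξ, hξ⟩ := ln_roots hP hρ y 1
  obtain ⟨i, rfl⟩ := (eval_root hρ hξ x).1 h1
  obtain ⟨j, rfl⟩ := (eval_root hρ hξ x').1 h1'
  have hij : j ≠ i := fun h => hne (by rw [h])
  set c := ci d (m + 1) P (pen m E 0 0)
  set f := fp d m P E with hf
  obtain ⟨hfm, hfn⟩ : f.Monic ∧ f.natDegree = d * (m + 1) := ft_deg _ _ _ _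
  have hv : ∃ q : k[X], f.eval (C (c * y)) = (X - C t) ^ 2 * q := by
    refine ⟨C (c ^ (d * (m + 1) - 1) * mev ![1, 0, 0] P ^ (m + 1)) *
        ∏ a ∈ (univ.erase i).erase j, (C (mev ![ξ a, y, 1] E) + X), ?_⟩
    refine Polynomial.funext fun s => ?_
    have h3 : (f.eval (C (c * y))).eval s = (ft d (m + 1) P (pen m E 0 s)).eval (c * y) := by
      rw [← fp_ev, map_evalRingHom_eval, evalEval]
    have h4 : c = ci d (m + 1) P (pen m E 0 s) := (ci_pen _ _ _ _ _ _).symm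
    rw [h3, h4, ft_eval hP hρ (pen_hom hE _ _) hn, ← h4, fr_eval, rs_prod (pen_hom hE _ _) hξ,
      ← mul_prod_erase _ _ (mem_univ i), ← mul_prod_erase _ _ (mem_erase.2 ⟨hij, mem_univ j⟩)]
    simp only [pen_eval, zero_mul, add_zero, eval_mul, eval_X, eval_C, eval_prod, eval_add, eval_pow, eval_sub] at h2 h2' ⊢
    rw [eq_neg_of_add_eq_zero_left h2, eq_neg_of_add_eq_zero_left h2']
    ring
  obtain ⟨q, hq⟩ := hv
  have hlt := dt_deg hfm (by rw [hfn]; exact hn)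
  obtain ⟨a, b, -, -, hab⟩ := exists_mul_add_mul_eq_C_resultant (m := d * (m + 1)) (n := d * (m + 1)) f (dt f)
    hfn.le (by rw [← hfn]; exact hlt.le) (Or.inl hn)
  have h5 := congrArg (fun F => (F.eval (C (c * y))).eval t) hab
  simp only [eval_add, eval_mul, eval_C, dt_eval, hq] at h5
  apply hr
  rw [← h5]
  simp [derivative_mul, derivative_pow]

lemma fix_im {K : Type} [Field K] [Fintype K] {p : ℕ} [Fact p.Prime] [CharP k p] {a : ℕ} (ha : a ≠ 0)
    (hK : card K = p ^ a) (i : K →+* k) : FQ k (p ^ a) = univ.map ⟨i, i.injective⟩ := by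
  have hQ : 1 < p ^ a := one_lt_pow ha (Fact.out : p.Prime).one_lt
  symm
  refine Finset.eq_of_subset_of_card_le ?_ ?_
  · intro x hx
    obtain ⟨y, -, rfl⟩ := mem_map.1 hx
    rw [mem_FQ hQ, Function.Embedding.coeFn_mk, ← map_pow, ← hK, FiniteField.pow_card]
  · rw [card_FQ ha, card_map, card_univ, hK]

lemma frob_fix {K : Type} [Field K] [Fintype K] {p : ℕ} [Fact p.Prime] [CharP k p] {a : ℕ}
    (hK : card K = p ^ a) (i : K →+* k) : (iterateFrobenius k p a).comp i = i :=
  RingHom.ext fun x => by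
    rw [comp_apply, iterateFrobenius_def, ← map_pow, ← hK, FiniteField.pow_card]

open Classical in
lemma npts_eq {K : Type} [Field K] [Fintype K] {p : ℕ} [Fact p.Prime] [CharP k p] {a : ℕ} (ha : a ≠ 0)
    (hK : card K = p ^ a) (i : K →+* k) {d m : ℕ} (hn : d * (m + 1) ≠ 0) {P E : MP K} (hP : P.IsHomogeneous d)
    (hE : E.IsHomogeneous (m + 1)) (hρ : mev ![1, 0, 0] (mmap i P) ≠ 0)
    (hc : ci d (m + 1) (mmap i P) (mmap i E) ≠ 0) (t : K)
    (hr : (resultant (fp d m (mmap i P) (mmap i E))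
      (dt (fp d m (mmap i P) (mmap i E))) (d * (m + 1)) (d * (m + 1))).eval (i t) ≠ 0) :
    npts K P (pen m E 0 t) = ((FQ k (p ^ a)).filter fun y =>
      (fp d m (mmap i P) (mmap i E)).evalEval (i t) y = 0).card := by
  have hQ : 1 < p ^ a := one_lt_pow ha (Fact.out : p.Prime).one_lt
  have hiP := hP.map i
  have hiE := hE.map i
  have hG := pen_hom hE 0 t
  have hiG := pen_hom hiE 0 (i t)
  set c := ci d (m + 1) P E with hcdef
  rw [ci_map] at hc
  have hcc : ci d (m + 1) (mmap i P) (pen m (mmap i E) 0 (i t)) = i c := by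
    rw [ci_pen, pen_zero, ci_map]
  have hc0 : c ≠ 0 := fun h => hc (by rw [← hcdef, h, map_zero])
  have hρ0 : mev ![1, 0, 0] P ≠ 0 := fun h => hρ (by rw [kρ, h, map_zero])
  have hmap : ∀ (x y z : K) (Q : MP K), mev ![i x, i y, i z] (mmap i Q) = i (mev ![x, y, z] Q) := by
    intro x y z Q
    rw [← ln_eval, ← ln_eval, ln_map, eval_map_apply]
  have hpm : mmap i (pen m E 0 t) = pen m (mmap i E) 0 (i t) := by rw [pen_map, map_zero]
  have hzero : ∀ y : k, (fp d m (mmap i P) (mmap i E)).evalEval (i t) (i c * y) = 0 ↔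
      ∃ x, mev ![x, y, 1] (mmap i P) = 0 ∧
        mev ![x, y, 1] (pen m (mmap i E) 0 (i t)) = 0 := by
    intro y
    rw [← map_evalRingHom_eval, fp_ev, ← hcc, ft_eval hiP hρ hiG hn, mul_eq_zero, or_iff_right (pow_ne_zero _ (by rw [hcc]; exact hc)),
      fr_eval, rs_zero hiP hρ hiG]
  have hmap1 : ∀ (x y : K) (Q : MP K), mev ![i x, i y, 1] (mmap i Q) = 0 ↔ mev ![x, y, 1] Q = 0 := by
    intro x y Q
    rw [← map_one i, hmap, map_eq_zero]
  let S := {q : K × K // mev ![q.1, q.2, 1] P = 0 ∧ mev ![q.1, q.2, 1] (pen m E 0 t) = 0}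
  have hnz : ∀ x y : K, ![x, y, 1] ≠ 0 := fun x y h => one_ne_zero (α := K) (by simpa using congrFun h 2)
  have e1 : Nat.card S = npts K P (pen m E 0 t) := by
    refine card_eq_of_bijective (fun q : S => ⟨Projectivization.mk K ![q.1.1, q.1.2, 1] (hnz _ _),
      (mk_rep hP _ _).2 q.2.1, (mk_rep hG _ _).2 q.2.2⟩) ⟨?_, ?_⟩
    · rintro ⟨⟨x, y⟩, h⟩ ⟨⟨x', y'⟩, h'⟩ he
      obtain ⟨l, hl⟩ := (mk_eq_mk_iff' K _ _ _ _).1 (Subtype.ext_iff.1 he)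
      have h2 := congrFun hl 2
      have h0 := congrFun hl 0
      have h1 := congrFun hl 1
      simp at h0 h1 h2
      subst h2
      simp only [one_mul] at h0 h1
      simp [h0, h1]
    · rintro ⟨x, hx1, hx2⟩
      induction x using Projectivization.ind with
      | h v hv =>
      rw [mk_rep hP] at hx1
      rw [mk_rep hG] at hx2
      have hv2 : v 2 ≠ 0 := by
        intro h2
        have hv1 : v 1 ≠ 0 := by
          intro h1
          have hv0 : v 0 ≠ 0 := by
            intro h0; apply hv; rw [vec3 v, h0, h1, h2]; ext i; fin_cases i <;> simp
          have : v = fun i => v 0 * ![1, 0, 0] i := by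
            funext i; fin_cases i <;> simp [h1, h2]
          rw [this, hom_smul hP] at hx1
          exact mul_ne_zero (pow_ne_zero _ hv0) hρ0 hx1
        have hw : v = fun i => v 1 * ![v 0 / v 1, 1, 0] i := by
          funext i; fin_cases i <;> simp [h2, mul_div_cancel₀ _ hv1]
        rw [hw, hom_smul hP] at hx1
        rw [hw, hom_smul hG] at hx2
        have a1 := (mul_eq_zero.1 hx1).resolve_left (pow_ne_zero _ hv1)
        have a2 := (mul_eq_zero.1 hx2).resolve_left (pow_ne_zero _ hv1)
        apply hc
        rw [← hcdef, ← hcc, ci, rs_zero hiP hρ hiG]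
        refine ⟨i (v 0 / v 1), ?_, ?_⟩
        · rw [← map_one i, ← map_zero i, hmap, a1, map_zero]
        · rw [← hpm, ← map_one i, ← map_zero i, hmap, a2, map_zero]
      have hw : v = fun i => v 2 * ![v 0 / v 2, v 1 / v 2, 1] i := by
        funext i; fin_cases i <;> simp [mul_div_cancel₀ _ hv2]
      have a1 := hx1
      have a2 := hx2
      rw [hw, hom_smul hP] at a1
      rw [hw, hom_smul hG] at a2
      refine ⟨⟨(v 0 / v 2, v 1 / v 2), (mul_eq_zero.1 a1).resolve_left (pow_ne_zero _ hv2),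
        (mul_eq_zero.1 a2).resolve_left (pow_ne_zero _ hv2)⟩, ?_⟩
      refine Subtype.ext ((mk_eq_mk_iff' K _ _ _ _).2 ⟨(v 2)⁻¹, ?_⟩)
      funext i; fin_cases i <;> simp [hv2, div_eq_inv_mul]
  rw [← e1, ← card_coe, ← card_eq_fintype_card]
  refine card_eq_of_bijective (fun q : S => ⟨i c * i q.1.2, ?_⟩) ⟨?_, ?_⟩
  · rw [mem_filter, hzero, ← map_mul]
    refine ⟨?_, i q.1.1, (hmap1 _ _ _).2 q.2.1, ?_⟩
    · rw [fix_im ha hK i]; exact mem_map.2 ⟨c * q.1.2, mem_univ _, rfl⟩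
    · rw [← hpm, hmap1]; exact q.2.2
  · rintro ⟨⟨x, y⟩, h1, h2⟩ ⟨⟨x', y'⟩, h1', h2'⟩ he
    have he' := mul_left_cancel₀ hc (Subtype.ext_iff.1 he)
    obtain rfl : y = y' := i.injective he'
    rw [← hmap1] at h1 h2 h1' h2'
    rw [hpm] at h2 h2'
    have := i.injective (uniq hn hiP hiE hρ hr h1 h2 h1' h2')
    simp only at this
    subst this
    rfl
  · rintro ⟨y, hy⟩
    rw [mem_filter, fix_im ha hK i, mem_map] at hy
    obtain ⟨⟨z, -, rfl⟩, hy⟩ := hy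
    have hz : i z = i c * i (z / c) := by rw [← map_mul, mul_div_cancel₀ _ hc0]
    rw [Function.Embedding.coeFn_mk, hz, hzero] at hy
    obtain ⟨x, hx1, hx2⟩ := hy
    have hfr : ∀ Q : MP K, mev ![x, i (z / c), 1] (mmap i Q) = 0 →
        mev ![x ^ p ^ a, i (z / c), 1] (mmap i Q) = 0 := by
      intro Q hQ0
      have h3 := congrArg (iterateFrobenius k p a) hQ0
      have hi : iterateFrobenius k p a (i (z / c)) = i (z / c) := RingHom.congr_fun (frob_fix hK i) _
      rw [← ln_eval, ← eval_map_apply, ← ln_map, ln_eval, MvPolynomial.map_map, frob_fix hK, map_zero, map_one, hi,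
        iterateFrobenius_def] at h3
      exact h3
    have hxx : x ^ p ^ a = x := by
      refine uniq hn hiP hiE hρ hr (hfr _ hx1) ?_ hx1 hx2
      rw [← hpm] at hx2 ⊢
      exact hfr _ hx2
    rw [← mem_FQ hQ, fix_im ha hK i, mem_map] at hxx
    obtain ⟨x0, -, rfl⟩ := hxx
    refine ⟨⟨(x0, z / c), (hmap1 _ _ _).1 hx1, (hmap1 _ _ _).1 (by rw [hpm]; exact hx2)⟩, Subtype.ext ?_⟩
    exact hz.symm

end Cnt
section Cnt2
open Polynomial
variable {k : Type} [Field k] [IsAlgClosed k]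

noncomputable def fixN (n κ : ℕ) : ℕ := (univ.filter (fun σ : Perm (Fin n) => (univ.filter (fun i => σ i = i)).card = κ)).card

open Classical in
theorem count_good (k : Type) [Field k] [IsAlgClosed k] (p : ℕ) [Fact p.Prime] [CharP k p] (d m w h : ℕ) (hn : d * (m + 1) ≠ 0) :
    ∃ B a₀ : ℕ, ∀ a, a₀ ≤ a → ∀ (K : Type) [Field K] [Fintype K], card K = p ^ a → ∀ (i : K →+* k) (P E : MP K)
      (M : Matrix (Fin 3) (Fin 3) K) (c' : Fin (d * (m + 1)) → k), P.IsHomogeneous d → E.IsHomogeneous (m + 1) →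
      Good c' w h d m (mmap i P) (M.map i) (mmap i E) → ∀ κ,
      |((d * (m + 1)).factorial : ℝ) * (univ.filter fun t : K => npts K (cm M P) (pen m E 0 t) = κ).card
        - (p : ℝ) ^ a * fixN (d * (m + 1)) κ| ≤ B * (p : ℝ) ^ (a - a / 2) := by
  obtain ⟨C, a₀, hC⟩ := cheb k p (d * (m + 1)) w h
  refine ⟨C + (d * (m + 1)).factorial * h, a₀ + 1, ?_⟩
  intro a ha K _ _ hK i P E M c' hP hE hg κ
  have ha0 : a ≠ 0 := by omega
  have hcm : cm (M.map i) (mmap i P) = mmap i (cm M P) := (cm_map _ _ _).symm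
  have hfd := ft_deg d (m + 1) (mmap Polynomial.C (cm (M.map i) (mmap i P)))
    (pen m (mmap Polynomial.C (mmap i E)) 0 X)
  have h1 := hC a (by omega) c' (fp d m (cm (M.map i) (mmap i P)) (mmap i E)) hfd.1 hfd.2 ?_ hg.irr hg.b1 hg.b2 hg.b3 hg.r1 hg.r2 κ
  swap
  · intro x y
    rw [hcm, fp_map, bev_ee, bev_ee, ← iterateFrobenius_def, comp_bev, frob_fix hK, iterateFrobenius_def, iterateFrobenius_def]
  set R := resultant (fp d m (cm (M.map i) (mmap i P)) (mmap i E))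
    (dt (fp d m (cm (M.map i) (mmap i P)) (mmap i E))) (d * (m + 1)) (d * (m + 1)) with hR
  have hd1 : R ≠ 0 := hg.d1
  have hd2 : R.natDegree ≤ h := hg.d2
  set A := univ.filter fun t : K => npts K (cm M P) (pen m E 0 t) = κ with hA
  set A' := univ.filter fun t : K => ((FQ k (p^a)).filter fun y =>
    (fp d m (cm (M.map i) (mmap i P)) (mmap i E)).evalEval (i t) y = 0).card = κ with hA'
  set Z := univ.filter fun t : K => R.eval (i t) = 0 with hZ
  have hZc : Z.card ≤ h := by
    refine le_trans ?_ ((card_roots' R).trans hd2)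
    refine le_trans ?_ (toFinset_card_le _)
    refine Finset.card_le_card_of_injOn i ?_ i.injective.injOn
    intro t ht
    simpa [hZ, hd1] using ht
  have hcnt : ∀ t : K, t ∉ Z → npts K (cm M P) (pen m E 0 t) = ((FQ k (p^a)).filter fun y =>
    (fp d m (cm (M.map i) (mmap i P)) (mmap i E)).evalEval (i t) y = 0).card := by
    intro t ht
    have ht' : R.eval (i t) ≠ 0 := fun h => ht (by simp [hZ, h])
    have hrho := hg.rho
    have hci := hg.hci
    rw [hR] at ht'
    rw [hcm] at ht' hrho hci ⊢
    exact npts_eq ha0 hK i hn (cm_hom hP M) hE hrho hci t ht'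
  have h2 : A.card ≤ A'.card + Z.card := by
    refine (card_le_card ?_).trans (card_union_le _ _)
    intro t ht
    by_cases hz : t ∈ Z
    · exact Finset.mem_union_right _ hz
    · refine Finset.mem_union_left _ ?_
      simp only [hA, hA', mem_filter, mem_univ, true_and] at ht ⊢
      rw [← hcnt t hz, ht]
  have h3 : A'.card ≤ A.card + Z.card := by
    refine (card_le_card ?_).trans (card_union_le _ _)
    intro t ht
    by_cases hz : t ∈ Z
    · exact Finset.mem_union_right _ hz
    · refine Finset.mem_union_left _ ?_
      simp only [hA, hA', mem_filter, mem_univ, true_and] at ht ⊢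
      rw [hcnt t hz, ht]
  have h4 : ((FQ k (p^a)).filter fun t => ((FQ k (p^a)).filter fun y =>
    (fp d m (cm (M.map i) (mmap i P)) (mmap i E)).evalEval t y = 0).card = κ).card = A'.card := by
    conv_lhs => rw [fix_im ha0 hK i, Finset.filter_map, card_map]
    rw [hA', fix_im ha0 hK i]
    rfl
  rw [h4] at h1
  have h5 : |(A.card : ℝ) - A'.card| ≤ h := by
    rw [abs_le]
    have e2 : (A.card : ℝ) ≤ A'.card + h := by exact_mod_cast h2.trans (by omega)
    have e3 : (A'.card : ℝ) ≤ A.card + h := by exact_mod_cast h3.trans (by omega)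
    constructor <;> linarith
  have h6 : (1 : ℝ) ≤ (p : ℝ) ^ (a - a / 2) := one_le_pow₀ (by exact_mod_cast (Fact.out : p.Prime).one_lt.le)
  have h7 : ((d * (m + 1)).factorial : ℝ) * A.card - (p : ℝ) ^ a * fixN (d * (m + 1)) κ =
    (((d * (m + 1)).factorial : ℝ) * A'.card - (p : ℝ) ^ a * fixN (d * (m + 1)) κ) + (d * (m + 1)).factorial * ((A.card : ℝ) - A'.card) := by ring
  rw [h7]
  refine (abs_add_le _ _).trans ?_
  rw [abs_mul, abs_of_nonneg (by positivity : (0 : ℝ) ≤ ((d * (m + 1)).factorial : ℝ))]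
  push_cast
  rw [add_mul]
  refine add_le_add h1 ?_
  calc _ ≤ ((d * (m + 1)).factorial : ℝ) * h := by gcongr
    _ ≤ _ := le_mul_of_one_le_right (by positivity) h6
end Cnt2
section Fin1
variable {K : Type} [Field K] [Fintype K]

lemma proj_cnt {V : Type} [AddCommGroup V] [Module K V] (Pr : V → Prop) (h : ∀ (a : Kˣ) v, Pr (a • v) ↔ Pr v) :
    Nat.card {E : Projectivization K V // Pr E.rep} * (card K - 1) = Nat.card {v : V // v ≠ 0 ∧ Pr v} := by
  classical
  rw [← Fintype.card_units, ← card_eq_fintype_card, ← Nat.card_prod]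
  refine card_eq_of_bijective (fun q => ⟨q.2 • q.1.1.rep, (smul_ne_zero_iff_ne _).2 q.1.1.rep_nonzero, (h _ _).2 q.1.2⟩) ⟨?_, ?_⟩
  · rintro ⟨⟨E, hE⟩, a⟩ ⟨⟨E', hE'⟩, b⟩ he
    have he : a • E.rep = b • E'.rep := Subtype.ext_iff.1 he
    obtain rfl : E = E' := by
      rw [← E.mk_rep, ← E'.mk_rep, Projectivization.mk_eq_mk_iff]
      exact ⟨a⁻¹ * b, by rw [mul_smul, ← he, inv_smul_smul]⟩
    have : ((a : K) - b) • E.rep = 0 := by rw [sub_smul, sub_eq_zero]; exact he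
    obtain rfl : a = b := Units.ext (sub_eq_zero.1 ((smul_eq_zero.1 this).resolve_right E.rep_nonzero))
    rfl
  · rintro ⟨v, hv, hp⟩
    obtain ⟨a, ha⟩ := exists_smul_eq_mk_rep K v hv
    exact ⟨(⟨Projectivization.mk K v hv, by rw [← ha, h]; exact hp⟩, a⁻¹), Subtype.ext (by simp [← ha])⟩

lemma q_pos : 0 < card K - 1 := Nat.sub_pos_of_lt Fintype.one_lt_card

lemma npts_vec {d e : ℕ} {P G : MP K} (hP : P.IsHomogeneous d) (hG : G.IsHomogeneous e) :
    npts K P G * (card K - 1) =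
      Nat.card {v : Fin 3 → K // v ≠ 0 ∧ mev v P = 0 ∧ mev v G = 0} := by
  refine proj_cnt (fun v => mev v P = 0 ∧ mev v G = 0) fun a v => ?_
  have : a • v = fun i => (a : K) * v i := rfl
  rw [this, hom_smul hP, hom_smul hG, mul_eq_zero, mul_eq_zero, or_iff_right (pow_ne_zero _ a.ne_zero),
    or_iff_right (pow_ne_zero _ a.ne_zero)]

lemma npts_cm {d e : ℕ} {P G : MP K} (hP : P.IsHomogeneous d) (hG : G.IsHomogeneous e) {M : Matrix (Fin 3) (Fin 3) K}
    (hM : IsUnit M.det) : npts K (cm M P) (cm M G) = npts K P G := by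
  refine Nat.eq_of_mul_eq_mul_right (q_pos (K := K)) ?_
  rw [npts_vec (cm_hom hP M) (cm_hom hG M), npts_vec hP hG]
  let φ : (Fin 3 → K) ≃ (Fin 3 → K) := ⟨M.mulVec, M⁻¹.mulVec,
    fun v => by rw [mulVec_mulVec, nonsing_inv_mul _ hM, one_mulVec],
    fun v => by rw [mulVec_mulVec, mul_nonsing_inv _ hM, one_mulVec]⟩
  refine card_congr (subtypeEquiv φ fun v => ?_)
  rw [cm_eval, cm_eval]
  refine and_congr_left fun _ => not_congr ?_
  rw [← φ.apply_eq_iff_eq, show φ 0 = 0 from Matrix.mulVec_zero M]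

lemma npts_smul (P G : MP K) (a : Kˣ) : npts K P (a • G) = npts K P G := by
  have : (a • G : MP K) = MvPolynomial.C (a : K) * G := by rw [← MvPolynomial.smul_eq_C_mul]; rfl
  simp [npts, this]

open Classical in
noncomputable def cnt (P : MP K) (e κ : ℕ) : ℕ := (univ.filter fun u : Mon e → K => npts K P (Eu u) = κ).card

open Classical in
lemma cnt_cm {d : ℕ} {P : MP K} (hP : P.IsHomogeneous d) (e κ : ℕ) {M : Matrix (Fin 3) (Fin 3) K} (hM : IsUnit M.det) :
    cnt (cm M P) e κ = cnt P e κ := by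
  have key : ∀ N : Matrix (Fin 3) (Fin 3) K, ∀ u : Mon e → K, Eu (fun m : Mon e => (cm N (Eu u)).coeff m.1) = cm N (Eu u) :=
    fun N u => Eu_surj (cm_hom (Eu_hom u) N)
  let φ : (Mon e → K) ≃ (Mon e → K) := ⟨fun u m => (cm M (Eu u)).coeff m.1, fun u m => (cm M⁻¹ (Eu u)).coeff m.1,
    fun u => by funext m; simp only [key, cm_cm, mul_nonsing_inv _ hM, cm_one, Eu_coeff],
    fun u => by funext m; simp only [key, cm_cm, nonsing_inv_mul _ hM, cm_one, Eu_coeff]⟩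
  symm
  refine Finset.card_equiv φ fun u => ?_
  simp only [mem_filter, mem_univ, true_and]
  rw [show Eu (φ u) = cm M (Eu u) from key M u, npts_cm hP (Eu_hom u) hM]

open Classical in
lemma sum_pen (P : MP K) (m κ : ℕ) :
    ∑ u : Mon (m + 1) → K, (univ.filter fun t : K => npts K P (pen m (Eu u) 0 t) = κ).card = card K * cnt P (m + 1) κ := by
  have hz : Finsupp.single (2 : Fin 3) (m + 1) ∈ finsuppAntidiag (univ : Finset (Fin 3)) (m + 1) := by
    rw [mem_mon]; simp
  have h1 : ∀ (u : Mon (m + 1) → K) (t : K), pen m (Eu u) 0 t = Eu (u + single ⟨_, hz⟩ t) := by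
    intro u t
    rw [pen, map_zero, zero_mul, zero_mul, add_zero, Eu, Eu]
    simp only [Pi.add_apply, map_add, sum_add_distrib]
    congr 1
    rw [sum_eq_single ⟨_, hz⟩, single_eq_same, MvPolynomial.X_pow_eq_monomial, MvPolynomial.C_mul_monomial, mul_one]
    · intro b _ hb; rw [single_eq_of_ne hb, map_zero]
    · intro h; exact absurd (mem_univ _) h
  simp only [card_filter, h1]
  rw [sum_comm, card, ← smul_eq_mul, ← sum_const]
  refine sum_congr rfl fun t _ => ?_
  rw [cnt, card_filter]
  exact sum_equiv (Equiv.addRight _) _ _ fun u => rfl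

lemma sz {k : Type} [Field k] {σ : Type} [Fintype σ] (i : K →+* k) {g : MvPolynomial σ k} (hg : g ≠ 0) :
    Nat.card {v : σ → K // mev (fun s => i (v s)) g = 0} * card K ≤ g.totalDegree * card K ^ card σ := by
  classical
  let ε := Fintype.equivFin σ
  let S : Finset k := univ.map ⟨i, i.injective⟩
  have hS : S.card = card K := by rw [card_map, card_univ]
  have hg' : rename ε g ≠ 0 := fun h => hg (MvPolynomial.rename_injective _ ε.injective (by rw [h, map_zero]))
  have h1 := MvPolynomial.schwartz_zippel_totalDegree hg' S
  have hle : Nat.card {v : σ → K // mev (fun s => i (v s)) g = 0} ≤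
      ((Fintype.piFinset fun _ => S).filter fun x => mev x (rename ε g) = 0).card := by
    rw [← card_coe, ← card_eq_fintype_card]
    refine card_le_card_of_injective (fun v => ⟨fun s => i (v.1 (ε.symm s)), ?_⟩) ?_
    · rw [mem_filter, Fintype.mem_piFinset, MvPolynomial.eval_rename]
      refine ⟨fun a => mem_map.2 ⟨_, mem_univ _, rfl⟩, ?_⟩
      have : ((fun s => i (v.1 (ε.symm s))) ∘ ε) = fun s => i (v.1 s) := by funext s; simp
      rw [this, v.2]
    · intro v w h
      refine Subtype.ext (funext fun s => i.injective ?_)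
      simpa using congrFun (Subtype.ext_iff.1 h) (ε s)
  have hQ : (0 : ℚ≥0) < card K := by exact_mod_cast Fintype.card_pos
  rw [hS, div_le_div_iff₀ (pow_pos hQ _) hQ] at h1
  have h2 : ((Fintype.piFinset fun _ => S).filter fun x => mev x (rename ε g) = 0).card * card K ≤
      (rename ε g).totalDegree * card K ^ card σ := by exact_mod_cast h1
  refine (Nat.mul_le_mul_right _ hle).trans (h2.trans (Nat.mul_le_mul_right _ ?_))
  exact MvPolynomial.totalDegree_rename_le _ _

open Classical in
lemma pigeon {k : Type} [Field k] {e : ℕ} (i : K →+* k) {g : MvPolynomial (Va e) k} (hg : g ≠ 0) :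
    ∃ M : Fin 3 × Fin 3 → K, (univ.filter fun u : Mon e → K => mev (fun s => i (Sum.elim M u s)) g = 0).card * card K ≤
      g.totalDegree * card K ^ card (Mon e) := by
  by_contra! hcon
  have h1 := sz i hg
  have h2 : Nat.card {v : Va e → K // mev (fun s => i (v s)) g = 0} =
      ∑ M : Fin 3 × Fin 3 → K, (univ.filter fun u : Mon e → K => mev (fun s => i (Sum.elim M u s)) g = 0).card := by
    rw [card_eq_fintype_card, card_subtype, card_filter]
    simp only [card_filter]
    rw [← Fintype.sum_prod_type']
    exact sum_equiv (Equiv.sumArrowEquivProdArrow _ _ _) _ _ fun v => by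
      simp only [Equiv.sumArrowEquivProdArrow, Equiv.coe_fn_mk, Sum.elim_comp_inl_inr]
  have h3 := Finset.sum_lt_sum_of_nonempty (Finset.univ_nonempty (α := Fin 3 × Fin 3 → K)) (fun M _ => hcon M)
  rw [sum_const, ← sum_mul, ← h2, card_univ, card_fun, smul_eq_mul] at h3
  refine absurd (h3.trans_le h1) ?_
  rw [Fintype.card_sum, pow_add]
  apply not_lt.2; apply le_of_eq; ring
end Fin1
section Fin2

lemma fixN_le (n κ : ℕ) : fixN n κ ≤ n.factorial := by
  refine (card_filter_le _ _).trans ?_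
  rw [card_univ, card_perm, card_fin]

lemma bd0 {nf N Q fx b : ℝ} (h1 : N ≤ Q) (h0 : 0 ≤ N) (h2 : fx ≤ nf) (h3 : 0 ≤ fx) (hb : 0 ≤ b) : |nf * N - Q * fx| ≤ b + nf * Q := by
  have a1 : nf * N ≤ nf * Q := mul_le_mul_of_nonneg_left h1 (h3.trans h2)
  have a2 : Q * fx ≤ Q * nf := mul_le_mul_of_nonneg_left h2 (h0.trans h1)
  have a3 : 0 ≤ nf * N := mul_nonneg (h3.trans h2) h0
  have a4 : 0 ≤ Q * fx := mul_nonneg (h0.trans h1) h3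
  rw [abs_le]; constructor <;> linarith

lemma avg {U : Type} [Fintype U] (N : U → ℕ) (bad : Finset U) {nf Q fx b g s : ℝ} (h1 : fx ≤ nf) (h0 : 0 ≤ fx) (hb : 0 ≤ b) (hg : 0 ≤ g) (hs : 1 ≤ s)
    (hN : ∀ u, (N u : ℝ) ≤ Q) (hgood : ∀ u, u ∉ bad → |nf * N u - Q * fx| ≤ b * s) (hbad : (bad.card : ℝ) * Q ≤ g * card U) :
    |nf * ((∑ u, N u : ℕ) : ℝ) - card U * (Q * fx)| ≤ (b + g * nf) * card U * s := by
  classical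
  have hbd : ∀ u, |nf * N u - Q * fx| ≤ b * s + if u ∈ bad then nf * Q else 0 := by
    intro u
    split_ifs with hu
    · exact bd0 (hN u) (cast_nonneg _) h1 h0 (by positivity)
    · rw [add_zero]; exact hgood u hu
  have htot : nf * ((∑ u, N u : ℕ) : ℝ) - card U * (Q * fx) = ∑ u, (nf * N u - Q * fx) := by
    rw [sum_sub_distrib, ← mul_sum, sum_const, nsmul_eq_mul, card_univ, Nat.cast_sum]
  rw [htot]
  refine (Finset.abs_sum_le_sum_abs _ _).trans ((Finset.sum_le_sum fun u _ => hbd u).trans ?_)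
  rw [sum_add_distrib, sum_const, nsmul_eq_mul, card_univ, Finset.sum_ite_mem, Finset.univ_inter, sum_const, nsmul_eq_mul]
  have hnf := h0.trans h1
  have h7 : (bad.card : ℝ) * (nf * Q) ≤ nf * (g * card U) := by
    rw [mul_left_comm]; exact mul_le_mul_of_nonneg_left hbad hnf
  have h8 : nf * (g * card U) ≤ nf * (g * card U) * s := le_mul_of_one_le_right (by positivity) hs
  linarith

open Classical in
theorem est {k : Type} [Field k] [IsAlgClosed k] {p : ℕ} [Fact p.Prime] [CharP k p] {d : ℕ} (hd : d ≠ 0) {P0 : MP k}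
    (hP0 : P0.IsHomogeneous d) (hirr : Irreducible P0) (htan : SimpleTangencyPlane d P0) (m : ℕ) :
    ∃ B a₀ : ℕ, ∀ a, a₀ ≤ a → ∀ (K : Type) [Field K] [Fintype K], card K = p ^ a → ∀ (i : K →+* k) (P : MP K),
      P.IsHomogeneous d → mmap i P = P0 → ∀ κ,
      |((d * (m + 1)).factorial : ℝ) * (p ^ a * cnt P (m + 1) κ) - ((p : ℝ) ^ a) ^ card (Mon (m + 1)) * (p ^ a * fixN (d * (m + 1)) κ)| ≤
        B * ((p : ℝ) ^ a) ^ card (Mon (m + 1)) * (p : ℝ) ^ (a - a / 2) := by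
  obtain ⟨c', g, w, h, hg, hgood⟩ := univ_good hP0 hirr htan m
  have hn : d * (m + 1) ≠ 0 := mul_ne_zero hd (by omega)
  obtain ⟨B, a₀, hB⟩ := count_good k p d m w h hn
  refine ⟨B + g.totalDegree * (d * (m + 1)).factorial, a₀ + g.totalDegree, ?_⟩
  intro a ha K _ _ hK i P hP hPi κ
  have hp : 1 < p := (Fact.out : p.Prime).one_lt
  obtain ⟨Mv, hMv⟩ := pigeon i hg
  set D := card (Mon (m + 1)) with hD
  set bad := univ.filter fun u : Mon (m + 1) → K => mev (fun s => i (Sum.elim Mv u s)) g = 0 with hbad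
  let M : Matrix (Fin 3) (Fin 3) K := Matrix.of fun x y => Mv (x, y)
  have hG : ∀ u : Mon (m + 1) → K, u ∉ bad → Good c' w h d m (mmap i P) (M.map i) (mmap i (Eu u)) := by
    intro u hu
    have h1 := hgood (fun s => i (Sum.elim Mv u s)) (fun h0 => hu (by simp [hbad, h0]))
    rw [hPi, Eu_map]
    exact h1
  have hdet : IsUnit M.det := by
    have hlt : bad.card < univ.card (α := Mon (m + 1) → K) := by
      rw [card_univ, card_fun, ← hD]
      by_contra! hcon
      have h1 := (Nat.mul_le_mul_right (card K) hcon).trans hMv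
      rw [mul_comm] at h1
      have h2 := Nat.le_of_mul_le_mul_right h1 (pow_pos Fintype.card_pos _)
      rw [hK] at h2
      have := Nat.lt_pow_self hp (n := a)
      omega
    obtain ⟨u, -, hu⟩ := Finset.exists_mem_notMem_of_card_lt_card hlt
    have h1 := (hG u hu).det
    rw [isUnit_iff_ne_zero]
    intro h0
    apply h1
    rw [← mapMatrix_apply, ← map_det, h0, map_zero]
  have hsum := sum_pen (cm M P) m κ
  rw [cnt_cm hP _ _ hdet, hK] at hsum
  have hcardu : (card (Mon (m + 1) → K) : ℝ) = ((p : ℝ) ^ a) ^ D := by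
    rw [card_fun, hK, ← hD, cast_pow, cast_pow]
  have hres := avg (fun u => (univ.filter fun t : K => npts K (cm M P) (pen m (Eu u) 0 t) = κ).card) bad
    (Q := (p : ℝ) ^ a) (nf := ((d * (m + 1)).factorial : ℝ)) (fx := fixN (d * (m + 1)) κ) (b := B) (g := g.totalDegree) (s := (p : ℝ) ^ (a - a / 2))
    (by exact_mod_cast fixN_le _ _) (cast_nonneg _) (cast_nonneg _) (cast_nonneg _) (one_le_pow₀ (by exact_mod_cast hp.le))
    (fun u => by
      have := card_filter_le (univ : Finset K) (fun t : K => npts K (cm M P) (pen m (Eu u) 0 t) = κ)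
      rw [card_univ, hK] at this
      rw [← cast_pow]
      exact cast_le.2 this)
    (fun u hu => hB a (by omega) K hK i P (Eu u) M c' hP (Eu_hom u) (hG u hu) κ)
    (by rw [hK] at hMv; rw [hcardu, ← cast_pow, ← cast_pow, ← cast_mul, ← cast_mul]; exact cast_le.2 hMv)
  rw [hsum, hcardu] at hres
  rw [Nat.cast_add, cast_mul, ← cast_pow, ← cast_mul, cast_pow]
  exact hres

lemma prob_cnt {K : Type} [Field K] [Fintype K] (P : MP K) (e κ : ℕ) :
    ∃ T : ℕ, T ≤ cnt P e κ ∧ cnt P e κ ≤ T + 1 ∧ probCurve K P e κ = T / ((card K : ℝ) ^ card (Mon e) - 1) := by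
  classical
  let V := homogeneousSubmodule (Fin 3) K e
  let φ : (Mon e → K) ≃ V := ⟨fun u => ⟨Eu u, (mem_homogeneousSubmodule _ _).2 (Eu_hom u)⟩, fun E m => E.1.coeff m.1,
    fun u => by funext m; exact Eu_coeff u m,
    fun E => Subtype.ext (Eu_surj ((mem_homogeneousSubmodule _ _).1 E.2))⟩
  have hfin : Finite V := Finite.of_equiv _ φ
  have hcard : Nat.card V = card K ^ card (Mon e) := by
    rw [← card_congr φ, card_eq_fintype_card, card_fun]
  have hT := proj_cnt (K := K) (V := V) (fun E => npts K P E.1 = κ) (fun a E => by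
    rw [show (a • E).1 = a • E.1 from rfl, npts_smul])
  have hall := Projectivization.card' K V
  rw [hcard, card_eq_fintype_card (α := K)] at hall
  have hc : cnt P e κ = Nat.card {E : V // npts K P E.1 = κ} := by
    rw [cnt, ← card_subtype, ← card_eq_fintype_card]
    exact card_congr (subtypeEquiv φ fun u => Iff.rfl)
  refine ⟨Nat.card {E : V // E ≠ 0 ∧ npts K P E.1 = κ}, ?_, ?_, ?_⟩
  · rw [hc]
    exact card_le_card_of_injective (fun E => ⟨E.1, E.2.2⟩) fun E E' h => Subtype.ext (congrArg (fun z => z.1) h)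
  · rw [hc, ← Nat.card_unique (α := Unit), ← Nat.card_sum]
    refine card_le_card_of_injective (fun E => if h : E.1 = 0 then Sum.inr () else Sum.inl ⟨E.1, h, E.2⟩) ?_
    intro E E' h
    simp only at h
    split_ifs at h with h1 h2 h2
    · exact Subtype.ext (h1.trans h2.symm)
    · exact Subtype.ext (congrArg (fun z => z.1) (Sum.inl.inj h))
  · have hq : ((card K - 1 : ℕ) : ℝ) ≠ 0 := by exact_mod_cast (q_pos (K := K)).ne'
    rw [← hT]
    have : ((card K : ℝ) ^ card (Mon e) - 1) = Nat.card (Projectivization K V) * (card K - 1 : ℕ) := by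
      rw [sub_eq_iff_eq_add]; exact_mod_cast hall
    rw [this, cast_mul, mul_div_mul_right _ _ hq]
    rfl
end Fin2
section Fin3

lemma fin_est {nf fx B X Q s r c T : ℝ} (hQ : Q = s * r) (hs : 0 < s) (hr : 0 < r) (hrX : r ≤ X) (hX : 2 ≤ X) (hB : 0 ≤ B)
    (h : |nf * (Q * c) - X * (Q * fx)| ≤ B * X * s) (h1 : T ≤ c) (h2 : c ≤ T + 1) (hf0 : 0 ≤ fx) (hf : fx ≤ nf) (hn : 1 ≤ nf) :
    |T / (X - 1) - fx / nf| ≤ (2 * B + 4) / r := by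
  have e1 : nf * (Q * c) - X * (Q * fx) = s * (r * (nf * c - X * fx)) := by rw [hQ]; ring
  rw [e1, abs_mul, abs_of_pos hs, abs_mul, abs_of_pos hr, mul_comm (B * X)] at h
  have h3 := le_of_mul_le_mul_left h hs
  have hX1 : 0 < X - 1 := by linarith
  have hnf : 0 < nf := by linarith
  have e2 : T / (X - 1) - fx / nf = (nf * T - (X - 1) * fx) / ((X - 1) * nf) := by field_simp
  rw [e2, abs_div, abs_of_pos (mul_pos hX1 hnf), div_le_div_iff₀ (mul_pos hX1 hnf) hr]
  have h4 : |nf * T - (X - 1) * fx| ≤ |nf * c - X * fx| + 2 * nf := by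
    have e3 : nf * T - (X - 1) * fx = (nf * c - X * fx) + (fx - nf * (c - T)) := by ring
    rw [e3]
    refine (abs_add_le _ _).trans (add_le_add le_rfl ?_)
    have a1 : nf * (c - T) ≤ nf * 1 := mul_le_mul_of_nonneg_left (by linarith) hnf.le
    have a2 : 0 ≤ nf * (c - T) := mul_nonneg hnf.le (by linarith)
    rw [abs_le]; constructor <;> linarith
  have h5 : |nf * T - (X - 1) * fx| * r ≤ B * X + 2 * nf * X := by
    refine (mul_le_mul_of_nonneg_right h4 hr.le).trans ?_
    rw [add_mul, mul_comm _ r]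
    refine add_le_add h3 ?_
    gcongr
  refine h5.trans ?_
  have h6 : X ≤ 2 * (X - 1) := by linarith
  have h7 : B * X ≤ 2 * B * ((X - 1) * nf) := by
    have : X ≤ 2 * (X - 1) * nf := h6.trans (le_mul_of_one_le_right (by linarith) hn)
    calc _ ≤ B * (2 * (X - 1) * nf) := by gcongr
      _ = _ := by ring
  have h8 : 2 * nf * X ≤ 4 * ((X - 1) * nf) := by
    calc _ ≤ 2 * nf * (2 * (X - 1)) := by gcongr
      _ = _ := by ring
  linarith

theorem main_lim
    (F : Type) [Field F] [Fintype F]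
    (K : ℕ → Type) [∀ N, Field (K N)] [∀ N, Fintype (K N)] [∀ N, Algebra F (K N)]
    (hcard : ∀ N, 1 ≤ N → card (K N) = card F ^ N)
    (d : ℕ) (P : MvPolynomial (Fin 3) F) (hhom : P.IsHomogeneous d)
    (hirr : Irreducible (mmap (aM F (AlgebraicClosure F)) P))
    (htan : SimpleTangencyPlane d
      (mmap (aM F (AlgebraicClosure F)) P))
    (e : ℕ) (k : ℕ) (hk : k ≤ d * e) :
    Filter.Tendsto
      (fun N => probCurve (K N) (mmap (aM F (K N)) P) e k)
      Filter.atTop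
      (nhds (∑ s ∈ Icc k (d * e),
        (-1 : ℝ) ^ (k + s) / (Nat.factorial s) * (Nat.choose s k))) := by
  have hd2 := (nform (hhom.map _) hirr htan).1
  rcases e with _ | m
  · obtain rfl : k = 0 := by simpa using hk
    have h1 : ∀ N, probCurve (K N) (mmap (aM F (K N)) P) 0 0 = 1 := by
      intro N
      have hall : ∀ E : Projectivization (K N) (homogeneousSubmodule (Fin 3) (K N) 0), Nat.card {x : P2 (K N) //
        mev x.rep (mmap (aM F (K N)) P) = 0 ∧ mev x.rep (E.rep : MP (K N)) = 0} = 0 := by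
        intro E
        have hE := (mem_homogeneousSubmodule _ _).1 E.rep.2
        rw [← MvPolynomial.totalDegree_zero_iff_isHomogeneous, MvPolynomial.totalDegree_eq_zero_iff_eq_C] at hE
        have : IsEmpty {x : P2 (K N) // mev x.rep (mmap (aM F (K N)) P) = 0 ∧
            mev x.rep (E.rep : MP (K N)) = 0} := by
          refine ⟨fun ⟨x, _, h2⟩ => E.rep_nonzero (Subtype.ext ?_)⟩
          rw [hE, MvPolynomial.eval_C] at h2
          rw [hE, h2, map_zero]; rfl
        exact Nat.card_of_isEmpty
      have hne : Nat.card (Projectivization (K N) (homogeneousSubmodule (Fin 3) (K N) 0)) ≠ 0 := by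
        have hfin : Finite (homogeneousSubmodule (Fin 3) (K N) 0) :=
          Finite.of_surjective (fun u : Mon 0 → K N => ⟨Eu u, (mem_homogeneousSubmodule _ _).2 (Eu_hom u)⟩)
            fun E => ⟨_, Subtype.ext (Eu_surj ((mem_homogeneousSubmodule _ _).1 E.2))⟩
        have hnt : Nonempty (Projectivization (K N) (homogeneousSubmodule (Fin 3) (K N) 0)) :=
          ⟨Projectivization.mk _ ⟨1, (mem_homogeneousSubmodule _ _).2 (isHomogeneous_one _ _)⟩
            fun h => one_ne_zero (Subtype.ext_iff.1 h)⟩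
        exact Nat.card_pos.ne'
      rw [probCurve, card_congr (Equiv.subtypeUnivEquiv hall), div_self (Nat.cast_ne_zero.2 hne)]
    simp only [h1]
    simp
  obtain ⟨p, hp⟩ := CharP.exists F
  obtain ⟨⟨r, hr0⟩, hpp, hr⟩ := FiniteField.card F p
  rw [PNat.mk_coe] at hr
  have : Fact p.Prime := ⟨hpp⟩
  have : CharP (AlgebraicClosure F) p := charP_of_injective_algebraMap (aM F _).injective p
  obtain ⟨B, a₀, hB⟩ := est (k := AlgebraicClosure F) (p := p) (by omega) (hhom.map _) hirr htan m
  rw [← fix_formula (d * (m + 1)) k hk]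
  have hp1 : 1 < p := hpp.one_lt
  refine tendsto_sub_nhds_zero_iff.1 (squeeze_zero_norm' (a := fun N => (2 * (B : ℝ) + 4) / (p : ℝ) ^ ((r * N) / 2)) ?_ ?_)
  · filter_upwards [Filter.eventually_ge_atTop (a₀ + 1)] with N hN
    have hKc : card (K N) = p ^ (r * N) := by rw [hcard N (by omega), hr, pow_mul]
    have haa : N ≤ r * N := le_mul_of_pos_left _ hr0
    have : Module.Finite F (K N) := Module.Finite.of_finite
    let i : K N →ₐ[F] AlgebraicClosure F := lift
    have hPi : mmap (i : K N →+* AlgebraicClosure F) (mmap (aM F (K N)) P) =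
        mmap (aM F (AlgebraicClosure F)) P := by
      rw [MvPolynomial.map_map, AlgHom.comp_algebraMap]
    have h1 := hB (r * N) (by omega) (K N) hKc i _ (hhom.map _) hPi k
    obtain ⟨T, hT1, hT2, hpr⟩ := prob_cnt (mmap (aM F (K N)) P) (m + 1) k
    rw [hpr, hKc, cast_pow, Real.norm_eq_abs]
    have hz : Nonempty (Mon (m + 1)) := ⟨⟨Finsupp.single 0 (m + 1), by rw [mem_mon]; simp⟩⟩
    have hD : card (Mon (m + 1)) ≠ 0 := Fintype.card_ne_zero
    have hpR : (1 : ℝ) ≤ p := by exact_mod_cast hp1.le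
    have hX : (p : ℝ) ^ (r * N) ≤ ((p : ℝ) ^ (r * N)) ^ card (Mon (m + 1)) := le_self_pow₀ (one_le_pow₀ hpR) hD
    have hX1 : (p : ℝ) ≤ (p : ℝ) ^ (r * N) := le_self_pow₀ hpR (by omega)
    have hp2 : (2 : ℝ) ≤ p := by exact_mod_cast hp1
    have hp0 : (0 : ℝ) < p := by linarith
    refine fin_est (Q := (p : ℝ) ^ (r * N)) (s := (p : ℝ) ^ (r * N - r * N / 2)) (c := cnt (mmap (aM F (K N)) P) (m + 1) k)
      ?_ (pow_pos hp0 _) (pow_pos hp0 _)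
      ((pow_le_pow_right₀ hpR (Nat.div_le_self _ _)).trans hX) (hp2.trans (hX1.trans hX)) (cast_nonneg _) h1 (cast_le.2 hT1)
      (by exact_mod_cast hT2) (cast_nonneg _) (cast_le.2 (fixN_le _ _)) (by exact_mod_cast Nat.factorial_pos _)
    rw [← pow_add, Nat.sub_add_cancel (Nat.div_le_self _ _)]
  · refine Filter.Tendsto.div_atTop tendsto_const_nhds ((tendsto_pow_atTop_atTop_of_one_lt (by exact_mod_cast hp1)).comp ?_)
    refine Filter.tendsto_atTop_mono (fun N => ?_) (Nat.tendsto_div_const_atTop (n := 2) (by norm_num))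
    exact Nat.div_le_div_right (le_mul_of_pos_left _ hr0)
end Fin3
end IncidenceProb
end Mine

open MvPolynomial Filter
namespace IncidenceProb

theorem statement14
    (F : Type) [Field F] [Fintype F]
    (K : ℕ → Type) [∀ N, Field (K N)] [∀ N, Fintype (K N)] [∀ N, Algebra F (K N)]
    (hcard : ∀ N, 1 ≤ N → Fintype.card (K N) = Fintype.card F ^ N)
    (d : ℕ) (P : MvPolynomial (Fin 3) F)
    (hP0 : P ≠ 0) (hhom : P.IsHomogeneous d)
    (hirr : Irreducible (MvPolynomial.map (algebraMap F (AlgebraicClosure F)) P))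
    (htan : SimpleTangencyPlane d
      (MvPolynomial.map (algebraMap F (AlgebraicClosure F)) P))
    (e : ℕ) (k : ℕ) (hk : k ≤ d * e) :
    Filter.Tendsto
      (fun N => probCurve (K N) (MvPolynomial.map (algebraMap F (K N)) P) e k)
      Filter.atTop
      (nhds (∑ s ∈ Finset.Icc k (d * e),
        (-1 : ℝ) ^ (k + s) / (Nat.factorial s) * (Nat.choose s k))) := by
  exact main_lim F K hcard d P hhom hirr htan e k hk

end IncidenceProb
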